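/- Let G be a 4-connected graph that belongs neither to 𝓒 nor to 𝓛. If G is planar, then there exists a (G, C²₆)-chain; if G is nonplanar, then there exists a (G, C²₅)-chain. -/

import Mathlib

open SimpleGraph

/-- `H` is a minor of `G`: there is a family of nonempty, pairwise disjoint,
connected branch sets in `G`, one for each vertex of `H`, such that adjacent
vertices of `H` have branch sets joined by an edge of `G`. -/
def SimpleGraph.IsMinorOf {W V : Type*} (H : SimpleGraph W) (G : SimpleGraph V) : Prop :=
  ∃ φ : W → Set V,
    (∀ w, (φ w).Nonempty) ∧
    (∀ w, (G.induce (φ w)).Connected) ∧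
    (Pairwise fun w₁ w₂ => Disjoint (φ w₁) (φ w₂)) ∧
    (∀ ⦃w₁ w₂⦄, H.Adj w₁ w₂ → ∃ a ∈ φ w₁, ∃ b ∈ φ w₂, G.Adj a b)

/-- The square `C²ₙ` of the `n`-cycle. -/
def cycleSq (n : ℕ) : SimpleGraph (ZMod n) :=
  SimpleGraph.fromRel fun i j => j = i + 1 ∨ j = i + 2

/-- A graph is 4-connected if it has at least five vertices and deleting any set
of at most three vertices leaves it connected. -/
def FourConnected {V : Type*} (G : SimpleGraph V) : Prop :=
  5 ≤ Nat.card V ∧ ∀ S : Set V, S.ncard ≤ 3 → (G.induce Sᶜ).Connected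

/-- A cubic graph: every vertex has degree 3. -/
def IsCubic {V : Type*} (G : SimpleGraph V) : Prop :=
  ∀ v : V, (G.neighborSet v).ncard = 3

/-- A graph is cyclically 4-connected if no set of fewer than four edges
separates it into two parts each containing a cycle; equivalently, every vertex
partition with a cycle on both sides is crossed by at least four edges. -/
def CyclicallyFourConnected {V : Type*} (G : SimpleGraph V) : Prop :=
  ∀ A : Set V, ¬ (G.induce A).IsAcyclic → ¬ (G.induce Aᶜ).IsAcyclic →
    4 ≤ {e : Sym2 V | e ∈ G.edgeSet ∧ ∃ a ∈ A, ∃ b ∈ Aᶜ, e = s(a, b)}.ncard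

/-- Planarity, via Wagner's characterization: a graph is planar iff it has
no `K₅` minor and no `K₃,₃` minor. -/
def IsPlanar {V : Type*} (G : SimpleGraph V) : Prop :=
  ¬ SimpleGraph.IsMinorOf (⊤ : SimpleGraph (Fin 5)) G ∧
  ¬ SimpleGraph.IsMinorOf (completeBipartiteGraph (Fin 3) (Fin 3)) G

/-- Contraction of the edge `uv` of `G` (the vertex `v` is merged into `u`),
parallel edges being simplified. -/
def contractEdge {V : Type} (G : SimpleGraph V) (u v : V) :
    SimpleGraph {w : V // w ≠ v} :=
  SimpleGraph.fromRel fun a b => G.Adj a b ∨ ((a : V) = u ∧ G.Adj v b)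

/-- A packaged graph. -/
structure PGraph : Type 1 where
  V : Type
  G : SimpleGraph V

/-- A `(G, H)`-chain: a sequence of 4-connected graphs starting at `G` and
ending at `H`, in which each graph is obtained from the previous one by
contracting an edge. -/
def IsContractionChain {V W : Type*} (G : SimpleGraph V) (H : SimpleGraph W)
    (n : ℕ) (seq : Fin (n + 1) → PGraph) : Prop :=
  Nonempty ((seq 0).G ≃g G) ∧ Nonempty ((seq (Fin.last n)).G ≃g H) ∧
  (∀ i, FourConnected (seq i).G) ∧
  ∀ i : Fin n, ∃ u v : (seq i.castSucc).V, (seq i.castSucc).G.Adj u v ∧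
    Nonempty ((seq i.succ).G ≃g contractEdge (seq i.castSucc).G u v)

section Separations

set_option linter.unusedSectionVars false

open Finset

/-- The finsets `A` and `B` are disjoint and no edge of `G` joins them. -/
def IsSep {V : Type*} (G : SimpleGraph V) (A B : Finset V) : Prop :=
  Disjoint A B ∧ ∀ a ∈ A, ∀ b ∈ B, ¬ G.Adj a b

/-- Finset form of 4-connectivity. -/
def Conn4 {V : Type*} [Fintype V] (G : SimpleGraph V) : Prop :=
  5 ≤ Fintype.card V ∧ ∀ A B : Finset V, IsSep G A B → A.Nonempty → B.Nonempty →
    #A + #B + 4 ≤ Fintype.card V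

/-- A separation whose separating set `(A ∪ B)ᶜ` has exactly four vertices. -/
def IsTight {V : Type*} [Fintype V] (G : SimpleGraph V) (A B : Finset V) : Prop :=
  IsSep G A B ∧ A.Nonempty ∧ B.Nonempty ∧ #A + #B + 4 = Fintype.card V

/-- No four-vertex separating set contains both `p` and `q`. -/
def Contr {V : Type*} [Fintype V] (G : SimpleGraph V) (p q : V) : Prop :=
  ∀ A B : Finset V, IsTight G A B → p ∉ A → p ∉ B → q ∉ A → q ∉ B → False

open Classical in
/-- The neighbourhood of a vertex as a finset. -/
noncomputable def nb {V : Type*} [Fintype V] (G : SimpleGraph V) (u : V) : Finset V :=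
  univ.filter (G.Adj u)

variable {V : Type*} [Fintype V] {G : SimpleGraph V} {A B A' B' : Finset V}

@[simp] lemma mem_nb {u w : V} : w ∈ nb G u ↔ G.Adj u w := by simp [nb]

lemma IsSep.symm (h : IsSep G A B) : IsSep G B A :=
  ⟨h.1.symm, fun a ha b hb e => h.2 b hb a ha e.symm⟩

lemma IsTight.symm (h : IsTight G A B) : IsTight G B A :=
  ⟨h.1.symm, h.2.2.1, h.2.1, by have := h.2.2.2; omega⟩

lemma Contr.symm {p q : V} (h : Contr G p q) : Contr G q p :=
  fun A B ht a b c d => h A B ht c d a b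

lemma not_contr {p q : V} (h : ¬ Contr G p q) :
    ∃ A B, IsTight G A B ∧ p ∉ A ∧ p ∉ B ∧ q ∉ A ∧ q ∉ B := by
  unfold Contr at h; push Not at h
  obtain ⟨A, B, h1, h2, h3, h4, h5, -⟩ := h
  exact ⟨A, B, h1, h2, h3, h4, h5⟩

lemma IsTight.notMem_of_mem_left (h : IsTight G A B) {x : V} (hx : x ∈ A) : x ∉ B :=
  Finset.disjoint_left.1 h.1.1 hx

lemma IsTight.notMem_of_adj (h : IsTight G A B) {x y : V} (hx : x ∈ A) (e : G.Adj x y) : y ∉ B :=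
  fun hy => h.1.2 x hx y hy e

variable [DecidableEq V]

lemma card_split (X : Finset V) (h' : Disjoint A' B') :
    #X = #(X ∩ A') + #(X ∩ B') + #(X \ (A' ∪ B')) := by
  have h1 := card_inter_add_card_sdiff X (A' ∪ B')
  rw [inter_union_distrib_left, card_union_of_disjoint] at h1
  · exact h1.symm
  · exact Disjoint.mono inter_subset_right inter_subset_right h'

/-- The cardinalities of the nine cells cut out by two disjoint pairs. -/
lemma card_cells (h : Disjoint A B) (h' : Disjoint A' B') :
    #A = #(A ∩ A') + #(A ∩ B') + #(A \ (A' ∪ B')) ∧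
    #B = #(B ∩ A') + #(B ∩ B') + #(B \ (A' ∪ B')) ∧
    #A' = #(A ∩ A') + #(B ∩ A') + #(A' \ (A ∪ B)) ∧
    #B' = #(A ∩ B') + #(B ∩ B') + #(B' \ (A ∪ B)) ∧
    Fintype.card V = #A + #B + #(A' \ (A ∪ B)) + #(B' \ (A ∪ B)) +
      #(((A ∪ B) ∪ (A' ∪ B'))ᶜ) := by
  refine ⟨card_split A h', card_split B h', ?_, ?_, ?_⟩
  · rw [inter_comm A, inter_comm B]; exact card_split A' h
  · rw [inter_comm A, inter_comm B]; exact card_split B' h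
  · rw [card_compl]
    have h1 : #((A ∪ B) ∪ (A' ∪ B')) = #A + #B + #(A' \ (A ∪ B)) + #(B' \ (A ∪ B)) := by
      rw [← union_sdiff_self_eq_union, card_union_of_disjoint disjoint_sdiff,
        card_union_of_disjoint h, union_sdiff_distrib, card_union_of_disjoint]
      · omega
      · exact h'.mono sdiff_subset sdiff_subset
    have h2 : #((A ∪ B) ∪ (A' ∪ B')) ≤ Fintype.card V := card_le_univ _
    omega

lemma IsSep.inter_union (h : IsSep G A B) (h' : IsSep G A' B') : IsSep G (A ∩ A') (B ∪ B') := by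
  constructor
  · rw [disjoint_union_right]
    exact ⟨h.1.mono_left inter_subset_left, h'.1.mono_left inter_subset_right⟩
  · intro a ha b hb
    rw [mem_inter] at ha
    rcases mem_union.1 hb with hb | hb
    exacts [h.2 a ha.1 b hb, h'.2 a ha.2 b hb]

lemma IsSep.corner (hc : Conn4 G) (h : IsSep G A B) (h' : IsSep G A' B')
    (ne : (A ∩ A').Nonempty) (hB : B.Nonempty) :
    #(A ∩ A') + #B + #B' + 4 ≤ Fintype.card V + #(B ∩ B') := by
  have h1 := hc.2 _ _ (h.inter_union h') ne (hB.mono subset_union_left)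
  have := card_union_add_card_inter B B'
  omega

lemma IsTight.exists_adj_left (hc : Conn4 G) (h : IsTight G A B) {t : V} (hA : t ∉ A)
    (hB : t ∉ B) : ∃ a ∈ A, G.Adj t a := by
  by_contra! hcon
  have hs : IsSep G A (insert t B) := by
    constructor
    · rw [disjoint_insert_right]; exact ⟨hA, h.1.1⟩
    · intro a ha b hb
      rcases mem_insert.1 hb with rfl | hb
      exacts [fun e => hcon a ha e.symm, h.1.2 a ha b hb]
  have := hc.2 _ _ hs h.2.1 (by simp)
  rw [card_insert_of_notMem hB] at this
  have := h.2.2.2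
  omega

lemma IsTight.exists_adj_right (hc : Conn4 G) (h : IsTight G A B) {t : V} (hA : t ∉ A)
    (hB : t ∉ B) : ∃ b ∈ B, G.Adj t b :=
  h.symm.exists_adj_left hc hB hA

/-- A vertex set with few outside neighbours dominates the graph. -/
lemma Conn4.card_nbrs (hc : Conn4 G) {A N : Finset V} (hA : A.Nonempty)
    (hN : ∀ a ∈ A, ∀ w, G.Adj a w → w ∈ A ∪ N) (hcard : #N ≤ 3) : A ∪ N = univ := by
  by_contra hne
  have hs : IsSep G A (A ∪ N)ᶜ := by
    constructor
    · exact disjoint_compl_right.mono_left subset_union_left |>.mono_right le_rfl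
    · intro a ha b hb e
      exact (mem_compl.1 hb) (hN a ha b e)
  have hne' : ((A ∪ N)ᶜ).Nonempty := by
    rw [nonempty_iff_ne_empty, Ne, compl_eq_empty_iff]; exact hne
  have := hc.2 _ _ hs hA hne'
  have h1 := card_union_le A N
  have h2 := card_compl (A ∪ N)
  have h3 : #(A ∪ N) ≤ Fintype.card V := card_le_univ _
  omega

lemma Conn4.four_le_nb (hc : Conn4 G) (u : V) : 4 ≤ #(nb G u) := by
  classical
  by_contra! hlt
  have := hc.card_nbrs (A := {u}) (N := nb G u) (by simp)
    (by simp +contextual) (by omega)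
  have h1 := card_union_le {u} (nb G u)
  rw [this, card_univ] at h1
  have := hc.1
  simp at h1
  omega

lemma IsTight.adj_of_singleton (hc : Conn4 G) {f : V} (h : IsTight G {f} B) (w : V) :
    G.Adj f w ↔ w ≠ f ∧ w ∉ B := by
  constructor
  · intro e
    exact ⟨fun hw => (hw ▸ e).ne rfl, h.notMem_of_adj (by simp) e⟩
  · rintro ⟨h1, h2⟩
    obtain ⟨a, ha, e⟩ := h.exists_adj_left hc (t := w) (by simpa using h1) h2
    rw [mem_singleton] at ha
    exact (ha ▸ e).symm

lemma IsTight.nb_of_singleton (hc : Conn4 G) {f : V} (h : IsTight G {f} B) : #(nb G f) = 4 := by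
  have : nb G f = ({f} ∪ B)ᶜ := by
    ext w; simp [h.adj_of_singleton hc w]
  rw [this, card_compl, card_union_of_disjoint h.1.1]
  have := h.2.2.2
  omega

/-- A minimal side of the tight separations whose separator spans an edge. -/
theorem atom_bound (hc : Conn4 G) (h : IsTight G A B)
    (hmin : ∀ A' B', IsTight G A' B' →
      (∃ p q, G.Adj p q ∧ p ∉ A' ∧ p ∉ B' ∧ q ∉ A' ∧ q ∉ B') → #A ≤ #A')
    (hmin0 : #A ≤ #B) {p q : V} (hpq : G.Adj p q) (hp : p ∈ A) (hn : ¬ Contr G p q) :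
    #A ≤ 2 ∧ (q ∉ A → #A = 1) := by
  obtain ⟨A', B', h', p1, p2, q1, q2⟩ := not_contr hn
  have hqB : q ∉ B := h.notMem_of_adj hp hpq
  have key : ∀ A' B', IsTight G A' B' → p ∉ A' → p ∉ B' → q ∉ A' → q ∉ B' → #(A ∩ A') = 0 := by
    intro A' B' h' p1 p2 q1 q2
    obtain ⟨c1, c2, c3, c4, c5⟩ := card_cells h.1.1 h'.1.1
    have mA := hmin A' B' h' ⟨p, q, hpq, p1, p2, q1, q2⟩
    have mB := hmin B' A' h'.symm ⟨p, q, hpq, p2, p1, q2, q1⟩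
    have t1 := h.2.2.2
    have t2 := h'.2.2.2
    by_contra hne
    have ne : (A ∩ A').Nonempty := card_pos.1 (Nat.pos_of_ne_zero hne)
    have k1 := h.1.corner hc h'.1 ne h.2.2.1
    by_cases he : #(B ∩ B') = 0
    · omega
    · have ne2 : (B ∩ B').Nonempty := card_pos.1 (Nat.pos_of_ne_zero he)
      have k2 := h.1.symm.corner hc h'.1.symm ne2 h.2.1
      have k3 := card_union_add_card_inter B B'
      have ht : IsTight G (A ∩ A') (B ∪ B') :=
        ⟨h.1.inter_union h'.1, ne, h.2.2.1.mono subset_union_left, by omega⟩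
      have hpB := h.notMem_of_mem_left hp
      have := hmin _ _ ht ⟨p, q, hpq, by simp [p1], by simp [p2, hpB], by simp [q1],
        by simp [q2, hqB]⟩
      have hlt : #(A ∩ A') < #A := card_lt_card ⟨inter_subset_left, fun hs =>
        p1 (mem_inter.1 (hs hp)).2⟩
      omega
  obtain ⟨c1, c2, c3, c4, c5⟩ := card_cells h.1.1 h'.1.1
  have mA := hmin A' B' h' ⟨p, q, hpq, p1, p2, q1, q2⟩
  have mB := hmin B' A' h'.symm ⟨p, q, hpq, p2, p1, q2, q1⟩
  have t1 := h.2.2.2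
  have t2 := h'.2.2.2
  have z1 := key A' B' h' p1 p2 q1 q2
  have z2 := key B' A' h'.symm p2 p1 q2 q1
  have e1 : #(B ∩ B') = 0 ∨ #(B ∩ B') + #A + #A' + 4 ≤ Fintype.card V + #(A ∩ A') := by
    rcases Nat.eq_zero_or_pos #(B ∩ B') with h0 | h0
    exacts [Or.inl h0, Or.inr (h.1.symm.corner hc h'.1.symm (card_pos.1 h0) h.2.1)]
  have e2 : #(B ∩ A') = 0 ∨ #(B ∩ A') + #A + #B' + 4 ≤ Fintype.card V + #(A ∩ B') := by
    rcases Nat.eq_zero_or_pos #(B ∩ A') with h0 | h0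
    exacts [Or.inl h0, Or.inr (h.1.symm.corner hc h'.1 (card_pos.1 h0) h.2.1)]
  refine ⟨by omega, fun hq => ?_⟩
  have : 0 < #(((A ∪ B) ∪ (A' ∪ B'))ᶜ) := card_pos.2 ⟨q, by simp [hq, hqB, q1, q2]⟩
  have := card_pos.2 h.2.1
  omega

end Separations

section DegreeFour

open Finset

set_option linter.unusedSectionVars false

variable {V : Type*} [Fintype V] {G : SimpleGraph V} {A B A' B' : Finset V} [DecidableEq V]

lemma exists_apex_aux (hc : Conn4 G) (h : IsTight G A B) {u b : V} (huA : u ∉ A) (huB : u ∉ B)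
    (hb : b ∈ A) (h' : IsTight G A' B') (u1 : u ∉ A') (u2 : u ∉ B') (b1 : b ∉ A')
    (b2 : b ∉ B') (cA' : #A' = 1) (sA' : #(A' \ (A ∪ B)) = 1) (cA : #(A \ (A' ∪ B')) = 2)
    (cB : #(B \ (A' ∪ B')) = 1) (cS : #(((A ∪ B) ∪ (A' ∪ B'))ᶜ) = 1) :
    ∃ f β γ, f ∉ A ∧ f ∉ B ∧ β ∈ A ∧ γ ∈ B ∧ β ≠ b ∧
      ∀ w, G.Adj f w ↔ w = u ∨ w = b ∨ w = β ∨ w = γ := by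
  obtain ⟨f, rfl⟩ := card_eq_one.1 cA'
  obtain ⟨f', hf'⟩ := card_eq_one.1 sA'
  have hf : f' ∈ ({f} : Finset V) \ (A ∪ B) := by simp [hf']
  simp only [mem_sdiff, mem_singleton, mem_union, not_or] at hf
  obtain ⟨rfl, hfA, hfB⟩ := hf
  obtain ⟨γ, hγ⟩ := card_eq_one.1 cB
  obtain ⟨v, hv⟩ := card_eq_one.1 cS
  have hbm : b ∈ A \ ({f'} ∪ B') := by
    rw [mem_sdiff, mem_union]; exact ⟨hb, fun h => h.elim b1 b2⟩
  have hβ : #((A \ ({f'} ∪ B')).erase b) = 1 := by rw [card_erase_of_mem hbm, cA]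
  obtain ⟨β, hβ⟩ := card_eq_one.1 hβ
  have eβ : ∀ w, (w ≠ b ∧ w ∈ A ∧ ¬ (w = f' ∨ w ∈ B')) ↔ w = β := fun w => by
    have := Finset.ext_iff.1 hβ w; simpa using this
  have eγ : ∀ w, (w ∈ B ∧ ¬ (w = f' ∨ w ∈ B')) ↔ w = γ := fun w => by
    have := Finset.ext_iff.1 hγ w; simpa using this
  have ev : ∀ w, (¬ (w ∈ A ∨ w ∈ B) ∧ ¬ (w = f' ∨ w ∈ B')) ↔ w = v := fun w => by
    have := Finset.ext_iff.1 hv w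
    simp only [mem_compl, mem_union, mem_singleton] at this
    tauto
  rw [mem_singleton] at u1 b1
  have huv : u = v := (ev u).1 ⟨by tauto, by tauto⟩
  have hbB := h.notMem_of_mem_left hb
  refine ⟨f', β, γ, hfA, hfB, ((eβ β).2 rfl).2.1, ((eγ γ).2 rfl).1, ((eβ β).2 rfl).1, fun w => ?_⟩
  rw [h'.adj_of_singleton hc]
  constructor
  · rintro ⟨h1, h2⟩
    by_cases hA : w ∈ A
    · by_cases hwb : w = b
      · tauto
      · right; right; left; exact (eβ w).1 ⟨hwb, hA, by tauto⟩
    · by_cases hB : w ∈ B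
      · right; right; right; exact (eγ w).1 ⟨hB, by tauto⟩
      · left; rw [huv]; exact (ev w).1 ⟨by tauto, by tauto⟩
  · rintro (rfl | rfl | rfl | rfl)
    · exact ⟨u1, u2⟩
    · exact ⟨b1, b2⟩
    · have := ((eβ w).2 rfl).2.2; tauto
    · have := ((eγ w).2 rfl).2; tauto

/-- If `u` lies in a tight separator and has a single neighbour `b` in a side with at least two
vertices, and `ub` is not contractible, then a vertex of degree four in the separator is adjacent
to both `u` and `b`. -/
theorem exists_apex (hc : Conn4 G) (h : IsTight G A B) (hA2 : 2 ≤ #A) {u b : V}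
    (huA : u ∉ A) (huB : u ∉ B) (hb : b ∈ A) (hub : ∀ w ∈ A, G.Adj u w → w = b)
    (hn : ¬ Contr G u b) :
    ∃ f β γ, f ∉ A ∧ f ∉ B ∧ β ∈ A ∧ γ ∈ B ∧ β ≠ b ∧
      ∀ w, G.Adj f w ↔ w = u ∨ w = b ∨ w = β ∨ w = γ := by
  obtain ⟨A', B', h', u1, u2, b1, b2⟩ := not_contr hn
  have hbB := h.notMem_of_mem_left hb
  have t1 := h.2.2.2
  have pS : 0 < #(((A ∪ B) ∪ (A' ∪ B'))ᶜ) := card_pos.2 ⟨u, by simp [huA, huB, u1, u2]⟩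
  have corner : ∀ A' B', IsTight G A' B' → u ∉ A' → u ∉ B' → b ∉ A' → b ∉ B' →
      #(A ∩ A') = 0 ∨ #(A ∩ A') + #B + #B' + 5 ≤ Fintype.card V + #(B ∩ B') := by
    intro A' B' h' u1 u2 b1 b2
    rcases Nat.eq_zero_or_pos #(A ∩ A') with h0 | h0
    · exact Or.inl h0
    right
    have hs := h.1.inter_union h'.1
    have hs' : IsSep G (A ∩ A') (insert u (B ∪ B')) := by
      constructor
      · rw [disjoint_insert_right]
        exact ⟨by simp [huA], hs.1⟩
      · intro a ha w hw
        rcases mem_insert.1 hw with rfl | hw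
        · intro e
          rw [mem_inter] at ha
          exact b1 (hub a ha.1 e.symm ▸ ha.2)
        · exact hs.2 a ha w hw
    have h1 := hc.2 _ _ hs' (card_pos.1 h0) (by simp)
    rw [card_insert_of_notMem (by simp [huB, u2])] at h1
    have := card_union_add_card_inter B B'
    omega
  have corner' : ∀ A' B', IsTight G A' B' →
      #(B ∩ B') = 0 ∨ #(B ∩ B') + #A + #A' + 4 ≤ Fintype.card V + #(A ∩ A') := by
    intro A' B' h'
    rcases Nat.eq_zero_or_pos #(B ∩ B') with h0 | h0
    exacts [Or.inl h0, Or.inr (h.1.symm.corner hc h'.1.symm (card_pos.1 h0) h.2.1)]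
  have meet : ∀ A' B', IsTight G A' B' →
      0 < #(A ∩ A') ∨ 0 < #(B ∩ A') ∨ 1 ≤ #(B \ (A' ∪ B')) := by
    intro A' B' h'
    rcases Nat.eq_zero_or_pos #(A ∩ A') with h1 | h1
    swap
    · exact Or.inl h1
    rcases Nat.eq_zero_or_pos #(B ∩ A') with h2 | h2
    swap
    · exact Or.inr (Or.inl h2)
    refine Or.inr (Or.inr ?_)
    obtain ⟨f, hf⟩ := h'.2.1
    rw [card_eq_zero] at h1 h2
    have f1 : f ∉ A := fun h => notMem_empty f (h1 ▸ mem_inter.2 ⟨h, hf⟩)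
    have f2 : f ∉ B := fun h => notMem_empty f (h2 ▸ mem_inter.2 ⟨h, hf⟩)
    obtain ⟨w, hw, e⟩ := h.exists_adj_right hc f1 f2
    have w1 : w ∉ A' := fun h => notMem_empty w (h2 ▸ mem_inter.2 ⟨hw, h⟩)
    have w2 := h'.notMem_of_adj hf e
    exact card_pos.2 ⟨w, by simp [hw, w1, w2]⟩
  have main : ∀ A' B', IsTight G A' B' → u ∉ A' → u ∉ B' → b ∉ A' → b ∉ B' →
      #(A ∩ A') = 0 → #(B ∩ A') = 0 → #(A' \ (A ∪ B)) = 1 → ∃ f β γ, f ∉ A ∧ f ∉ B ∧ β ∈ A ∧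
      γ ∈ B ∧ β ≠ b ∧ ∀ w, G.Adj f w ↔ w = u ∨ w = b ∨ w = β ∨ w = γ := by
    intro A' B' h' u1 u2 b1 b2 z1 z2 z3
    obtain ⟨c1, c2, c3, c4, c5⟩ := card_cells h.1.1 h'.1.1
    have pS : 0 < #(((A ∪ B) ∪ (A' ∪ B'))ᶜ) := card_pos.2 ⟨u, by simp [huA, huB, u1, u2]⟩
    have m := meet A' B' h'
    have k1 := corner B' A' h'.symm u2 u1 b2 b1
    have k2 := corner' A' B' h'
    have t2 := h'.2.2.2
    have pb : 0 < #(A \ (A' ∪ B')) := card_pos.2 ⟨b, by simp [hb, b1, b2]⟩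
    have hq : 0 < #(A ∩ B') ∨ 2 ≤ #(A \ (A' ∪ B')) := by omega
    exact exists_apex_aux hc h huA huB hb h' u1 u2 b1 b2 (by omega) z3 (by omega) (by omega)
      (by omega)
  have main' := main B' A' h'.symm u2 u1 b2 b1
  have main := main A' B' h' u1 u2 b1 b2
  obtain ⟨c1, c2, c3, c4, c5⟩ := card_cells h.1.1 h'.1.1
  have m1 := meet A' B' h'
  have m2 := meet B' A' h'.symm
  have k1 := corner A' B' h' u1 u2 b1 b2
  have k2 := corner B' A' h'.symm u2 u1 b2 b1
  have k3 := corner' A' B' h'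
  have k4 := corner' B' A' h'.symm
  have t2 := h'.2.2.2
  have q1 := card_pos.2 h'.2.1
  have q2 := card_pos.2 h'.2.2.1
  rw [union_comm B' A'] at m2
  have pB := card_pos.2 h.2.2.1
  have pb : 0 < #(A \ (A' ∪ B')) := card_pos.2 ⟨b, by simp [hb, b1, b2]⟩
  by_cases hz : #(A ∩ A') = 0 ∧ #(B ∩ A') = 0 ∧ #(A' \ (A ∪ B)) = 1
  · exact main hz.1 hz.2.1 hz.2.2
  · exact main' (by omega) (by omega) (by omega)

end DegreeFour

section NoContractible

open Finset

set_option linter.unusedSectionVars false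

variable {V : Type*} [Fintype V] {G : SimpleGraph V} {A B A' B' : Finset V} [DecidableEq V]

lemma card_nb_of_iff {f u b c d : V} (h : ∀ w, G.Adj f w ↔ w = u ∨ w = b ∨ w = c ∨ w = d)
    (h1 : u ≠ b) (h2 : u ≠ c) (h3 : u ≠ d) (h4 : b ≠ c) (h5 : b ≠ d) (h6 : c ≠ d) :
    #(nb G f) = 4 := by
  have : nb G f = {u, b, c, d} := by ext w; simp [h]
  rw [this, card_eq_four]
  exact ⟨u, b, c, d, h1, h2, h3, h4, h5, h6, rfl⟩

lemma adj_iff_of_card_nb {f u b c d : V} (hf : #(nb G f) = 4) (hu : G.Adj f u) (hb : G.Adj f b)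
    (hc : G.Adj f c) (hd : G.Adj f d) (h1 : u ≠ b) (h2 : u ≠ c) (h3 : u ≠ d) (h4 : b ≠ c)
    (h5 : b ≠ d) (h6 : c ≠ d) (w : V) : G.Adj f w ↔ w = u ∨ w = b ∨ w = c ∨ w = d := by
  have h4 : #({u, b, c, d} : Finset V) = 4 :=
    card_eq_four.2 ⟨u, b, c, d, h1, h2, h3, h4, h5, h6, rfl⟩
  have hs : ({u, b, c, d} : Finset V) ⊆ nb G f := by
    intro w hw
    simp only [mem_insert, mem_singleton] at hw
    rcases hw with rfl | rfl | rfl | rfl <;> simpa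
  have := Finset.ext_iff.1 (eq_of_subset_of_card_le hs (by omega)) w
  simpa using this.symm

/-- Complete two neighbours of a vertex of degree four to the whole neighbourhood. -/
lemma exists_adj_iff_two {f u b : V} (hf : #(nb G f) = 4) (hu : G.Adj f u) (hb : G.Adj f b)
    (hub : u ≠ b) : ∃ c d, u ≠ c ∧ u ≠ d ∧ b ≠ c ∧ b ≠ d ∧ c ≠ d ∧
      ∀ w, G.Adj f w ↔ w = u ∨ w = b ∨ w = c ∨ w = d := by
  have h2 : #(((nb G f).erase u).erase b) = 2 := by
    rw [card_erase_of_mem, card_erase_of_mem, hf]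
    · simpa
    · simp [hb, hub.symm]
  obtain ⟨c, d, hcd, he⟩ := card_eq_two.1 h2
  have key : ∀ w, (w ≠ b ∧ w ≠ u ∧ G.Adj f w) ↔ w = c ∨ w = d := fun w => by
    have := Finset.ext_iff.1 he w; simpa using this
  have kc := (key c).2 (Or.inl rfl)
  have kd := (key d).2 (Or.inr rfl)
  exact ⟨c, d, kc.2.1.symm, kd.2.1.symm, kc.1.symm, kd.1.symm, hcd,
    adj_iff_of_card_nb hf hu hb kc.2.2 kd.2.2 hub kc.2.1.symm kd.2.1.symm kc.1.symm kd.1.symm hcd⟩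

lemma exists_adj_iff_three {f u b c : V} (hf : #(nb G f) = 4) (hu : G.Adj f u) (hb : G.Adj f b)
    (hc : G.Adj f c) (hub : u ≠ b) (huc : u ≠ c) (hbc : b ≠ c) :
    ∃ d, u ≠ d ∧ b ≠ d ∧ c ≠ d ∧ ∀ w, G.Adj f w ↔ w = u ∨ w = b ∨ w = c ∨ w = d := by
  obtain ⟨d, e, h1, h2, h3, h4, h5, h6⟩ := exists_adj_iff_two hf hu hb hub
  rcases (h6 c).1 hc with h | h | rfl | rfl
  · exact absurd h.symm huc
  · exact absurd h.symm hbc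
  · exact ⟨e, h2, h4, h5, h6⟩
  · exact ⟨d, h1, h3, h5.symm, fun w => by rw [h6]; tauto⟩

lemma exists_apex_pair (hc : Conn4 G) (hN : ∀ u v, G.Adj u v → #(nb G u) = 4 → ¬ Contr G u v)
    (h : IsTight G A B) (hA2 : 2 ≤ #A) (hB2 : 2 ≤ #B) {u b : V}
    (huA : u ∉ A) (huB : u ∉ B) (hb : b ∈ A) (hub : ∀ w ∈ A, G.Adj u w → w = b)
    (hn : ¬ Contr G u b) :
    ∃ f β γ δ, f ∉ A ∧ f ∉ B ∧ β ∈ A ∧ β ≠ b ∧ γ ∈ B ∧ δ ∈ B ∧ γ ≠ δ ∧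
      (∀ w, G.Adj f w ↔ w = u ∨ w = b ∨ w = β ∨ w = γ) ∧
      (∀ w, G.Adj u w ↔ w = f ∨ w = b ∨ w = γ ∨ w = δ) := by
  obtain ⟨f, β, γ, fA, fB, hβ, hγ, hβb, hf⟩ := exists_apex hc h hA2 huA huB hb hub hn
  have hdisj := Finset.disjoint_left.1 h.1.1
  have ne : ∀ {x y}, x ∈ A → y ∈ B → x ≠ y := fun hx hy e => hdisj hx (e ▸ hy)
  have neu : ∀ {x}, x ∈ A → u ≠ x := fun hx e => huA (e ▸ hx)
  have neu' : ∀ {x}, x ∈ B → u ≠ x := fun hx e => huB (e ▸ hx)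
  have f4 := card_nb_of_iff hf (neu hb) (neu hβ) (neu' hγ) hβb.symm (ne hb hγ) (ne hβ hγ)
  have fγ := (hf γ).2 (by simp)
  obtain ⟨g, δ, β2, gB, gA, hδ, hβ2, hδγ, hg⟩ := exists_apex hc h.symm hB2 fB fA hγ
    (fun w hw e => by
      rcases (hf w).1 e with rfl | rfl | rfl | rfl
      exacts [absurd hw huB, absurd hb fun x => hdisj x hw, absurd hβ fun x => hdisj x hw, rfl])
    (hN f γ fγ f4)
  have fg : G.Adj f g := ((hg f).2 (by simp)).symm
  have gu : g = u := by
    rcases (hf g).1 fg with h | rfl | rfl | rfl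
    exacts [h, absurd hb gA, absurd hβ gA, absurd hγ gB]
  subst gu
  have : β2 = b := hub _ hβ2 ((hg β2).2 (by simp))
  subst this
  exact ⟨f, β, γ, δ, fA, fB, hβ, hβb, hγ, hδ, hδγ.symm, hf, fun w => by rw [hg]; tauto⟩

lemma apex_or (hc : Conn4 G) (hN : ∀ u v, G.Adj u v → #(nb G u) = 4 → ¬ Contr G u v)
    {u a : V} (hu : #(nb G u) = 4) (hua : G.Adj u a) :
    (∃ w, #(nb G w) = 4 ∧ G.Adj w u ∧ G.Adj w a) ∨
    ∃ b β γ δ, b ≠ γ ∧ ¬ G.Adj a δ ∧ ¬ G.Adj b δ ∧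
      (∀ w, G.Adj a w ↔ w = u ∨ w = b ∨ w = β ∨ w = γ) ∧
      (∀ w, G.Adj u w ↔ w = a ∨ w = b ∨ w = γ ∨ w = δ) := by
  obtain ⟨A, B, h, uA, uB, aA, aB⟩ := not_contr (hN u a hua hu)
  have main : ∀ A B, IsTight G A B → u ∉ A → u ∉ B → a ∉ A → a ∉ B → #(nb G u ∩ A) = 1 →
      (∃ w, #(nb G w) = 4 ∧ G.Adj w u ∧ G.Adj w a) ∨
      ∃ b β γ δ, b ≠ γ ∧ ¬ G.Adj a δ ∧ ¬ G.Adj b δ ∧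
        (∀ w, G.Adj a w ↔ w = u ∨ w = b ∨ w = β ∨ w = γ) ∧
        (∀ w, G.Adj u w ↔ w = a ∨ w = b ∨ w = γ ∨ w = δ) := by
    intro A B h uA uB aA aB h1
    have sing : ∀ A B, IsTight G A B → u ∉ A → u ∉ B → a ∉ A → a ∉ B → #A = 1 →
        ∃ w, #(nb G w) = 4 ∧ G.Adj w u ∧ G.Adj w a := by
      intro A B h uA uB aA aB h1
      obtain ⟨w, rfl⟩ := card_eq_one.1 h1
      rw [mem_singleton] at uA aA
      exact ⟨w, h.nb_of_singleton hc, (h.adj_of_singleton hc u).2 ⟨uA, uB⟩,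
        (h.adj_of_singleton hc a).2 ⟨aA, aB⟩⟩
    by_cases hA1 : #A = 1
    · exact Or.inl (sing A B h uA uB aA aB hA1)
    by_cases hB1 : #B = 1
    · exact Or.inl (sing B A h.symm uB uA aB aA hB1)
    right
    have pA := card_pos.2 h.2.1
    have pB := card_pos.2 h.2.2.1
    obtain ⟨b, hb⟩ := card_eq_one.1 h1
    have eb : ∀ w, (G.Adj u w ∧ w ∈ A) ↔ w = b := fun w => by
      have := Finset.ext_iff.1 hb w; simpa using this
    obtain ⟨f, β, γ, δ, fA, fB, hβ, hβb, hγ, hδ, hγδ, hf, hu'⟩ :=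
      exists_apex_pair hc hN h (by omega) (by omega) uA uB ((eb b).2 rfl).2
        (fun w hw e => (eb w).1 ⟨e, hw⟩) (hN u b ((eb b).2 rfl).1 hu)
    have hbA := ((eb b).2 rfl).2
    have af : a = f := by
      rcases (hu' a).1 hua with h | rfl | rfl | rfl
      exacts [h, absurd hbA aA, absurd hγ aB, absurd hδ aB]
    subst af
    refine ⟨b, β, γ, δ, fun e => h.notMem_of_mem_left hbA (e ▸ hγ), fun e => ?_,
      fun e => h.1.2 _ hbA _ hδ e, hf, hu'⟩
    rcases (hf δ).1 e with rfl | rfl | rfl | rfl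
    exacts [uB hδ, h.notMem_of_mem_left hbA hδ, h.notMem_of_mem_left hβ hδ, hγδ rfl]
  obtain ⟨x, hx, ux⟩ := h.exists_adj_left hc uA uB
  obtain ⟨y, hy, uy⟩ := h.exists_adj_right hc uA uB
  have p1 : 0 < #(nb G u ∩ A) := card_pos.2 ⟨x, by simp [ux, hx]⟩
  have p2 : 0 < #(nb G u ∩ B) := card_pos.2 ⟨y, by simp [uy, hy]⟩
  have p3 : 0 < #(nb G u \ (A ∪ B)) := card_pos.2 ⟨a, by simp [hua, aA, aB]⟩
  have := card_split (nb G u) h.1.1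
  by_cases h1 : #(nb G u ∩ A) = 1
  · exact main A B h uA uB aA aB h1
  · exact main B A h.symm uB uA aB aA (by omega)

/-- If no edge at a vertex of degree four is contractible, every such edge is in a triangle
with a further vertex of degree four. -/
theorem exists_apex_deg_four (hc : Conn4 G)
    (hN : ∀ u v, G.Adj u v → #(nb G u) = 4 → ¬ Contr G u v)
    {u a : V} (hu : #(nb G u) = 4) (hua : G.Adj u a) :
    ∃ w, #(nb G w) = 4 ∧ G.Adj w u ∧ G.Adj w a := by
  rcases apex_or hc hN hu hua with h | ⟨b, β, γ, δ, hbγ, haδ, hbδ, ha, hu'⟩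
  · exact h
  have uδ := (hu' δ).2 (by simp)
  rcases apex_or hc hN hu uδ with ⟨w, w4, wu, wδ⟩ | ⟨b', β', γ', δ', h1, h2, h3, h4, h5⟩
  · rcases (hu' w).1 wu.symm with rfl | rfl | rfl | rfl
    · exact absurd wδ haδ
    · exact absurd wδ hbδ
    · exact ⟨w, w4, wu, ((ha w).2 (by simp)).symm⟩
    · exact absurd rfl wδ.ne
  · exfalso
    have key : ∀ w, G.Adj u w → G.Adj δ w → w = γ := by
      intro w h h'
      rcases (hu' w).1 h with rfl | rfl | rfl | rfl
      exacts [absurd h'.symm haδ, absurd h'.symm hbδ, rfl, absurd rfl h'.ne]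
    exact h1 ((key b' ((h5 _).2 (by simp)) ((h4 _).2 (by simp))).trans
      (key γ' ((h5 _).2 (by simp)) ((h4 _).2 (by simp))).symm)

lemma Conn4.exists_cross (hc : Conn4 G) {T : Finset V} {u v : V} (hu : u ∈ T) (hv : v ∉ T) :
    ∃ a ∈ T, ∃ b ∉ T, G.Adj a b := by
  by_contra! hcon
  have := hc.2 T Tᶜ ⟨disjoint_compl_right, fun a ha b hb => hcon a ha b (mem_compl.1 hb)⟩
    ⟨u, hu⟩ ⟨v, mem_compl.2 hv⟩
  have := card_add_card_compl T
  omega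

/-- If some vertex has degree four and no edge at such a vertex is contractible, then the graph is
4-regular. -/
theorem regular_of_not_contr (hc : Conn4 G) (hn : 6 ≤ Fintype.card V)
    (hN : ∀ u v, G.Adj u v → #(nb G u) = 4 → ¬ Contr G u v) (h4 : ∃ u, #(nb G u) = 4) (v : V) :
    #(nb G v) = 4 := by
  by_contra hv
  obtain ⟨u₀, hu₀⟩ := h4
  obtain ⟨u, hu, x, hx, hux⟩ := hc.exists_cross (T := univ.filter fun u => #(nb G u) = 4)
    (u := u₀) (v := v) (by simpa) (by simpa)
  simp only [mem_filter, mem_univ, true_and] at hu hx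
  have apex : ∀ {u a}, #(nb G u) = 4 → G.Adj u a → ∃ w, #(nb G w) = 4 ∧ G.Adj w u ∧ G.Adj w a :=
    fun h h' => exists_apex_deg_four hc hN h h'
  obtain ⟨u', hu', huu, hu'x⟩ := apex hu hux
  have hxu' : x ≠ u' := fun e => hx (e ▸ hu')
  obtain ⟨p, q, xp, xq, u'p, u'q, pq, hN'⟩ := exists_adj_iff_two hu hux huu.symm hxu'
  have one : ∀ p q, x ≠ p → x ≠ q → u' ≠ p → u' ≠ q → p ≠ q →
      (∀ w, G.Adj u w ↔ w = x ∨ w = u' ∨ w = p ∨ w = q) → G.Adj u' p → ¬ G.Adj u' q → False := by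
    intro p q xp xq u'p u'q pq hN' ap aq
    have uq := (hN' q).2 (by simp)
    have up := (hN' p).2 (by simp)
    obtain ⟨w, w4, wu, wq⟩ := apex hu uq
    have wp : w = p := by
      rcases (hN' w).1 wu.symm with rfl | rfl | h | rfl
      exacts [absurd w4 hx, absurd wq aq, h, absurd rfl wq.ne]
    subst wp
    obtain ⟨r, xr, ur, pr, hr⟩ := exists_adj_iff_three hu' hu'x huu ap hux.ne.symm xp up.ne
    have u'r := (hr r).2 (by simp)
    have rq : r ≠ q := fun e => aq (e ▸ u'r)
    obtain ⟨t, t4, tu', tr⟩ := apex hu' u'r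
    have pr' : G.Adj w r := by
      rcases (hr t).1 tu'.symm with rfl | rfl | rfl | rfl
      · exact absurd t4 hx
      · rcases (hN' r).1 tr with h | rfl | h | h
        exacts [absurd h.symm xr, absurd rfl u'r.ne, absurd h.symm pr, absurd h rq]
      · exact tr
      · exact absurd rfl tr.ne
    have hp := adj_iff_of_card_nb w4 wu ap.symm wq pr' huu.ne.symm uq.ne ur u'q u'r.ne rq.symm
    have huniv := hc.card_nbrs (A := {u, u', w}) (N := {x, q, r}) (by simp) (by
      intro a ha v hv
      simp only [mem_insert, mem_singleton] at ha
      simp only [mem_union, mem_insert, mem_singleton]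
      rcases ha with rfl | rfl | rfl
      · rcases (hN' v).1 hv with h | h | h | h <;> simp [h]
      · rcases (hr v).1 hv with h | h | h | h <;> simp [h]
      · rcases (hp v).1 hv with h | h | h | h <;> simp [h]) card_le_three
    have hsub : nb G x ⊆ {u, u', q, r} := by
      intro v hv
      rw [mem_nb] at hv
      have : v ∈ ({u, u', w} ∪ {x, q, r} : Finset V) := huniv ▸ mem_univ v
      simp only [mem_union, mem_insert, mem_singleton] at this ⊢
      rcases this with (h | h | rfl) | (rfl | h | h)
      · simp [h]
      · simp [h]
      · exfalso
        rcases (hp x).1 hv.symm with rfl | h | h | h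
        exacts [hux.ne rfl, hxu' h, xq h, xr h]
      · exact absurd rfl hv.ne
      · simp [h]
      · simp [h]
    have := (card_le_card hsub).trans card_le_four
    have := hc.four_le_nb x
    omega
  by_cases ap : G.Adj u' p <;> by_cases aq : G.Adj u' q
  · have up := (hN' p).2 (by simp)
    have uq := (hN' q).2 (by simp)
    have hr := adj_iff_of_card_nb hu' hu'x huu ap aq hux.ne.symm xp xq up.ne uq.ne pq
    have huniv := hc.card_nbrs (A := {u, u'}) (N := {x, p, q}) (by simp) (by
      intro a ha v hv
      simp only [mem_insert, mem_singleton] at ha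
      simp only [mem_union, mem_insert, mem_singleton]
      rcases ha with rfl | rfl
      · rcases (hN' v).1 hv with h | h | h | h <;> simp [h]
      · rcases (hr v).1 hv with h | h | h | h <;> simp [h]) card_le_three
    have h1 := card_union_le {u, u'} {x, p, q}
    rw [huniv, card_univ] at h1
    have : #({u, u'} : Finset V) ≤ 2 := card_le_two
    have : #({x, p, q} : Finset V) ≤ 3 := card_le_three
    omega
  · exact one p q xp xq u'p u'q pq hN' ap aq
  · exact one q p xq xp u'q u'p pq.symm (fun w => by rw [hN']; tauto) aq ap
  · obtain ⟨w, w4, wu, wu'⟩ := apex hu huu.symm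
    rcases (hN' w).1 wu.symm with rfl | rfl | rfl | rfl
    exacts [hx w4, wu'.ne rfl, ap wu'.symm, aq wu'.symm]

/-- A tight separation with an edge in its separator and a side as small as possible. -/
lemma exists_atom {p q : V} (hpq : G.Adj p q) (hn : ¬ Contr G p q) :
    ∃ A B, IsTight G A B ∧ (∃ p q, G.Adj p q ∧ p ∉ A ∧ p ∉ B ∧ q ∉ A ∧ q ∉ B) ∧
      (∀ A' B', IsTight G A' B' →
        (∃ p q, G.Adj p q ∧ p ∉ A' ∧ p ∉ B' ∧ q ∉ A' ∧ q ∉ B') → #A ≤ #A') ∧ #A ≤ #B := by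
  obtain ⟨A, B, h, h1, h2, h3, h4⟩ := not_contr hn
  let P : ℕ → Prop := fun k => ∃ A B, IsTight G A B ∧
    (∃ p q, G.Adj p q ∧ p ∉ A ∧ p ∉ B ∧ q ∉ A ∧ q ∉ B) ∧ #A = k
  have hP : ∃ k, P k := ⟨_, A, B, h, ⟨p, q, hpq, h1, h2, h3, h4⟩, rfl⟩
  classical
  obtain ⟨A, B, h, he, hk⟩ := Nat.find_spec hP
  have hmin : ∀ A' B', IsTight G A' B' →
        (∃ p q, G.Adj p q ∧ p ∉ A' ∧ p ∉ B' ∧ q ∉ A' ∧ q ∉ B') → #A ≤ #A' := by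
    intro A' B' h' e'
    rw [hk]
    exact Nat.find_min' hP ⟨A', B', h', e', rfl⟩
  refine ⟨A, B, h, he, hmin, hmin B A h.symm ?_⟩
  obtain ⟨p, q, h1, h2, h3, h4, h5⟩ := he
  exact ⟨p, q, h1, h3, h2, h5, h4⟩

theorem regular_of_no_contr (hc : Conn4 G) (hn : 6 ≤ Fintype.card V)
    (hN : ∀ u v, G.Adj u v → ¬ Contr G u v) :
    (∀ v, #(nb G v) = 4) ∧ ∀ u v, G.Adj u v → ∃ w, G.Adj w u ∧ G.Adj w v := by
  have hN' : ∀ u v, G.Adj u v → #(nb G u) = 4 → ¬ Contr G u v := fun u v h _ => hN u v h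
  have h4 : ∃ u, #(nb G u) = 4 := by
    have : Nonempty V := Fintype.card_pos_iff.1 (by omega)
    obtain ⟨u⟩ := this
    obtain ⟨v, hv⟩ := card_pos.1 (show 0 < #(nb G u) by have := hc.four_le_nb u; omega)
    rw [mem_nb] at hv
    obtain ⟨A, B, h, ⟨p, q, hpq, pA, pB, -, -⟩, hmin, hle⟩ := exists_atom hv (hN u v hv)
    obtain ⟨a, ha, hpa⟩ := h.exists_adj_left hc pA pB
    have := (atom_bound hc h hmin hle hpa.symm ha (hN _ _ hpa.symm)).2 pA
    obtain ⟨w, rfl⟩ := card_eq_one.1 this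
    exact ⟨w, h.nb_of_singleton hc⟩
  have hreg := regular_of_not_contr hc hn hN' h4
  refine ⟨hreg, fun u v huv => ?_⟩
  obtain ⟨w, -, h⟩ := exists_apex_deg_four hc hN' (hreg u) huv
  exact ⟨w, h⟩

end NoContractible

section Good

open Finset

set_option linter.unusedSectionVars false

/-- A 4-regular graph in which every edge lies in a triangle. -/
def Good {V : Type*} [Fintype V] (G : SimpleGraph V) : Prop :=
  (∀ v, #(nb G v) = 4) ∧ ∀ u v, G.Adj u v → ∃ w, G.Adj w u ∧ G.Adj w v

/-- Two consecutive triangles of the neighbourhood path `p q s t` of `r`. -/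
structure IsBand {V : Type*} (G : SimpleGraph V) (p q r s t : V) : Prop where
  adj : ∀ w, G.Adj r w ↔ w = p ∨ w = q ∨ w = s ∨ w = t
  pq : p ≠ q
  ps : p ≠ s
  pt : p ≠ t
  qs : q ≠ s
  qt : q ≠ t
  st : s ≠ t
  apq : G.Adj p q
  aqs : G.Adj q s
  ast : G.Adj s t

variable {V : Type*} [Fintype V] {G : SimpleGraph V} [DecidableEq V]

lemma card_le_of_union {A N : Finset V} {k l : ℕ} (h : A ∪ N = univ) (hA : #A ≤ k) (hN : #N ≤ l) :
    Fintype.card V ≤ k + l := by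
  have := card_union_le A N
  rw [h, card_univ] at this
  omega

/-- No neighbour of `u` is adjacent to all other neighbours of `u`. -/
lemma Good.no_claw (hc : Conn4 G) (hn : 7 ≤ Fintype.card V) (hg : Good G) {u p a b c : V}
    (hup : G.Adj u p) (ha : G.Adj u a) (hb : G.Adj u b) (hcc : G.Adj u c) (hpa : G.Adj p a)
    (hpb : G.Adj p b) (hpc : G.Adj p c) (hab : a ≠ b) (hac : a ≠ c) (hbc : b ≠ c) : False := by
  have h1 := adj_iff_of_card_nb (hg.1 u) hup ha hb hcc hpa.ne hpb.ne hpc.ne hab hac hbc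
  have h2 := adj_iff_of_card_nb (hg.1 p) hup.symm hpa hpb hpc ha.ne hb.ne hcc.ne hab hac hbc
  have := hc.card_nbrs (A := {u, p}) (N := {a, b, c}) (by simp) (by
    intro x hx w hw
    simp only [mem_insert, mem_singleton] at hx
    simp only [mem_union, mem_insert, mem_singleton]
    rcases hx with rfl | rfl
    · rcases (h1 w).1 hw with h | h | h | h <;> simp [h]
    · rcases (h2 w).1 hw with h | h | h | h <;> simp [h]) card_le_three
  have := card_le_of_union this card_le_two card_le_three
  omega

/-- Three vertices with at most three outside neighbours. -/
lemma no_three_cut (hc : Conn4 G) (hn : 7 ≤ Fintype.card V) {u p q a b c : V}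
    (hu : ∀ w, G.Adj u w → w = p ∨ w = q ∨ w = a ∨ w = b ∨ w = c)
    (hp : ∀ w, G.Adj p w → w = u ∨ w = q ∨ w = a ∨ w = b ∨ w = c)
    (hq : ∀ w, G.Adj q w → w = u ∨ w = p ∨ w = a ∨ w = b ∨ w = c) : False := by
  have := hc.card_nbrs (A := {u, p, q}) (N := {a, b, c}) (by simp) (by
    intro x hx w hw
    simp only [mem_insert, mem_singleton] at hx
    simp only [mem_union, mem_insert, mem_singleton]
    rcases hx with rfl | rfl | rfl
    · rcases hu w hw with h | h | h | h | h <;> simp [h]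
    · rcases hp w hw with h | h | h | h | h <;> simp [h]
    · rcases hq w hw with h | h | h | h | h <;> simp [h]) card_le_three
  have := card_le_of_union this card_le_three card_le_three
  omega

/-- The neighbourhood of a vertex contains no 4-cycle. -/
lemma Good.no_wheel (hc : Conn4 G) (hn : 7 ≤ Fintype.card V) (hg : Good G) {u p q r s : V}
    (up : G.Adj u p) (uq : G.Adj u q) (ur : G.Adj u r) (us : G.Adj u s) (pq : G.Adj p q)
    (qr : G.Adj q r) (rs : G.Adj r s) (sp : G.Adj s p) (pr : p ≠ r) (qs : q ≠ s) : False := by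
  have hu := adj_iff_of_card_nb (hg.1 u) up uq ur us pq.ne pr sp.ne.symm qr.ne qs rs.ne
  have npr : ¬ G.Adj p r := fun e =>
    hg.no_claw hc hn up uq ur us pq e sp.symm qr.ne qs rs.ne
  obtain ⟨p', hup', hqp', hsp', hp⟩ :=
    exists_adj_iff_three (hg.1 p) up.symm pq sp.symm uq.ne us.ne qs
  have pp' := (hp p').2 (by simp)
  obtain ⟨w, wp, wp'⟩ := hg.2 p p' pp'
  have hrp' : r ≠ p' := fun e => npr (e ▸ pp')
  have fin : ∀ q s, q ≠ s → G.Adj u q → G.Adj u s → G.Adj p q → G.Adj q r → G.Adj s p →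
      (∀ w, G.Adj u w ↔ w = p ∨ w = q ∨ w = r ∨ w = s) →
      (∀ w, G.Adj p w ↔ w = u ∨ w = q ∨ w = s ∨ w = p') → G.Adj q p' → False := by
    intro q s qs uq us pq qr sp hu hp qp'
    have hq := adj_iff_of_card_nb (hg.1 q) uq.symm pq.symm qr qp' up.ne ur.ne hup' pr pp'.ne hrp'
    refine no_three_cut hc hn (u := u) (p := p) (q := q) (a := r) (b := s) (c := p') ?_ ?_ ?_ <;>
    intro w hw
    · have := (hu w).1 hw; tauto
    · have := (hp w).1 hw; tauto
    · have := (hq w).1 hw; tauto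
  rcases (hp w).1 wp.symm with rfl | rfl | rfl | rfl
  · rcases (hu p').1 wp' with h | h | h | h
    exacts [pp'.ne h.symm, hqp' h.symm, hrp' h.symm, hsp' h.symm]
  · exact fin w s qs uq us pq qr sp hu hp wp'
  · exact fin w q qs.symm us uq sp.symm rs.symm pq.symm (fun w => by rw [hu]; tauto)
      (fun w => by rw [hp]; tauto) wp'
  · exact wp'.ne rfl

lemma Good.band_step (hc : Conn4 G) (hn : 7 ≤ Fintype.card V) (hg : Good G) {p q r s t : V}
    (h : IsBand G p q r s t) : ∃ e, IsBand G q r s t e := by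
  have rp := (h.adj p).2 (by simp)
  have rq := (h.adj q).2 (by simp)
  have rs := (h.adj s).2 (by simp)
  have rt := (h.adj t).2 (by simp)
  obtain ⟨e, qe, re, te, he⟩ := exists_adj_iff_three (hg.1 s) h.aqs.symm rs.symm h.ast rq.ne.symm
    h.qt rt.ne
  have se := (he e).2 (by simp)
  have ep : e ≠ p := by
    rintro rfl
    exact hg.no_claw hc hn rs rp rq rt se h.aqs.symm h.ast h.pq h.pt h.qt
  refine ⟨e, he, rq.ne.symm, h.qt, qe, rt.ne, re, te, rq.symm, rt, ?_⟩
  obtain ⟨w, ws, we⟩ := hg.2 s e se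
  rcases (he w).1 ws.symm with rfl | rfl | rfl | rfl
  · exfalso
    have hq := adj_iff_of_card_nb (hg.1 w) h.apq.symm rq.symm h.aqs we rp.ne.symm h.ps ep.symm
      rs.ne re se.ne
    refine no_three_cut hc hn (u := w) (p := r) (q := s) (a := p) (b := t) (c := e) ?_ ?_ ?_ <;>
    intro x hx
    · have := (hq x).1 hx; tauto
    · have := (h.adj x).1 hx; tauto
    · have := (he x).1 hx; tauto
  · rcases (h.adj e).1 we with h1 | h1 | h1 | h1
    exacts [absurd h1 ep, absurd h1.symm qe, absurd h1.symm se.ne, absurd h1.symm te]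
  · exact we
  · exact absurd rfl we.ne

lemma exists_band_seq (hstep : ∀ p q r s t, IsBand G p q r s t → ∃ e, IsBand G q r s t e)
    {p q r s t : V} (h : IsBand G p q r s t) :
    ∃ f : ℕ → V, ∀ i, IsBand G (f i) (f (i + 1)) (f (i + 2)) (f (i + 3)) (f (i + 4)) := by
  let S := {x : V × V × V × V × V // IsBand G x.1 x.2.1 x.2.2.1 x.2.2.2.1 x.2.2.2.2}
  choose e he using hstep
  let step : S → S := fun x => ⟨(_, _, _, _, e _ _ _ _ _ x.2), he _ _ _ _ _ x.2⟩
  let g : ℕ → S := fun i => step^[i] ⟨(p, q, r, s, t), h⟩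
  have hg : ∀ i, g (i + 1) = step (g i) := fun i => Function.iterate_succ_apply' _ _ _
  refine ⟨fun i => (g i).1.1, fun i => ?_⟩
  have h2 := (g i).2
  simp only [hg]
  exact h2

lemma exists_cycleSq_of_band (hc : Conn4 G) (hn : 7 ≤ Fintype.card V) (hg : Good G)
    {p q r s t : V} (h : IsBand G p q r s t) :
    ∃ n : ℕ, 5 ≤ n ∧ Nonempty (G ≃g cycleSq n) := by
  obtain ⟨f, hf⟩ := exists_band_seq (fun p q r s t h => hg.band_step hc hn h) h
  have a1 : ∀ i, G.Adj (f i) (f (i + 1)) := fun i => (hf i).apq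
  have a2 : ∀ i, G.Adj (f i) (f (i + 2)) := fun i => (((hf i).adj _).2 (by simp)).symm
  have d3 : ∀ i, f i ≠ f (i + 3) := fun i => (hf i).ps
  have d4 : ∀ i, f i ≠ f (i + 4) := fun i => (hf i).pt
  have hrep : ∃ m, ∃ k < m, f k = f m := by
    obtain ⟨i, j, hij, he⟩ := Finite.exists_ne_map_eq_of_infinite f
    rcases lt_or_gt_of_ne hij with h | h
    exacts [⟨j, i, h, he⟩, ⟨i, j, h, he.symm⟩]
  classical
  obtain ⟨k, hkm, hkf⟩ := Nat.find_spec hrep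
  have hmin := fun m => Nat.find_min hrep (m := m)
  generalize Nat.find hrep = m at *
  have inj : ∀ i j, i < m → j < m → f i = f j → i = j := by
    intro i j hi hj e
    rcases lt_trichotomy i j with h | h | h
    · exact absurd ⟨i, h, e⟩ (hmin j hj)
    · exact h
    · exact absurd ⟨j, h, e.symm⟩ (hmin i hi)
  have hm5 : k + 5 ≤ m := by
    by_contra hlt
    obtain rfl | rfl | rfl | rfl : m = k + 1 ∨ m = k + 2 ∨ m = k + 3 ∨ m = k + 4 := by omega
    exacts [(a1 k).ne hkf, (a2 k).ne hkf, d3 k hkf, d4 k hkf]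
  obtain ⟨m', rfl⟩ : ∃ m', m = m' + 2 := ⟨m - 2, by omega⟩
  have b1 : G.Adj (f k) (f (m' + 1)) := hkf ▸ (a1 (m' + 1)).symm
  have b2 : G.Adj (f k) (f m') := hkf ▸ (a2 m').symm
  have hk0 : k = 0 := by
    by_contra hk0
    obtain ⟨j, rfl⟩ : ∃ j, k = j + 1 := ⟨k - 1, by omega⟩
    have c0 : G.Adj (f (j + 1)) (f j) := (a1 j).symm
    have hk := adj_iff_of_card_nb (hg.1 (f (j + 1))) c0 (a1 _) (a2 _) b1
      (a2 j).ne (d3 j) (fun e => by have := inj _ _ (by omega) (by omega) e; omega)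
      (a1 (j + 2)).ne (fun e => by have := inj _ _ (by omega) (by omega) e; omega)
      (fun e => by have := inj _ _ (by omega) (by omega) e; omega)
    rcases (hk _).1 b2 with e | e | e | e <;>
    · have := inj _ _ (by omega) (by omega) e; omega
  subst hk0
  have a0 := adj_iff_of_card_nb (hg.1 (f 0)) (a1 0) (a2 0) b1 b2 (a1 1).ne
      (fun e => by have := inj _ _ (by omega) (by omega) e; omega)
      (fun e => by have := inj _ _ (by omega) (by omega) e; omega)
      (fun e => by have := inj _ _ (by omega) (by omega) e; omega)
      (fun e => by have := inj _ _ (by omega) (by omega) e; omega)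
      (fun e => by have := inj _ _ (by omega) (by omega) e; omega)
  have hlast : f (m' + 3) = f 1 := by
    have h1 : G.Adj (f 0) (f (m' + 3)) := hkf ▸ a1 (m' + 2)
    rcases (a0 _).1 h1 with e | e | e | e
    · exact e
    · exfalso
      have h2 : G.Adj (f 2) (f (m' + 1)) := by
        have := (a2 (m' + 1)).symm; rwa [show m' + 1 + 2 = m' + 3 by ring, e] at this
      rcases ((hf 0).adj _).1 h2 with e' | e' | e' | e'
      · have := inj _ _ (by omega) (by omega) e'; omega
      · have := inj _ _ (by omega) (by omega) e'; omega
      · have := inj _ _ (by omega) (by omega) e'; omega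
      · have := inj _ _ (by omega) (by omega) e'
        obtain rfl : m' = 3 := by omega
        exact d4 2 e.symm
    · exact absurd e.symm (a2 (m' + 1)).ne
    · exact absurd e.symm (d3 m')
  set m := m' + 2 with hm
  have : NeZero m := ⟨by omega⟩
  have : Fact (1 < m) := ⟨by omega⟩
  let F : ZMod m → V := fun i => f i.val
  have one_val : (1 : ZMod m).val = 1 := ZMod.val_one m
  have two_val : (2 : ZMod m).val = 2 := by
    have := ZMod.val_natCast_of_lt (show 2 < m by omega); exact_mod_cast this
  have F1 : ∀ i, G.Adj (F i) (F (i + 1)) := by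
    intro i
    have hi := ZMod.val_lt i
    have : F (i + 1) = f (i.val + 1) := by
      simp only [F, ZMod.val_add, one_val]
      rcases Nat.lt_or_ge (i.val + 1) m with h | h
      · rw [Nat.mod_eq_of_lt h]
      · rw [show i.val + 1 = m by omega, Nat.mod_self, hkf]
    rw [this]
    exact a1 _
  have F2 : ∀ i, G.Adj (F i) (F (i + 2)) := by
    intro i
    have hi := ZMod.val_lt i
    have : F (i + 2) = f (i.val + 2) := by
      simp only [F, ZMod.val_add, two_val]
      rcases Nat.lt_or_ge (i.val + 2) m with h | h
      · rw [Nat.mod_eq_of_lt h]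
      · rcases Nat.lt_or_ge m (i.val + 2) with h' | h'
        · rw [show i.val + 2 = m + 1 by omega, Nat.add_mod_left, Nat.mod_eq_of_lt (by omega)]
          exact hlast.symm
        · rw [show i.val + 2 = m by omega, Nat.mod_self, hkf]
    rw [this]
    exact a2 _
  have Finj : Function.Injective F := fun i j e =>
    ZMod.val_injective m (inj _ _ (ZMod.val_lt i) (ZMod.val_lt j) e)
  have small : ∀ c : ℕ, 0 < c → c < m → (c : ZMod m) ≠ 0 := by
    intro c h1 h2 h3
    rw [ZMod.natCast_eq_zero_iff] at h3
    exact absurd (Nat.le_of_dvd h1 h3) (by omega)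
  have s1 := small 1 (by omega) (by omega)
  have s2 := small 2 (by omega) (by omega)
  have s3 := small 3 (by omega) (by omega)
  have s4 := small 4 (by omega) (by omega)
  push_cast at s1 s2 s3 s4
  have Fadj : ∀ i w, G.Adj (F i) w ↔
      w = F (i - 2) ∨ w = F (i - 1) ∨ w = F (i + 1) ∨ w = F (i + 2) := by
    intro i w
    have e1 := F1 (i - 1)
    have e2 := F2 (i - 2)
    rw [sub_add_cancel] at e1 e2
    refine adj_iff_of_card_nb (hg.1 _) e2.symm e1.symm (F1 i) (F2 i) ?_ ?_ ?_ ?_ ?_ ?_ w <;>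
    · intro e
      have e := Finj e
      first
        | exact s1 (by linear_combination e)
        | exact s1 (by linear_combination -e)
        | exact s2 (by linear_combination -e)
        | exact s3 (by linear_combination -e)
        | exact s4 (by linear_combination -e)
  have Fsurj : Function.Surjective F := by
    intro v
    by_contra hv
    obtain ⟨a, ha, b, hb, hab⟩ := hc.exists_cross (T := univ.image F) (u := F 0) (v := v) (by simp)
      (by simpa using hv)
    simp only [mem_image, mem_univ, true_and] at ha hb
    obtain ⟨i, rfl⟩ := ha
    rcases (Fadj i b).1 hab with rfl | rfl | rfl | rfl <;> exact hb ⟨_, rfl⟩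
  refine ⟨m, by omega, ⟨RelIso.symm ⟨Equiv.ofBijective F ⟨Finj, Fsurj⟩, ?_⟩⟩⟩
  intro i j
  change G.Adj (F i) (F j) ↔ _
  simp only [Fadj, Finj.eq_iff, cycleSq, fromRel_adj]
  constructor
  · rintro (rfl | rfl | rfl | rfl)
    · exact ⟨fun e => s2 (by linear_combination e), by right; right; ring⟩
    · exact ⟨fun e => s1 (by linear_combination e), by right; left; ring⟩
    · exact ⟨fun e => s1 (by linear_combination -e), by simp⟩
    · exact ⟨fun e => s2 (by linear_combination -e), by simp⟩
  · rintro ⟨-, (h | h) | (h | h)⟩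
    · exact Or.inr (Or.inr (Or.inl h))
    · exact Or.inr (Or.inr (Or.inr h))
    · exact Or.inr (Or.inl (by rw [h]; ring))
    · exact Or.inl (by rw [h]; ring)

end Good

section LineGraph

open Finset

set_option linter.unusedSectionVars false

/-- Each vertex lies in exactly two triangles, which meet only there and cover its neighbours. -/
def TwoTri {V : Type*} (G : SimpleGraph V) : Prop :=
  ∀ u, ∃ T₁ T₂ : Finset V, T₁ ≠ T₂ ∧ G.IsNClique 3 T₁ ∧ G.IsNClique 3 T₂ ∧ u ∈ T₁ ∧ u ∈ T₂ ∧
    (∀ v, v ∈ T₁ → v ∈ T₂ → v = u) ∧ (∀ T, G.IsNClique 3 T → u ∈ T → T = T₁ ∨ T = T₂) ∧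
    ∀ v, G.Adj u v → v ∈ T₁ ∨ v ∈ T₂

/-- The graph on the triangles of `G`, adjacent when they share a vertex. -/
def triGraph {V : Type*} (G : SimpleGraph V) : SimpleGraph {T : Finset V // G.IsNClique 3 T} where
  Adj S T := S ≠ T ∧ ∃ u, u ∈ S.1 ∧ u ∈ T.1
  symm := ⟨fun _ _ h => ⟨h.1.symm, h.2.imp fun _ h => ⟨h.2, h.1⟩⟩⟩
  loopless := ⟨fun _ h => h.1 rfl⟩

lemma TwoTri.eq_of_mem {V : Type*} {G : SimpleGraph V} (h : TwoTri G) {S T : Finset V}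
    (hS : G.IsNClique 3 S) (hT : G.IsNClique 3 T) (hne : S ≠ T) {u v : V} (h1 : u ∈ S) (h2 : u ∈ T)
    (h3 : v ∈ S) (h4 : v ∈ T) : u = v := by
  obtain ⟨T₁, T₂, -, -, -, -, -, ha, hb, -⟩ := h u
  rcases hb S hS h1 with rfl | rfl <;> rcases hb T hT h2 with rfl | rfl
  exacts [absurd rfl hne, (ha v h3 h4).symm, (ha v h4 h3).symm, absurd rfl hne]

/-- The pair of triangles at a vertex. -/
lemma TwoTri.exists_edge {V : Type*} {G : SimpleGraph V} (h : TwoTri G) (u : V) :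
    ∃ e : (triGraph G).edgeSet, ∀ T, T ∈ e.1 ↔ u ∈ T.1 := by
  obtain ⟨T₁, T₂, hne, c1, c2, u1, u2, -, hb, -⟩ := h u
  refine ⟨⟨s(⟨T₁, c1⟩, ⟨T₂, c2⟩), fun e => hne (congrArg Subtype.val e), u, u1, u2⟩, fun T => ?_⟩
  rw [Sym2.mem_iff]
  constructor
  · rintro (rfl | rfl) <;> assumption
  · intro hu
    rcases hb T.1 T.2 hu with e | e
    exacts [Or.inl (Subtype.ext e), Or.inr (Subtype.ext e)]

variable {V : Type} [Fintype V] {G : SimpleGraph V} [DecidableEq V]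

theorem exists_lineGraph (hc : Conn4 G) (h : TwoTri G) :
    ∃ (W : Type) (H : SimpleGraph W), IsCubic H ∧ CyclicallyFourConnected H ∧
      Nonempty (G ≃g H.lineGraph) := by
  choose φ hφ using fun u => h.exists_edge u
  have two : ∀ u, ∃ S T, S ≠ T ∧ (φ u).1 = s(S, T) := by
    intro u
    obtain ⟨e, he⟩ := φ u
    induction e with
    | _ S T => exact ⟨S, T, he.1, rfl⟩
  have inj : Function.Injective φ := by
    intro u v huv
    obtain ⟨S, T, hST, e⟩ := two u
    have e' : (φ v).1 = s(S, T) := huv ▸ e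
    have a1 := (hφ u S).1 (by simp [e])
    have a2 := (hφ u T).1 (by simp [e])
    have a3 := (hφ v S).1 (by simp [e'])
    have a4 := (hφ v T).1 (by simp [e'])
    exact h.eq_of_mem S.2 T.2 (fun e => hST (Subtype.ext e)) a1 a2 a3 a4
  have surj : Function.Surjective φ := by
    rintro ⟨e, he⟩
    induction e with
    | _ S T =>
      obtain ⟨hST, u, hu, hv⟩ := he
      refine ⟨u, Subtype.ext ?_⟩
      exact ((Sym2.mem_and_mem_iff hST).1 ⟨(hφ u S).2 hu, (hφ u T).2 hv⟩)
  have share : ∀ u v, G.Adj u v → ∃ T : {T : Finset V // G.IsNClique 3 T}, u ∈ T.1 ∧ v ∈ T.1 := by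
    intro u v huv
    obtain ⟨T₁, T₂, hne, c1, c2, u1, u2, -, -, hb⟩ := h u
    rcases hb v huv with hv | hv
    exacts [⟨⟨T₁, c1⟩, u1, hv⟩, ⟨⟨T₂, c2⟩, u2, hv⟩]
  refine ⟨_, triGraph G, ?_, ?_, ⟨⟨Equiv.ofBijective φ ⟨inj, surj⟩, ?_⟩⟩⟩
  · intro T
    have key : ∀ x : T.1, ∃ T', φ x = s(T, T') ∧ T ≠ T' := by
      rintro ⟨x, hx⟩
      obtain ⟨T', hT'⟩ := Sym2.mem_iff_exists.1 ((hφ x T).2 hx)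
      refine ⟨T', hT', ?_⟩
      have := (φ x).2
      rw [hT'] at this
      exact this.1
    choose g hg hne using key
    have hmem : ∀ x, (x : V) ∈ (g x).1 := fun x => (hφ x _).1 (by rw [hg x]; simp)
    have hb : Function.Bijective (fun x : T.1 => (⟨g x, hne x, x.1, x.2, hmem x⟩ :
        (triGraph G).neighborSet T)) := by
      constructor
      · intro x y hxy
        have e : g x = g y := congrArg Subtype.val hxy
        have := hmem y
        rw [← e] at this
        exact Subtype.ext (h.eq_of_mem T.2 (g x).2 (fun e => hne x (Subtype.ext e)) x.2 (hmem x)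
          y.2 this)
      · rintro ⟨S, hTS, x, hx, hxS⟩
        refine ⟨⟨x, hx⟩, Subtype.ext ?_⟩
        have h1 := (Sym2.mem_and_mem_iff hTS).1 ⟨(hφ x T).2 hx, (hφ x S).2 hxS⟩
        rw [hg ⟨x, hx⟩] at h1
        exact Sym2.congr_right.1 h1
    rw [← Nat.card_coe_set_eq, ← Nat.card_congr (Equiv.ofBijective _ hb), Nat.card_eq_fintype_card,
      Fintype.card_coe]
    exact T.2.card_eq
  · intro A hA hA'
    classical
    have ne : ∀ A : Set {T : Finset V // G.IsNClique 3 T}, ¬ ((triGraph G).induce A).IsAcyclic →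
        ∃ u, ∀ T ∈ (φ u).1, T ∈ A := by
      intro A hA
      by_contra hne
      refine hA ?_
      have : (triGraph G).induce A = ⊥ := by
        ext S T
        simp only [comap_adj, Function.Embedding.subtype_apply, bot_adj, iff_false]
        rintro ⟨hST, u, hu, hv⟩
        refine hne ⟨u, ?_⟩
        rw [(Sym2.mem_and_mem_iff hST).1 ⟨(hφ u _).2 hu, (hφ u _).2 hv⟩]
        intro T' hT'
        rcases Sym2.mem_iff.1 hT' with rfl | rfl
        exacts [S.2, T.2]
      rw [this]
      exact isAcyclic_bot
    have hs : IsSep G (univ.filter fun u => ∀ T ∈ (φ u).1, T ∈ A)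
        (univ.filter fun u => ∀ T ∈ (φ u).1, T ∈ Aᶜ) := by
      constructor
      · rw [Finset.disjoint_left]
        intro u hu hu'
        simp only [mem_filter, mem_univ, true_and] at hu hu'
        obtain ⟨S, T, -, e⟩ := two u
        exact hu' S (by simp [e]) (hu S (by simp [e]))
      · intro u hu v hv huv
        simp only [mem_filter, mem_univ, true_and] at hu hv
        obtain ⟨T, h1, h2⟩ := share u v huv
        exact hv T ((hφ v T).2 h2) (hu T ((hφ u T).2 h1))
    obtain ⟨u, hu⟩ := ne A hA
    obtain ⟨v, hv⟩ := ne Aᶜ hA'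
    have h1 := hc.2 _ _ hs ⟨u, mem_filter.2 ⟨mem_univ _, hu⟩⟩ ⟨v, mem_filter.2 ⟨mem_univ _, hv⟩⟩
    have h2 := card_union_of_disjoint hs.1
    generalize hX : (univ.filter fun u => ∀ T ∈ (φ u).1, T ∈ A) ∪
        (univ.filter fun u => ∀ T ∈ (φ u).1, T ∈ Aᶜ) = X at h2
    have h3 := card_add_card_compl X
    have h4 : 4 ≤ #Xᶜ := by omega
    rw [← Set.ncard_coe_finset] at h4
    have hfin : Finite (Sym2 {T : Finset V // G.IsNClique 3 T}) := inferInstance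
    refine h4.trans (Set.ncard_le_ncard_of_injOn (fun u => (φ u).1) ?_ ?_ (Set.toFinite _))
    · intro u hu
      simp only [coe_compl, Set.mem_compl_iff, mem_coe, ← hX, mem_union, mem_filter, mem_univ,
        true_and, not_or] at hu
      push Not at hu
      obtain ⟨⟨S, hS, hSA⟩, T, hT, hTA⟩ := hu
      have hTA' : T ∈ A := by simpa using hTA
      refine ⟨(φ u).2, T, hTA', S, hSA, (Sym2.mem_and_mem_iff ?_).1 ⟨hT, hS⟩⟩
      rintro rfl
      exact hSA hTA'
    · intro u _ v _ e
      exact inj (Subtype.ext e)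
  · intro u v
    change (triGraph G).lineGraph.Adj (φ u) (φ v) ↔ _
    rw [lineGraph_adj_iff_exists]
    constructor
    · rintro ⟨hne, T, h1, h2⟩
      rw [hφ] at h1 h2
      exact T.2.isClique h1 h2 (fun e => hne (congrArg φ e))
    · intro huv
      obtain ⟨T, h1, h2⟩ := share u v huv
      exact ⟨fun e => huv.ne (inj e), T, (hφ u T).2 h1, (hφ v T).2 h2⟩

lemma Good.band_or_two (hc : Conn4 G) (hn : 7 ≤ Fintype.card V) (hg : Good G) (u : V) :
    (∃ p q s t, IsBand G p q u s t) ∨ ∃ a b c d, a ≠ c ∧ a ≠ d ∧ b ≠ c ∧ b ≠ d ∧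
      (∀ w, G.Adj u w ↔ w = a ∨ w = b ∨ w = c ∨ w = d) ∧ G.Adj a b ∧ G.Adj c d ∧
      ¬ G.Adj a c ∧ ¬ G.Adj a d ∧ ¬ G.Adj b c ∧ ¬ G.Adj b d := by
  obtain ⟨a, ha⟩ := card_pos.1 (show 0 < #(nb G u) by rw [hg.1]; norm_num)
  rw [mem_nb] at ha
  obtain ⟨b, hbu, hba⟩ := hg.2 u a ha
  obtain ⟨c, d, ac, ad, bc, bd, cd, h⟩ := exists_adj_iff_two (hg.1 u) ha hbu.symm hba.ne.symm
  have ub := hbu.symm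
  have uc := (h c).2 (by simp)
  have ud := (h d).2 (by simp)
  have ab := hba.symm
  have nc : ∀ p x y z, G.Adj u p → G.Adj u x → G.Adj u y → G.Adj u z → x ≠ y → x ≠ z → y ≠ z →
      ¬ (G.Adj p x ∧ G.Adj p y ∧ G.Adj p z) := fun p x y z h1 h2 h3 h4 h5 h6 h7 ⟨h8, h9, h10⟩ =>
    hg.no_claw hc hn h1 h2 h3 h4 h8 h9 h10 h5 h6 h7
  have n1 := nc a b c d ha ub uc ud bc bd cd
  have n2 := nc b a c d ub ha uc ud ac ad cd
  obtain ⟨w, wu, wc⟩ := hg.2 u c uc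
  have hc' : G.Adj a c ∨ G.Adj b c ∨ G.Adj c d := by
    rcases (h w).1 wu.symm with rfl | rfl | rfl | rfl
    exacts [Or.inl wc, Or.inr (Or.inl wc), absurd rfl wc.ne, Or.inr (Or.inr wc.symm)]
  obtain ⟨w, wu, wd⟩ := hg.2 u d ud
  have hd' : G.Adj a d ∨ G.Adj b d ∨ G.Adj c d := by
    rcases (h w).1 wu.symm with rfl | rfl | rfl | rfl
    exacts [Or.inl wd, Or.inr (Or.inl wd), Or.inr (Or.inr wd), absurd rfl wd.ne]
  have band : ∀ p q s t, G.Adj u p → G.Adj u q → G.Adj u s → G.Adj u t → p ≠ q → p ≠ s →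
      p ≠ t → q ≠ s → q ≠ t → s ≠ t → G.Adj p q → G.Adj q s → G.Adj s t →
      ∃ p q s t, IsBand G p q u s t := fun p q s t a1 a2 a3 a4 h1 h2 h3 h4 h5 h6 h7 h8 h9 =>
    ⟨p, q, s, t, adj_iff_of_card_nb (hg.1 u) a1 a2 a3 a4 h1 h2 h3 h4 h5 h6, h1, h2, h3, h4, h5, h6,
      h7, h8, h9⟩
  by_cases hcd : G.Adj c d
  · by_cases e1 : G.Adj a c
    · exact Or.inl (band d c a b ud uc ha ub cd.symm ad.symm bd.symm ac.symm bc.symm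
        ab.ne hcd.symm e1.symm ab)
    by_cases e2 : G.Adj a d
    · exact Or.inl (band c d a b uc ud ha ub cd ac.symm bc.symm ad.symm bd.symm
        ab.ne hcd e2.symm ab)
    by_cases e3 : G.Adj b c
    · exact Or.inl (band d c b a ud uc ub ha cd.symm bd.symm ad.symm bc.symm ac.symm
        hba.ne hcd.symm e3.symm hba)
    by_cases e4 : G.Adj b d
    · exact Or.inl (band c d b a uc ud ub ha cd bc.symm ac.symm bd.symm ad.symm
        hba.ne hcd e4.symm hba)
    exact Or.inr ⟨a, b, c, d, ac, ad, bc, bd, h, ab, hcd, e1, e2, e3, e4⟩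
  · left
    by_cases e1 : G.Adj a c
    · have e4 : G.Adj b d := by tauto
      exact band c a b d uc ha ub ud ac.symm bc.symm cd ab.ne ad bd e1.symm ab e4
    · have e3 : G.Adj b c := by tauto
      have e2 : G.Adj a d := by tauto
      exact band c b a d uc ub ha ud bc.symm ac.symm cd hba.ne bd ad e3.symm hba e2

theorem Good.cycleSq_or_lineGraph (hc : Conn4 G) (hn : 7 ≤ Fintype.card V) (hg : Good G) :
    (∃ n : ℕ, 5 ≤ n ∧ Nonempty (G ≃g cycleSq n)) ∨
    ∃ (W : Type) (H : SimpleGraph W), IsCubic H ∧ CyclicallyFourConnected H ∧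
      Nonempty (G ≃g H.lineGraph) := by
  by_cases hb : ∃ p q r s t, IsBand G p q r s t
  · obtain ⟨p, q, r, s, t, h⟩ := hb
    exact Or.inl (exists_cycleSq_of_band hc hn hg h)
  right
  refine exists_lineGraph hc fun u => ?_
  rcases hg.band_or_two hc hn u with ⟨p, q, s, t, h⟩ | ⟨a, b, c, d, ac, ad, bc, bd, h, ab, cd, h1,
    h2, h3, h4⟩
  · exact absurd ⟨p, q, u, s, t, h⟩ hb
  have ua := (h a).2 (by simp)
  have ub := (h b).2 (by simp)
  have uc := (h c).2 (by simp)
  have ud := (h d).2 (by simp)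
  refine ⟨{u, a, b}, {u, c, d}, ?_, is3Clique_triple_iff.2 ⟨ua, ub, ab⟩,
    is3Clique_triple_iff.2 ⟨uc, ud, cd⟩, by simp, by simp, ?_, ?_, ?_⟩
  · intro e
    have : a ∈ ({u, c, d} : Finset V) := e ▸ (by simp)
    simp only [mem_insert, mem_singleton] at this
    rcases this with e | e | e
    exacts [ua.ne e.symm, ac e, ad e]
  · intro v hv hv'
    simp only [mem_insert, mem_singleton] at hv hv'
    rcases hv with e | rfl | rfl
    · exact e
    · rcases hv' with e | e | e
      exacts [e, absurd e ac, absurd e ad]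
    · rcases hv' with e | e | e
      exacts [e, absurd e bc, absurd e bd]
  · intro T hT hu
    have sub : ∀ {S : Finset V}, #S ≤ 3 → T ⊆ S → T = S := fun hS hTS =>
      eq_of_subset_of_card_le hTS (by rw [hT.card_eq]; exact hS)
    have nbr : ∀ v ∈ T, v = u ∨ v = a ∨ v = b ∨ v = c ∨ v = d := by
      intro v hv
      by_cases e : v = u
      · exact Or.inl e
      · exact Or.inr ((h v).1 (hT.isClique hu hv (Ne.symm e)))
    have cl : ∀ x ∈ T, ∀ y ∈ T, x ≠ y → G.Adj x y := fun x hx y hy h => hT.isClique hx hy h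
    by_cases hab : a ∈ T ∨ b ∈ T
    · left
      refine sub card_le_three fun v hv => ?_
      simp only [mem_insert, mem_singleton]
      rcases nbr v hv with e | e | e | rfl | rfl
      · simp [e]
      · simp [e]
      · simp [e]
      · exfalso
        rcases hab with h | h
        exacts [h1 (cl _ h _ hv ac), h3 (cl _ h _ hv bc)]
      · exfalso
        rcases hab with h | h
        exacts [h2 (cl _ h _ hv ad), h4 (cl _ h _ hv bd)]
    · right
      refine sub card_le_three fun v hv => ?_
      simp only [mem_insert, mem_singleton]
      rcases nbr v hv with e | rfl | rfl | e | e
      · simp [e]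
      · exact absurd (Or.inl hv) hab
      · exact absurd (Or.inr hv) hab
      · simp [e]
      · simp [e]
  · intro v hv
    rcases (h v).1 hv with e | e | e | e <;> simp [e]

end LineGraph

section Links

/-- There is a walk from `a` to `b` inside `S`. -/
def JoinIn {V : Type*} (G : SimpleGraph V) (S : Set V) (a b : V) : Prop :=
  ∃ P : G.Walk a b, ∀ v ∈ P.support, v ∈ S

/-- There are disjoint walks inside `S`, one from `a` to `a'` and one from `b` to `b'`. -/
def Linked {V : Type*} (G : SimpleGraph V) (S : Set V) (a a' b b' : V) : Prop :=
  ∃ S₁ S₂, Disjoint S₁ S₂ ∧ S₁ ⊆ S ∧ S₂ ⊆ S ∧ JoinIn G S₁ a a' ∧ JoinIn G S₂ b b'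

variable {V : Type*} {G : SimpleGraph V} {S T : Set V} {a b c d : V}

lemma JoinIn.refl (h : a ∈ S) : JoinIn G S a a := ⟨.nil, by simpa⟩

lemma JoinIn.symm (h : JoinIn G S a b) : JoinIn G S b a := by
  obtain ⟨P, hP⟩ := h
  exact ⟨P.reverse, by simpa using hP⟩

lemma JoinIn.trans (h : JoinIn G S a b) (h' : JoinIn G S b c) : JoinIn G S a c := by
  obtain ⟨P, hP⟩ := h
  obtain ⟨Q, hQ⟩ := h'
  refine ⟨P.append Q, fun v hv => ?_⟩
  rcases (Walk.mem_support_append_iff _ _).1 hv with h | h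
  exacts [hP v h, hQ v h]

lemma JoinIn.mono (h : JoinIn G S a b) (hST : S ⊆ T) : JoinIn G T a b := by
  obtain ⟨P, hP⟩ := h
  exact ⟨P, fun v hv => hST (hP v hv)⟩

lemma JoinIn.left_mem (h : JoinIn G S a b) : a ∈ S := by
  obtain ⟨P, hP⟩ := h
  exact hP _ P.start_mem_support

lemma JoinIn.right_mem (h : JoinIn G S a b) : b ∈ S := h.symm.left_mem

lemma JoinIn.of_adj (ha : a ∈ S) (hb : b ∈ S) (h : G.Adj a b) : JoinIn G S a b :=
  ⟨h.toWalk, by simp [ha, hb]⟩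

/-- A map sending adjacent vertices to joined vertices preserves joins. -/
lemma JoinIn.map {W : Type*} {H : SimpleGraph W} {f : V → W} {T : Set W} (h : JoinIn G S a b)
    (hmem : ∀ v ∈ S, f v ∈ T)
    (hf : ∀ u ∈ S, ∀ v ∈ S, G.Adj u v → JoinIn H T (f u) (f v)) : JoinIn H T (f a) (f b) := by
  obtain ⟨P, hP⟩ := h
  induction P with
  | nil => exact .refl (hmem _ (hP _ (by simp)))
  | cons e P ih =>
    simp only [Walk.support_cons, List.mem_cons, forall_eq_or_imp] at hP
    exact (hf _ hP.1 _ (hP.2 _ P.start_mem_support) e).trans (ih hP.2)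

/-- If two vertices of `S` are not joined, the vertices joined to the first form a cut. -/
lemma exists_cut_of_not_joinIn (ha : a ∈ S) (h : ¬ JoinIn G S a b) :
    ∃ T ⊆ S, a ∈ T ∧ b ∉ T ∧ ∀ u ∈ T, ∀ v ∈ S, v ∉ T → ¬ G.Adj u v := by
  refine ⟨{v | JoinIn G S a v}, fun v hv => JoinIn.right_mem hv, .refl ha, h, ?_⟩
  exact fun u hu v hv hvT huv => hvT (JoinIn.trans hu (.of_adj (JoinIn.right_mem hu) hv huv))

lemma Linked.mono (h : Linked G S a b c d) (hST : S ⊆ T) : Linked G T a b c d := by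
  obtain ⟨S₁, S₂, h0, h1, h2, h3, h4⟩ := h
  exact ⟨S₁, S₂, h0, h1.trans hST, h2.trans hST, h3, h4⟩

lemma Linked.swap (h : Linked G S a b c d) : Linked G S c d a b := by
  obtain ⟨S₁, S₂, h0, h1, h2, h3, h4⟩ := h
  exact ⟨S₂, S₁, h0.symm, h2, h1, h4, h3⟩

lemma Linked.symm_left (h : Linked G S a b c d) : Linked G S b a c d := by
  obtain ⟨S₁, S₂, h0, h1, h2, h3, h4⟩ := h
  exact ⟨S₁, S₂, h0, h1, h2, h3.symm, h4⟩

lemma Linked.symm_right (h : Linked G S a b c d) : Linked G S a b d c :=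
  h.swap.symm_left.swap

/-- Every vertex of `S` is joined to `a` inside `S`. -/
def ConnAt (G : SimpleGraph V) (S : Set V) (a : V) : Prop := ∀ v ∈ S, JoinIn G S a v

lemma ConnAt.join (h : ConnAt G S a) {u v : V} (hu : u ∈ S) (hv : v ∈ S) : JoinIn G S u v :=
  (h u hu).symm.trans (h v hv)

/-- No vertex `w` separates `X`. -/
def NoCut (G : SimpleGraph V) (X : Set V) : Prop :=
  ∀ w, ∀ S ⊆ X, ∀ u ∈ S, u ≠ w → ∀ v ∈ X, v ∉ S → v ≠ w →
    ∃ p ∈ S, p ≠ w ∧ ∃ q ∈ X, q ∉ S ∧ q ≠ w ∧ G.Adj p q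

lemma NoCut.connAt {X : Set V} (hX : NoCut G X) {p a : V} (ha : a ∈ X) (hap : a ≠ p) :
    ConnAt G (X \ {p}) a := by
  intro v hv
  by_contra hcon
  obtain ⟨T, hTS, h1, h2, h3⟩ := exists_cut_of_not_joinIn
    (show a ∈ X \ {p} from ⟨ha, by simpa using hap⟩) hcon
  obtain ⟨u, hu, -, w, hw, hwT, hwp, huw⟩ := hX p T (hTS.trans Set.sdiff_subset) a h1 hap v hv.1 h2
    (by simpa using hv.2)
  exact h3 u hu w ⟨hw, by simpa using hwp⟩ hwT huw

theorem NoCut.linked_or [Finite V] {X : Set V} (hX : NoCut G X) {p₁ p₂ q₁ q₂ : V} (hp₁ : p₁ ∈ X)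
    (hp₂ : p₂ ∈ X) (hq₁ : q₁ ∈ X) (hq₂ : q₂ ∈ X) (hp : p₁ ≠ p₂) (hq : q₁ ≠ q₂)
    (h11 : p₁ ≠ q₁) (h21 : p₂ ≠ q₁) (h22 : p₂ ≠ q₂) :
    Linked G X p₁ q₁ p₂ q₂ ∨ Linked G X p₁ q₂ p₂ q₁ := by
  by_contra! hcon
  have split : ∀ P ⊆ X, ConnAt G P p₁ → p₁ ∈ P → p₂ ∉ P → ConnAt G (X \ P) p₂ →
      (q₁ ∈ P ∧ q₂ ∈ P) ∨ (q₁ ∉ P ∧ q₂ ∉ P) := by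
    intro P hPX h1 h2 h3 h4
    by_cases a1 : q₁ ∈ P <;> by_cases a2 : q₂ ∈ P
    · exact Or.inl ⟨a1, a2⟩
    · exact absurd ⟨P, X \ P, Set.disjoint_sdiff_right, hPX, Set.sdiff_subset, h1 _ a1,
        h4 _ ⟨hq₂, a2⟩⟩ hcon.1
    · exact absurd ⟨P, X \ P, Set.disjoint_sdiff_right, hPX, Set.sdiff_subset, h1 _ a2,
        h4 _ ⟨hq₁, a1⟩⟩ hcon.2
    · exact Or.inr ⟨a1, a2⟩
  let Ok : Set V → Prop := fun P => P ⊆ X ∧ ConnAt G P p₁ ∧ p₁ ∈ P ∧ p₂ ∉ P ∧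
    ConnAt G (X \ P) p₂ ∧ q₁ ∈ P ∧ q₂ ∈ P
  have hOk : Ok (X \ {p₂}) := by
    refine ⟨Set.sdiff_subset, hX.connAt hp₁ hp, ⟨hp₁, by simpa⟩, by simp, ?_,
      ⟨hq₁, by simpa using h21.symm⟩, ⟨hq₂, by simpa using h22.symm⟩⟩
    intro v hv
    have : v = p₂ := by
      by_contra h
      exact hv.2 ⟨hv.1, h⟩
    subst this
    exact .refl hv
  obtain ⟨P, hP, hmin⟩ := Set.Finite.exists_minimalFor (fun P : Set V => P.ncard) {P | Ok P}
    (Set.toFinite _) ⟨_, hOk⟩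
  obtain ⟨hPX, hPc, p1P, p2P, hQc, q1P, q2P⟩ := hP
  let C : V → Set V := fun w => {v | JoinIn G (P \ {w}) p₁ v}
  have hC : ∀ w ∈ P, w ≠ p₁ → (∃ y ∈ X \ P, G.Adj w y) → q₁ ∉ C w ∧ q₂ ∉ C w := by
    intro w hw hwp ⟨y, hy, hwy⟩
    have CP : C w ⊆ P \ {w} := fun v hv => JoinIn.right_mem hv
    have p1C : p₁ ∈ C w := .refl ⟨p1P, by simpa using hwp.symm⟩
    have wC : w ∉ C w := fun h => (CP h).2 rfl
    have closed : ∀ u ∈ C w, ∀ v ∈ P, v ∉ C w → v ≠ w → ¬ G.Adj u v := fun u hu v hv hvC hvw huv =>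
      hvC (JoinIn.trans hu (.of_adj (CP hu) ⟨hv, hvw⟩ huv))
    have Cconn : ConnAt G (C w) p₁ := by
      intro v hv
      by_contra hcon
      obtain ⟨T, hTC, h1, h2, h3⟩ := exists_cut_of_not_joinIn p1C hcon
      obtain ⟨R, hR⟩ := (show JoinIn G (P \ {w}) p₁ v from hv)
      have key : ∀ {a b : V} (R : G.Walk a b), (∀ v ∈ R.support, v ∈ P \ {w}) → a ∈ T → b ∈ T := by
        intro a b R
        induction R with
        | nil => exact fun _ h => h
        | cons e R ih =>
          intro hs ha
          simp only [Walk.support_cons, List.mem_cons, forall_eq_or_imp] at hs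
          refine ih hs.2 ?_
          by_contra hb
          have hbC := JoinIn.trans (hTC ha) (.of_adj hs.1 (hs.2 _ R.start_mem_support) e)
          exact h3 _ ha _ hbC hb e
      exact h2 (key R hR h1)
    have Qconn : ConnAt G (X \ C w) p₂ := by
      have hsub : X \ P ⊆ X \ C w := Set.sdiff_subset_sdiff_right (CP.trans Set.sdiff_subset)
      have jw : JoinIn G (X \ C w) p₂ w :=
        ((hQc y hy).mono hsub).trans (.of_adj (hsub hy) ⟨hPX hw, wC⟩ hwy.symm)
      intro v hv
      by_cases hvP : v ∈ P
      swap
      · exact (hQc v ⟨hv.1, hvP⟩).mono hsub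
      refine jw.trans ?_
      have hwv : JoinIn G (P \ C w) w v := by
        by_contra hcon
        obtain ⟨T, hT, h1, h2, h3⟩ := exists_cut_of_not_joinIn
          (show w ∈ P \ C w from ⟨hw, wC⟩) hcon
        have key : ∀ {a b : V} (R : G.Walk a b), (∀ v ∈ R.support, v ∈ P) → a ∈ P \ C w →
            a ∉ T → b ∉ T ∧ b ∈ P \ C w := by
          intro a b R
          induction R with
          | nil => exact fun _ h h' => ⟨h', h⟩
          | @cons a b c e R ih =>
            intro hs ha haT
            simp only [Walk.support_cons, List.mem_cons, forall_eq_or_imp] at hs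
            have hbP := hs.2 _ R.start_mem_support
            have hbC : b ∉ C w := fun h =>
              closed b h a ha.1 ha.2 (fun e => haT (e ▸ h1)) e.symm
            exact ih hs.2 ⟨hbP, hbC⟩ fun h => h3 b h a ha haT e.symm
        obtain ⟨R, hR⟩ := hPc.join hvP p1P
        exact (key R hR ⟨hvP, hv.2⟩ h2).2.2 p1C
      exact hwv.mono (Set.sdiff_subset_sdiff_left hPX)
    rcases split (C w) (CP.trans (Set.sdiff_subset.trans hPX)) Cconn p1C (fun h => p2P (CP h).1)
      Qconn with h | h
    · exfalso
      have := hmin (j := C w) ⟨CP.trans (Set.sdiff_subset.trans hPX), Cconn, p1C,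
        fun h => p2P (CP h).1, Qconn, h.1, h.2⟩
        (Set.ncard_le_ncard (CP.trans Set.sdiff_subset) (Set.toFinite _))
      have hlt : (C w).ncard < P.ncard :=
        Set.ncard_lt_ncard ⟨CP.trans Set.sdiff_subset, fun h => wC (h hw)⟩ (Set.toFinite _)
      exact absurd (show P.ncard ≤ (C w).ncard from this) (by omega)
    · exact h
  let D : Set V := {w | w ∈ P ∧ w ≠ p₁ ∧ ∃ y ∈ X \ P, G.Adj w y}
  have hD : D.Nonempty := by
    obtain ⟨u, hu, hup, v, hv, hvP, -, huv⟩ := hX p₁ P hPX q₁ q1P h11.symm p₂ hp₂ p2P hp.symm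
    exact ⟨u, hu, hup, v, ⟨hv, hvP⟩, huv⟩
  obtain ⟨w, hw, hmax⟩ := Set.Finite.exists_maximalFor (fun w : V => (C w).ncard) D
    (Set.toFinite _) hD
  obtain ⟨hwP, hwp, hwy⟩ := hw
  have hqC' := hC w hwP hwp hwy
  have CP : C w ⊆ P \ {w} := fun v hv => JoinIn.right_mem hv
  have p1C : p₁ ∈ C w := .refl ⟨p1P, by simpa using hwp.symm⟩
  have closed : ∀ u ∈ C w, ∀ v ∈ P, v ∉ C w → v ≠ w → ¬ G.Adj u v := fun u hu v hv hvC hvw huv =>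
    hvC (JoinIn.trans hu (.of_adj (CP hu) ⟨hv, hvw⟩ huv))
  obtain ⟨q, hqP, hqw, hqC⟩ : ∃ q ∈ P, q ≠ w ∧ q ∉ C w := by
    by_cases h : q₁ = w
    · exact ⟨q₂, q2P, fun e => hq (h.trans e.symm), hqC'.2⟩
    · exact ⟨q₁, q1P, h, hqC'.1⟩
  obtain ⟨u, ⟨huP, huC⟩, huw, v, hvX, hvR, hvw, huv⟩ := hX w (P \ C w)
    (Set.sdiff_subset.trans hPX) q ⟨hqP, hqC⟩ hqw p₁ hp₁ (fun h => h.2 p1C) hwp.symm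
  have hvP : v ∉ P := fun hvP => by
    by_cases hvC : v ∈ C w
    · exact closed v hvC u huP huC huw huv.symm
    · exact hvR ⟨hvP, hvC⟩
  have hup : u ≠ p₁ := fun e => huC (e ▸ p1C)
  obtain ⟨c, hc, hcw⟩ : ∃ c ∈ C w, G.Adj c w := by
    by_contra! hno
    have key : ∀ {a b : V} (R : G.Walk a b), (∀ v ∈ R.support, v ∈ P) → a ∈ C w → b ∈ C w := by
      intro a b R
      induction R with
      | nil => exact fun _ h => h
      | @cons a b c e R ih =>
        intro hs ha
        simp only [Walk.support_cons, List.mem_cons, forall_eq_or_imp] at hs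
        refine ih hs.2 ?_
        by_contra hb
        exact closed a ha b (hs.2 _ R.start_mem_support) hb (fun e' => hno a ha (e' ▸ e)) e
    obtain ⟨R, hR⟩ := hPc q hqP
    exact hqC (key R hR p1C)
  have sub : C w ⊆ C u := by
    intro v hv
    have key : ∀ {a b : V} (R : G.Walk a b), (∀ v ∈ R.support, v ∈ P \ {w}) → a ∈ C w →
        a ∈ C u → b ∈ C u := by
      intro a b R
      induction R with
      | nil => exact fun _ _ h => h
      | @cons a b c e R ih =>
        intro hs ha haU
        simp only [Walk.support_cons, List.mem_cons, forall_eq_or_imp] at hs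
        have hb := hs.2 _ R.start_mem_support
        have hbC : b ∈ C w := JoinIn.trans ha (.of_adj hs.1 hb e)
        exact ih hs.2 hbC (JoinIn.trans haU (.of_adj (JoinIn.right_mem haU)
          ⟨hb.1, fun e => huC (e ▸ hbC)⟩ e))
    obtain ⟨R, hR⟩ := (show JoinIn G (P \ {w}) p₁ v from hv)
    exact key R hR p1C (.refl ⟨p1P, hup.symm⟩)
  have hwU : w ∈ C u := JoinIn.trans (sub hc) (.of_adj (JoinIn.right_mem (sub hc))
    ⟨hwP, huw.symm⟩ hcw)
  have hlt : (C w).ncard < (C u).ncard :=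
    Set.ncard_lt_ncard ⟨sub, fun h => (CP (h hwU)).2 rfl⟩ (Set.toFinite _)
  have := hmax (j := u) ⟨huP, hup, v, ⟨hvX, hvP⟩, huv⟩ hlt.le
  exact absurd (show (C u).ncard ≤ (C w).ncard from this) (by omega)

end Links

section Drawings

/-- An algebraic drawing modulo two: `τ` is a linear order of the vertices read off a drawing and
`s p q w` records on which side of the edge `pq` the vertex `w` lies. The equations say that
disjoint edges cross an even number of times. -/
structure ZDraw {V : Type*} (G : SimpleGraph V) (τ : V → V → ZMod 2) (s : V → V → V → ZMod 2) :
    Prop where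
  anti : ∀ p q, p ≠ q → τ p q + τ q p = 1
  eq : ∀ p q r t, G.Adj p q → G.Adj r t → p ≠ r → p ≠ t → q ≠ r → q ≠ t →
    τ p r + τ q r + τ p t + τ q t + s p q r + s p q t + s r t p + s r t q = 0

/-- A graph is drawable if it has an algebraic drawing modulo two. -/
def ZPlanar {V : Type*} (G : SimpleGraph V) : Prop := ∃ τ s, ZDraw G τ s

variable {V W : Type*} {G : SimpleGraph V} {τ : V → V → ZMod 2} {s : V → V → V → ZMod 2}

lemma ZPlanar.of_injective {H : SimpleGraph W} (h : ZPlanar G) (f : W → V)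
    (hf : Function.Injective f) (hadj : ∀ u v, H.Adj u v → G.Adj (f u) (f v)) : ZPlanar H := by
  obtain ⟨τ, s, h⟩ := h
  exact ⟨fun p q => τ (f p) (f q), fun p q r => s (f p) (f q) (f r),
    fun p q hpq => h.anti _ _ (hf.ne hpq), fun p q r t h1 h2 h3 h4 h5 h6 =>
      h.eq _ _ _ _ (hadj _ _ h1) (hadj _ _ h2) (hf.ne h3) (hf.ne h4) (hf.ne h5) (hf.ne h6)⟩

lemma ZPlanar.exists_symm [Countable V] (h : ZPlanar G) :
    ∃ τ s, ZDraw G τ s ∧ ∀ p q w, s p q w = s q p w := by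
  obtain ⟨τ, s, h⟩ := h
  obtain ⟨f, hf⟩ := exists_injective_nat V
  refine ⟨τ, fun p q w => if f p < f q then s p q w else s q p w, ⟨h.anti, ?_⟩, ?_⟩
  · intro p q r t h1 h2 h3 h4 h5 h6
    have e1 := h.eq p q r t h1 h2 h3 h4 h5 h6
    have e2 := h.eq q p r t h1.symm h2 h5 h6 h3 h4
    have e3 := h.eq p q t r h1 h2.symm h4 h3 h6 h5
    have e4 := h.eq q p t r h1.symm h2.symm h6 h5 h4 h3
    split_ifs <;> grind
  · intro p q w
    by_cases hpq : p = q
    · subst hpq; rfl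
    · have := hf.ne hpq
      change ite _ _ _ = ite _ _ _
      split_ifs <;> first | rfl | omega

/-- The sum of the side indicators of the edges of a walk. -/
def wsum (s : V → V → V → ZMod 2) : ∀ {u v : V}, G.Walk u v → V → ZMod 2
  | _, _, .nil, _ => 0
  | _, _, .cons (u := p) (v := q) _ P, w => s p q w + wsum s P w

lemma ZDraw.walk_edge (h : ZDraw G τ s) {p p' r t : V} (P : G.Walk p p') (hrt : G.Adj r t)
    (hr : r ∉ P.support) (ht : t ∉ P.support) :
    τ p r + τ p' r + τ p t + τ p' t + wsum s P r + wsum s P t + s r t p + s r t p' = 0 := by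
  induction P with
  | nil => simp only [wsum]; grind
  | @cons p q p' e P ih =>
    simp only [Walk.support_cons, List.mem_cons, not_or] at hr ht
    have h1 := ih hr.2 ht.2
    have h2 := h.eq p q r t e hrt (Ne.symm hr.1) (Ne.symm ht.1)
      (fun e => hr.2 (e ▸ P.start_mem_support)) (fun e => ht.2 (e ▸ P.start_mem_support))
    simp only [wsum]
    grind

lemma ZDraw.walk_walk (h : ZDraw G τ s) {p p' q q' : V} (P : G.Walk p p') (Q : G.Walk q q')
    (hPQ : ∀ v ∈ Q.support, v ∉ P.support) :
    τ p q + τ p' q + τ p q' + τ p' q' + wsum s P q + wsum s P q' +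
      wsum s Q p + wsum s Q p' = 0 := by
  induction Q with
  | nil => simp only [wsum]; grind
  | @cons q r q' e Q ih =>
    simp only [Walk.support_cons, List.mem_cons, forall_eq_or_imp] at hPQ
    have h1 := ih hPQ.2
    have h2 := h.walk_edge P e hPQ.1 (hPQ.2 _ Q.start_mem_support)
    simp only [wsum]
    grind

/-- An induced subgraph is connected if its vertices are joined inside it. -/
lemma induce_connected_iff {V : Type*} {G : SimpleGraph V} {S : Set V} :
    (G.induce S).Connected ↔ S.Nonempty ∧ ∀ a ∈ S, ∀ b ∈ S, JoinIn G S a b := by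
  constructor
  · intro h
    refine ⟨Set.nonempty_coe_sort.1 h.nonempty, fun u hu v hv => ?_⟩
    obtain ⟨P⟩ := h.preconnected ⟨u, hu⟩ ⟨v, hv⟩
    have : JoinIn (G.induce S) Set.univ ⟨u, hu⟩ ⟨v, hv⟩ := ⟨P, by simp⟩
    exact this.map (f := Subtype.val) (fun v _ => v.2) fun a _ b _ e => .of_adj a.2 b.2 e
  · rintro ⟨hne, h⟩
    have : Nonempty S := hne.to_subtype
    refine ⟨fun a b => ?_⟩
    obtain ⟨P, hP⟩ := h a a.2 b b.2
    exact ⟨P.induce S hP⟩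

/-- A family of disjoint branch sets with walks through them transports a drawing. -/
lemma ZPlanar.of_joinIn {H : SimpleGraph W} (h : ZPlanar G) (φ : W → Set V) (r : W → V)
    (hφ : Pairwise fun i j => Disjoint (φ i) (φ j)) (hr : ∀ i, r i ∈ φ i)
    (hj : ∀ i j, H.Adj i j → JoinIn G (φ i ∪ φ j) (r i) (r j)) : ZPlanar H := by
  classical
  obtain ⟨τ, s, h⟩ := h
  choose P hP using hj
  refine ⟨fun i j => τ (r i) (r j),
    fun i j k => if e : H.Adj i j then wsum s (P i j e) (r k) else 0, ?_, ?_⟩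
  · intro i j hij
    exact h.anti _ _ fun e => Set.disjoint_left.1 (hφ hij) (hr i) (e ▸ hr j)
  · intro i j k l e e' h1 h2 h3 h4
    simp only [e, e', dif_pos]
    refine h.walk_walk (P i j e) (P k l e') fun v hv hv' => ?_
    have d1 := Set.disjoint_left.1 (hφ h1)
    have d2 := Set.disjoint_left.1 (hφ h2)
    have d3 := Set.disjoint_left.1 (hφ h3)
    have d4 := Set.disjoint_left.1 (hφ h4)
    rcases hP _ _ _ v hv' with a | a <;> rcases hP _ _ _ v hv with b | b
    exacts [d1 a b, d2 a b, d3 a b, d4 a b]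

lemma not_zPlanar_top : ¬ ZPlanar (⊤ : SimpleGraph (Fin 5)) := by
  rintro ⟨τ, s, h⟩
  have ha : ∀ p q, p ≠ q → τ p q + τ q p = 1 := h.anti
  have he : ∀ p q r t, p ≠ q → r ≠ t → p ≠ r → p ≠ t → q ≠ r → q ≠ t →
    τ p r + τ q r + τ p t + τ q t + s p q r + s p q t + s r t p + s r t q = 0 :=
    fun p q r t h1 h2 => h.eq p q r t h1 h2
  have a01 := ha 0 1 (by decide)
  have a02 := ha 0 2 (by decide)
  have a03 := ha 0 3 (by decide)
  have a04 := ha 0 4 (by decide)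
  have a12 := ha 1 2 (by decide)
  have a13 := ha 1 3 (by decide)
  have a14 := ha 1 4 (by decide)
  have a23 := ha 2 3 (by decide)
  have a24 := ha 2 4 (by decide)
  have a34 := ha 3 4 (by decide)
  have e1 := he 0 1 2 3 (by decide) (by decide) (by decide) (by decide) (by decide) (by decide)
  have e2 := he 0 1 2 4 (by decide) (by decide) (by decide) (by decide) (by decide) (by decide)
  have e3 := he 0 1 3 4 (by decide) (by decide) (by decide) (by decide) (by decide) (by decide)
  have e4 := he 0 2 1 3 (by decide) (by decide) (by decide) (by decide) (by decide) (by decide)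
  have e5 := he 0 2 1 4 (by decide) (by decide) (by decide) (by decide) (by decide) (by decide)
  have e6 := he 0 2 3 4 (by decide) (by decide) (by decide) (by decide) (by decide) (by decide)
  have e7 := he 0 3 1 2 (by decide) (by decide) (by decide) (by decide) (by decide) (by decide)
  have e8 := he 0 3 1 4 (by decide) (by decide) (by decide) (by decide) (by decide) (by decide)
  have e9 := he 0 3 2 4 (by decide) (by decide) (by decide) (by decide) (by decide) (by decide)
  have e10 := he 0 4 1 2 (by decide) (by decide) (by decide) (by decide) (by decide) (by decide)
  have e11 := he 0 4 1 3 (by decide) (by decide) (by decide) (by decide) (by decide) (by decide)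
  have e12 := he 0 4 2 3 (by decide) (by decide) (by decide) (by decide) (by decide) (by decide)
  have e13 := he 1 2 3 4 (by decide) (by decide) (by decide) (by decide) (by decide) (by decide)
  have e14 := he 1 3 2 4 (by decide) (by decide) (by decide) (by decide) (by decide) (by decide)
  have e15 := he 1 4 2 3 (by decide) (by decide) (by decide) (by decide) (by decide) (by decide)
  clear ha he h
  grind

lemma not_zPlanar_completeBipartite : ¬ ZPlanar (completeBipartiteGraph (Fin 3) (Fin 3)) := by
  rintro ⟨τ, s, h⟩
  have ha : ∀ p q, p ≠ q → τ p q + τ q p = 1 := h.anti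
  have he : ∀ p q r t, p ≠ r → q ≠ t →
      τ (.inl p) (.inl r) + τ (.inr q) (.inl r) + τ (.inl p) (.inr t) + τ (.inr q) (.inr t) +
      s (.inl p) (.inr q) (.inl r) + s (.inl p) (.inr q) (.inr t) + s (.inl r) (.inr t) (.inl p) +
      s (.inl r) (.inr t) (.inr q) = 0 :=
    fun p q r t h1 h2 => h.eq (.inl p) (.inr q) (.inl r) (.inr t) (by simp) (by simp)
      (by simpa using h1) (by simp) (by simp) (by simpa using h2)
  have a01 := ha (.inr 0) (.inr 1) (by decide)
  have a02 := ha (.inr 0) (.inr 2) (by decide)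
  have a12 := ha (.inr 1) (.inr 2) (by decide)
  have b00 := ha (.inl 0) (.inr 0) (by decide)
  have b01 := ha (.inl 0) (.inr 1) (by decide)
  have b02 := ha (.inl 0) (.inr 2) (by decide)
  have b10 := ha (.inl 1) (.inr 0) (by decide)
  have b11 := ha (.inl 1) (.inr 1) (by decide)
  have b12 := ha (.inl 1) (.inr 2) (by decide)
  have b20 := ha (.inl 2) (.inr 0) (by decide)
  have b21 := ha (.inl 2) (.inr 1) (by decide)
  have b22 := ha (.inl 2) (.inr 2) (by decide)
  have e1 := he 0 0 1 1 (by decide) (by decide)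
  have e2 := he 0 0 1 2 (by decide) (by decide)
  have e3 := he 0 1 1 0 (by decide) (by decide)
  have e4 := he 0 1 1 2 (by decide) (by decide)
  have e5 := he 0 2 1 0 (by decide) (by decide)
  have e6 := he 0 2 1 1 (by decide) (by decide)
  have f1 := he 0 0 2 1 (by decide) (by decide)
  have f2 := he 0 0 2 2 (by decide) (by decide)
  have f3 := he 0 1 2 0 (by decide) (by decide)
  have f4 := he 0 1 2 2 (by decide) (by decide)
  have f5 := he 0 2 2 0 (by decide) (by decide)
  have f6 := he 0 2 2 1 (by decide) (by decide)
  have g1 := he 1 0 2 1 (by decide) (by decide)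
  have g2 := he 1 0 2 2 (by decide) (by decide)
  have g3 := he 1 1 2 0 (by decide) (by decide)
  have g4 := he 1 1 2 2 (by decide) (by decide)
  have g5 := he 1 2 2 0 (by decide) (by decide)
  have g6 := he 1 2 2 1 (by decide) (by decide)
  clear ha he h
  grind

lemma ZPlanar.not_isMinorOf {H : SimpleGraph W} (h : ZPlanar G) (hH : ¬ ZPlanar H) :
    ¬ H.IsMinorOf G := by
  rintro ⟨φ, h1, h2, h3, h4⟩
  refine hH (h.of_joinIn φ (fun w => (h1 w).some) h3 (fun w => (h1 w).some_mem) ?_)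
  have hj : ∀ i, ∀ u ∈ φ i, ∀ v ∈ φ i, JoinIn G (φ i) u v := fun i =>
    (induce_connected_iff.1 (h2 i)).2
  intro i j hij
  obtain ⟨a, ha, b, hb, e⟩ := h4 hij
  exact ((hj i _ (h1 i).some_mem a ha).mono Set.subset_union_left).trans
    ((JoinIn.of_adj (.inl ha) (.inr hb) e).trans
      ((hj j b hb _ (h1 j).some_mem).mono Set.subset_union_right))

theorem ZPlanar.isPlanar (h : ZPlanar G) : IsPlanar G :=
  ⟨h.not_isMinorOf not_zPlanar_top, h.not_isMinorOf not_zPlanar_completeBipartite⟩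

lemma cycleSq_six_adj {i j : ZMod 6} : (cycleSq 6).Adj i j ↔ i ≠ j ∧ i ≠ j + 3 := by
  simp only [cycleSq, fromRel_adj]
  revert i j
  decide

/-- The order of the vertices in a drawing of the octahedron. -/
def octOrder (p q : ZMod 6) : ZMod 2 := if q.val < p.val then 1 else 0

/-- The sides of the edges in a drawing of the octahedron. -/
def octSide (p q w : ZMod 6) : ZMod 2 :=
  if p.val * 36 + q.val * 6 + w.val ∈ [56, 68, 69, 70, 142] ∨
    q.val * 36 + p.val * 6 + w.val ∈ [56, 68, 69, 70, 142] then 1 else 0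

set_option maxRecDepth 10000 in
set_option synthInstance.maxSize 1000 in
lemma zPlanar_cycleSq_six : ZPlanar (cycleSq 6) := by
  refine ⟨octOrder, octSide, ⟨by decide, ?_⟩⟩
  simp only [cycleSq_six_adj]
  decide

end Drawings

section Contractions

variable {V W : Type*} {G : SimpleGraph V}

lemma Linked.exists_walks {S : Set V} {a a' b b' : V} (h : Linked G S a a' b b') :
    ∃ (P : G.Walk a a') (Q : G.Walk b b'), (∀ v ∈ P.support, v ∈ S) ∧ (∀ v ∈ Q.support, v ∈ S) ∧
      (∀ v ∈ Q.support, v ∉ P.support) := by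
  obtain ⟨S₁, S₂, h0, h1, h2, ⟨P, hP⟩, ⟨Q, hQ⟩⟩ := h
  exact ⟨P, Q, fun v hv => h1 (hP v hv), fun v hv => h2 (hQ v hv), fun v hv hv' =>
    Set.disjoint_left.1 h0 (hP v hv') (hQ v hv)⟩

lemma ZPlanar.not_linked_and_linked (h : ZPlanar G) {x y a a' b b' : V} (hxy : G.Adj x y)
    (hxa : G.Adj x a) (hxa' : G.Adj x a') (hyb : G.Adj y b) (hyb' : G.Adj y b')
    (haa' : a ≠ a') (hbb' : b ≠ b') (hab : a ≠ b) (hab' : a ≠ b') (ha'b : a' ≠ b) (ha'b' : a' ≠ b')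
    (hay : a ≠ y) (ha'y : a' ≠ y) (hbx : b ≠ x) (hb'x : b' ≠ x)
    (h1 : Linked G {v | v ≠ x ∧ v ≠ y} a b a' b') (h2 : Linked G {v | v ≠ x ∧ v ≠ y} a b' a' b) :
    False := by
  obtain ⟨τ, s, h⟩ := h
  obtain ⟨P, Q, hP, hQ, hPQ⟩ := h1.exists_walks
  obtain ⟨P2, Q2, hP2, hQ2, hPQ2⟩ := h2.exists_walks
  have Px : x ∉ P.support := fun e => (hP x e).1 rfl
  have Py : y ∉ P.support := fun e => (hP y e).2 rfl
  have Qx : x ∉ Q.support := fun e => (hQ x e).1 rfl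
  have Qy : y ∉ Q.support := fun e => (hQ y e).2 rfl
  have P2x : x ∉ P2.support := fun e => (hP2 x e).1 rfl
  have P2y : y ∉ P2.support := fun e => (hP2 y e).2 rfl
  have Q2x : x ∉ Q2.support := fun e => (hQ2 x e).1 rfl
  have Q2y : y ∉ Q2.support := fun e => (hQ2 y e).2 rfl
  have w1 := h.walk_walk P Q hPQ
  have w2 := h.walk_walk P2 Q2 hPQ2
  have p1 := h.walk_edge P hxa' Px (hPQ _ Q.start_mem_support)
  have p2 := h.walk_edge P hyb' Py (hPQ _ Q.end_mem_support)
  have p3 := h.walk_edge P hxy Px Py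
  have q1 := h.walk_edge Q hxa Qx fun e => hPQ _ e P.start_mem_support
  have q2 := h.walk_edge Q hyb Qy fun e => hPQ _ e P.end_mem_support
  have q3 := h.walk_edge Q hxy Qx Qy
  have r1 := h.walk_edge P2 hxa' P2x (hPQ2 _ Q2.start_mem_support)
  have r2 := h.walk_edge P2 hyb P2y (hPQ2 _ Q2.end_mem_support)
  have r3 := h.walk_edge P2 hxy P2x P2y
  have t1 := h.walk_edge Q2 hxa Q2x fun e => hPQ2 _ e P2.start_mem_support
  have t2 := h.walk_edge Q2 hyb' Q2y fun e => hPQ2 _ e P2.end_mem_support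
  have t3 := h.walk_edge Q2 hxy Q2x Q2y
  have e1 := h.eq x a y b hxa hyb hxy.ne hbx.symm hay hab
  have e2 := h.eq x a y b' hxa hyb' hxy.ne hb'x.symm hay hab'
  have e3 := h.eq x a' y b hxa' hyb hxy.ne hbx.symm ha'y ha'b
  have e4 := h.eq x a' y b' hxa' hyb' hxy.ne hb'x.symm ha'y ha'b'
  have z1 := h.anti a b hab
  have z2 := h.anti a b' hab'
  have z3 := h.anti a' b ha'b
  have z4 := h.anti a' b' ha'b'
  have z5 := h.anti a a' haa'
  have z6 := h.anti b b' hbb'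
  have z7 := h.anti x y hxy.ne
  have z8 := h.anti x a hxa.ne
  have z9 := h.anti x a' hxa'.ne
  have y1 := h.anti y b hyb.ne
  have y2 := h.anti y b' hyb'.ne
  have y3 := h.anti y a hay.symm
  have y4 := h.anti y a' ha'y.symm
  have y5 := h.anti x b hbx.symm
  have y6 := h.anti x b' hb'x.symm
  clear h h1 h2 hP hQ hPQ hP2 hQ2 hPQ2
  grind

/-- In a drawable graph, two neighbours of `x` and two neighbours of `y`, where `xy` is an edge, are
linked off `x` and `y`. -/
theorem ZPlanar.linked [Finite V] (h : ZPlanar G) {x y a a' b b' : V}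
    (hc : NoCut G {v | v ≠ x ∧ v ≠ y}) (hxy : G.Adj x y)
    (hxa : G.Adj x a) (hxa' : G.Adj x a') (hyb : G.Adj y b) (hyb' : G.Adj y b')
    (haa' : a ≠ a') (hbb' : b ≠ b') (hab : a ≠ b) (hab' : a ≠ b') (ha'b : a' ≠ b) (ha'b' : a' ≠ b')
    (hay : a ≠ y) (ha'y : a' ≠ y) (hbx : b ≠ x) (hb'x : b' ≠ x) :
    Linked G {v | v ≠ x ∧ v ≠ y} a a' b b' := by
  have ma : a ∈ {v | v ≠ x ∧ v ≠ y} := ⟨hxa.ne', hay⟩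
  have ma' : a' ∈ {v | v ≠ x ∧ v ≠ y} := ⟨hxa'.ne', ha'y⟩
  have mb : b ∈ {v | v ≠ x ∧ v ≠ y} := ⟨hbx, hyb.ne'⟩
  have mb' : b' ∈ {v | v ≠ x ∧ v ≠ y} := ⟨hb'x, hyb'.ne'⟩
  have k1 := hc.linked_or ma ma' mb mb' haa' hbb' hab ha'b ha'b'
  have k2 := hc.linked_or ma mb ma' mb' hab ha'b' haa' ha'b.symm hbb'
  have k3 := hc.linked_or ma mb' ma' mb hab' ha'b haa' ha'b'.symm hbb'.symm
  have k := h.not_linked_and_linked hxy hxa hxa' hyb hyb' haa' hbb' hab hab' ha'b ha'b' hay ha'y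
    hbx hb'x
  rcases k2 with k2 | k2
  · exact k2
  rcases k3 with k3 | k3
  · exact k3.symm_right
  · exact (k k3.symm_right k2.symm_right).elim

lemma Conn4.noCut [Fintype V] (hc : Conn4 G) (x y : V) : NoCut G {v | v ≠ x ∧ v ≠ y} := by
  classical
  intro w S hS u hu huw v hv hvS hvw
  by_contra! hcon
  let A : Finset V := Finset.univ.filter fun v => v ∈ S ∧ v ≠ w
  let B : Finset V := Finset.univ.filter fun v => v ≠ x ∧ v ≠ y ∧ v ∉ S ∧ v ≠ w
  have hsep : IsSep G A B := by
    constructor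
    · exact Finset.disjoint_left.2 fun t ha hb => by
        simp only [A, B, Finset.mem_filter, Finset.mem_univ, true_and] at ha hb
        exact hb.2.2.1 ha.1
    · intro a ha b hb
      simp only [A, B, Finset.mem_filter, Finset.mem_univ, true_and] at ha hb
      exact hcon a ha.1 ha.2 b ⟨hb.1, hb.2.1⟩ hb.2.2.1 hb.2.2.2
  have h4 := hc.2 A B hsep ⟨u, by simp [A, hu, huw]⟩ ⟨v, by simp [B, hv.1, hv.2, hvS, hvw]⟩
  have hcov : (Finset.univ : Finset V) ⊆ (A ∪ B) ∪ {x, y, w} := by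
    intro t _
    by_cases tS : t ∈ S <;> by_cases tx : t = x <;> by_cases ty : t = y <;> by_cases tw : t = w <;>
      simp [A, B, tS, tx, ty, tw]
  have := Finset.card_le_card hcov
  have c1 := Finset.card_union_le (A ∪ B) {x, y, w}
  have c2 := Finset.card_union_le A B
  have c3 : ({x, y, w} : Finset V).card ≤ 3 := Finset.card_le_three
  rw [Finset.card_univ] at this
  omega

/-- `π` exhibits `F` as the simple graph obtained from `G` by identifying `x` and `y`. -/
structure IsContr (G : SimpleGraph V) (F : SimpleGraph W) (x y : V) (π : V → W) : Prop where
  adj : G.Adj x y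
  surj : Function.Surjective π
  eq_iff : ∀ a b, π a = π b ↔ a = b ∨ (a = x ∧ b = y) ∨ (a = y ∧ b = x)
  adj_iff : ∀ a b, F.Adj (π a) (π b) ↔
    π a ≠ π b ∧ ∃ a' b', π a' = π a ∧ π b' = π b ∧ G.Adj a' b'

variable {F : SimpleGraph W} {x y : V} {π : V → W}

namespace IsContr

lemma symm (h : IsContr G F x y π) : IsContr G F y x π :=
  ⟨h.adj.symm, h.surj, fun a b => by rw [h.eq_iff]; tauto, h.adj_iff⟩

lemma map_eq (h : IsContr G F x y π) : π x = π y := (h.eq_iff x y).2 (by simp)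

lemma adj_of_adj (h : IsContr G F x y π) {a b : V} (e : G.Adj a b) (hab : π a ≠ π b) :
    F.Adj (π a) (π b) := (h.adj_iff a b).2 ⟨hab, a, b, rfl, rfl, e⟩

lemma joinIn_fibre (h : IsContr G F x y π) {S : Set W} {a b : V} (ha : π a ∈ S) (hab : π a = π b) :
    JoinIn G (π ⁻¹' S) a b := by
  have hb : π b ∈ S := hab ▸ ha
  rcases (h.eq_iff a b).1 hab with rfl | ⟨rfl, rfl⟩ | ⟨rfl, rfl⟩
  · exact .refl ha
  · exact .of_adj ha hb h.adj
  · exact .of_adj ha hb h.adj.symm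

lemma joinIn (h : IsContr G F x y π) {S : Set W} {a b : V} (hj : JoinIn F S (π a) (π b)) :
    JoinIn G (π ⁻¹' S) a b := by
  obtain ⟨P, hP⟩ := hj
  generalize hu : π a = u at P
  generalize hv : π b = v at P
  induction P generalizing a with
  | nil => exact h.joinIn_fibre (show π a ∈ S from hu ▸ hP _ (by simp)) (hu.trans hv.symm)
  | @cons u w v e P ih =>
    simp only [Walk.support_cons, List.mem_cons, forall_eq_or_imp] at hP
    obtain ⟨c, rfl⟩ := h.surj w
    subst hu
    obtain ⟨-, a', c', h1, h2, e'⟩ := (h.adj_iff a c).1 e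
    have ha'S : a' ∈ π ⁻¹' S := by rw [Set.mem_preimage, h1]; exact hP.1
    have hcS : π c' ∈ S := h2 ▸ hP.2 _ P.start_mem_support
    exact (h.joinIn_fibre hP.1 h1.symm).trans
      ((JoinIn.of_adj ha'S hcS e').trans (ih h2 hv hP.2))

lemma linked (h : IsContr G F x y π) {S : Set W} {a a' b b' : V}
    (hl : Linked F S (π a) (π a') (π b) (π b')) : Linked G (π ⁻¹' S) a a' b b' := by
  obtain ⟨S₁, S₂, h0, h1, h2, h3, h4⟩ := hl
  exact ⟨_, _, h0.preimage π, Set.preimage_mono h1, Set.preimage_mono h2, h.joinIn h3, h.joinIn h4⟩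

lemma linked_map (h : IsContr G F x y π) {a a' b b' : V}
    (hl : Linked G {v | v ≠ x ∧ v ≠ y} a a' b b') :
    Linked F {w | w ≠ π x} (π a) (π a') (π b) (π b') := by
  obtain ⟨S₁, S₂, h0, h1, h2, h3, h4⟩ := hl
  have key : ∀ S ⊆ {v | v ≠ x ∧ v ≠ y}, ∀ {a a'}, JoinIn G S a a' →
      JoinIn F (π '' S) (π a) (π a') := by
    intro S hS a a' hj
    refine hj.map (fun v hv => ⟨v, hv, rfl⟩) fun u hu v hv e =>
      .of_adj ⟨u, hu, rfl⟩ ⟨v, hv, rfl⟩ (h.adj_of_adj e ?_)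
    intro e'
    have h1 := hS hu
    have h2 := e.ne
    rcases (h.eq_iff u v).1 e' with h3 | h3 | h3
    exacts [h2 h3, h1.1 h3.1, h1.2 h3.1]
  have sub : ∀ S ⊆ {v | v ≠ x ∧ v ≠ y}, π '' S ⊆ {w | w ≠ π x} := by
    rintro S hS _ ⟨v, hv, rfl⟩ e
    rcases (h.eq_iff v x).1 e with h3 | h3 | h3
    exacts [(hS hv).1 h3, (hS hv).1 h3.1, (hS hv).2 h3.1]
  refine ⟨π '' S₁, π '' S₂, ?_, sub _ h1, sub _ h2, key _ h1 h3, key _ h2 h4⟩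
  rw [Set.disjoint_left]
  rintro _ ⟨u, hu, rfl⟩ ⟨v, hv, e⟩
  rcases (h.eq_iff v u).1 e with h3 | h3 | h3
  · exact Set.disjoint_left.1 h0 hu (h3 ▸ hv)
  · exact (h2 hv).1 h3.1
  · exact (h2 hv).2 h3.1

end IsContr

end Contractions

section Lifting

variable {V W : Type*} {G : SimpleGraph V}

lemma exists_rank_one_aux {P Q : V → Prop} {δ : V → V → ZMod 2}
    (hP : ∀ u v, ∃ a, P a ∧ a ≠ u ∧ a ≠ v)
    (hq : ∀ a a' b b', P a → P a' → Q b → Q b' → a ≠ a' → b ≠ b' → a ≠ b → a ≠ b' → a' ≠ b →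
      a' ≠ b' → δ a b + δ a b' + δ a' b + δ a' b' = 0) {b₀ : V} (hb₀ : Q b₀) (hb₀' : ¬ P b₀) :
    ∃ α β : V → ZMod 2, ∀ a b, P a → Q b → a ≠ b → α a + β b = δ a b := by
  classical
  choose c hc using fun b => hP b b
  refine ⟨fun a => δ a b₀, fun b => if b = b₀ then 0 else δ (c b) b + δ (c b) b₀, ?_⟩
  intro a b ha hb hab
  have h0 : ∀ a, P a → a ≠ b₀ := fun a ha e => hb₀' (e ▸ ha)
  dsimp only
  split_ifs with h
  · grind
  · by_cases h' : a = c b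
    · subst h'; grind
    · have := hq a (c b) b b₀ ha (hc b).1 hb hb₀ h' h hab (h0 _ ha) (hc b).2.1 (h0 _ (hc b).1)
      grind

/-- A function on pairs all of whose alternating sums over quadruples of distinct points vanish has
rank one. -/
lemma exists_rank_one {P Q : V → Prop} {δ : V → V → ZMod 2}
    (hP : ∀ u v, ∃ a, P a ∧ a ≠ u ∧ a ≠ v) (hQ : ∀ u v, ∃ a, Q a ∧ a ≠ u ∧ a ≠ v)
    (hPQ : ∀ u v w, ∃ a, (P a ∨ Q a) ∧ a ≠ u ∧ a ≠ v ∧ a ≠ w)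
    (hq : ∀ a a' b b', P a → P a' → Q b → Q b' → a ≠ a' → b ≠ b' → a ≠ b → a ≠ b' → a' ≠ b →
      a' ≠ b' → δ a b + δ a b' + δ a' b + δ a' b' = 0) :
    ∃ α β : V → ZMod 2, ∀ a b, P a → Q b → a ≠ b → α a + β b = δ a b := by
  classical
  by_cases h1 : ∃ b, Q b ∧ ¬ P b
  · obtain ⟨b₀, h1, h2⟩ := h1
    exact exists_rank_one_aux hP hq h1 h2
  by_cases h2 : ∃ a, P a ∧ ¬ Q a
  · obtain ⟨a₀, h1, h2⟩ := h2
    obtain ⟨β, α, h⟩ := exists_rank_one_aux (P := Q) (Q := P) (δ := fun b a => δ a b) hQ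
      (fun b b' a a' hb hb' ha ha' e1 e2 e3 e4 e5 e6 => by
        have := hq a a' b b' ha ha' hb hb' e2 e1 e3.symm e5.symm e4.symm e6.symm
        grind) h1 h2
    exact ⟨α, β, fun a b ha hb hab => by have := h b a hb ha hab.symm; grind⟩
  push Not at h1 h2
  have hPQ' : ∀ u v w, ∃ a, P a ∧ a ≠ u ∧ a ≠ v ∧ a ≠ w := fun u v w => by
    obtain ⟨a, ha, h⟩ := hPQ u v w
    exact ⟨a, ha.elim id (h1 a), h⟩
  by_cases hne : ∃ b, P b
  swap
  · exact ⟨0, 0, fun a _ ha => (hne ⟨a, ha⟩).elim⟩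
  obtain ⟨b₀, hb₀⟩ := hne
  choose c hc using fun b => hP b b₀
  let β : V → ZMod 2 := fun b => if b = b₀ then 0 else δ (c b) b + δ (c b) b₀
  have hβ₀ : β b₀ = 0 := if_pos rfl
  have hβ : ∀ a b, P a → P b → a ≠ b → b ≠ b₀ → a ≠ b₀ → β b = δ a b + δ a b₀ := by
    intro a b ha hb hab hbb hab₀
    have e : β b = δ (c b) b + δ (c b) b₀ := if_neg hbb
    rw [e]
    by_cases h : a = c b
    · rw [h]
    · have := hq a (c b) b b₀ ha (hc b).1 (h2 _ hb) (h2 _ hb₀) h hbb hab hab₀ (hc b).2.1 (hc b).2.2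
      grind
  obtain ⟨b₁, hb₁, hb₁₀, -⟩ := hP b₀ b₀
  refine ⟨fun a => if a = b₀ then δ b₀ b₁ + β b₁ else δ a b₀, β, fun a b ha hb hab => ?_⟩
  replace hb := h1 b hb
  dsimp only
  split_ifs with h
  · subst h
    by_cases h3 : b = b₁
    · subst h3; grind
    obtain ⟨d, hd, d1, d2, d3⟩ := hPQ' b b₁ a
    have e1 := hβ d b hd hb d1 hab.symm d3
    have e2 := hβ d b₁ hd hb₁ d2 hb₁₀ d3
    have e3 := hq a d b b₁ ha hd (h2 _ hb) (h2 _ hb₁) d3.symm h3 hab hb₁₀.symm d1 d2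
    grind
  · by_cases h3 : b = b₀
    · subst h3; grind
    · have := hβ a b ha hb hab h3 h
      grind

variable {F : SimpleGraph W} {x y : V} {π : V → W}

/-- The defect of a pair of neighbours of the ends of a contracted edge with image `z`. -/
def defect (τ : W → W → ZMod 2) (s : W → W → W → ZMod 2) (z a b : W) : ZMod 2 :=
  τ a z + τ z b + τ a b + s z a b + s z b a

lemma IsContr.zPlanar_of_defect (h : IsContr G F x y π) {τ : W → W → ZMod 2}
    {s : W → W → W → ZMod 2} (hd : ZDraw F τ s) (hs : ∀ p q w, s p q w = s q p w)
    {α β : V → ZMod 2} (hαβ : ∀ a b, G.Adj x a → a ≠ y → G.Adj y b → b ≠ x → a ≠ b →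
      α a + β b = defect τ s (π x) (π a) (π b)) : ZPlanar G := by
  classical
  have hxy := h.adj.ne
  let τ' : V → V → ZMod 2 := fun p q =>
    if π p = π q then (if p = x then 0 else 1) else τ (π p) (π q)
  let σ : V → V → ZMod 2 := fun p q => if p = x then α q else β q
  let s' : V → V → V → ZMod 2 := fun p q w => if π p = π q then 0 else
    if π w = π p then σ p q else if π w = π q then σ q p else s (π p) (π q) (π w)
  have hanti : ∀ p q, p ≠ q → τ' p q + τ' q p = 1 := by
    intro p q hpq
    by_cases e : π p = π q
    · rcases (h.eq_iff p q).1 e with e' | ⟨rfl, rfl⟩ | ⟨rfl, rfl⟩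
      · exact (hpq e').elim
      · simp [τ', e, hxy.symm]
      · simp [τ', e, hpq]
    · simp only [τ', e, Ne.symm e, if_false]
      simpa [Ne.symm e] using hd.anti _ _ e
  have hsymm : ∀ p q w, s' p q w = s' q p w := by
    intro p q w
    by_cases e : π p = π q
    · simp [s', e]
    · have e' := Ne.symm e
      simp only [s', e, e', if_false]
      split_ifs with e1 e2
      · exact (e (e1.symm.trans e2)).elim
      all_goals first | rfl | exact hs _ _ _
  have key : ∀ a b, G.Adj x a → a ≠ y → G.Adj y b → b ≠ x → a ≠ b →
      τ' x y + τ' a y + τ' x b + τ' a b + s' x a y + s' x a b + s' y b x + s' y b a = 0 := by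
    intro a b ha hay hb hbx hab
    have e1 : π a ≠ π x := fun e => by have := ha.ne; have := (h.eq_iff a x).1 e; tauto
    have e2 : π b ≠ π x := fun e => by have := hb.ne; have := (h.eq_iff b x).1 e; tauto
    have e3 : π a ≠ π b := fun e => by
      have := ha.ne; have := hb.ne; have := (h.eq_iff a b).1 e; tauto
    have := hαβ a b ha hay hb hbx hab
    simp only [defect] at this
    have e4 := h.map_eq
    simp only [τ', s', σ, ← e4, e1, e2, e3, e1.symm, e2.symm, e3.symm, if_true, if_false,
      hxy.symm]
    grind
  refine ⟨τ', s', hanti, fun p q r t h1 h2 h3 h4 h5 h6 => ?_⟩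
  have flat : ∀ r t, G.Adj r t → x ≠ r → y ≠ r → x ≠ t → y ≠ t →
      τ' x r + τ' y r + τ' x t + τ' y t + s' x y r + s' x y t + s' r t x + s' r t y = 0 := by
    intro r t h2 h3 h4 h5 h6
    have e1 : π r ≠ π x := fun e => by have := (h.eq_iff r x).1 e; tauto
    have e2 : π t ≠ π x := fun e => by have := (h.eq_iff t x).1 e; tauto
    have e3 : π r ≠ π t := fun e => by have := h2.ne; have := (h.eq_iff r t).1 e; tauto
    have e4 := h.map_eq
    simp only [τ', s', σ, ← e4, e1, e2, e3, e1.symm, e2.symm, if_true, if_false]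
    grind
  by_cases a1 : π p = π q
  · have := h1.ne
    rcases (h.eq_iff p q).1 a1 with e | ⟨rfl, rfl⟩ | ⟨rfl, rfl⟩
    · exact (this e).elim
    · exact flat r t h2 h3 h5 h4 h6
    · have := flat r t h2 h5 h3 h6 h4
      have := hsymm p q r
      have := hsymm p q t
      grind
  have flip : ∀ {p q}, p ≠ q → τ' p q = 1 + τ' q p := fun hpq => by
    have := hanti _ _ hpq
    grind
  by_cases a2 : π r = π t
  · have := h2.ne
    rw [flip h3, flip h4, flip h5, flip h6]
    rcases (h.eq_iff r t).1 a2 with e | ⟨rfl, rfl⟩ | ⟨rfl, rfl⟩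
    · exact (this e).elim
    · have := flat p q h1 h3.symm h4.symm h5.symm h6.symm
      grind
    · have := flat p q h1 h4.symm h3.symm h6.symm h5.symm
      have := hsymm r t p
      have := hsymm r t q
      grind
  have y1 := hsymm p q r
  have y2 := hsymm p q t
  have y3 := hsymm r t p
  have y4 := hsymm r t q
  have z1 := hanti _ _ h3
  have z2 := hanti _ _ h4
  have z3 := hanti _ _ h5
  have z4 := hanti _ _ h6
  by_cases c1 : π p = π r
  · rcases (h.eq_iff p r).1 c1 with e | ⟨rfl, rfl⟩ | ⟨rfl, rfl⟩
    · exact (h3 e).elim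
    · have := key q t h1 h5 h2 h4.symm h6
      grind
    · have := key t q h2 h4.symm h1 h5 h6.symm
      grind
  by_cases c2 : π p = π t
  · rcases (h.eq_iff p t).1 c2 with e | ⟨rfl, rfl⟩ | ⟨rfl, rfl⟩
    · exact (h4 e).elim
    · have := key q r h1 h6 h2.symm h3.symm h5
      grind
    · have := key r q h2.symm h3.symm h1 h6 h5.symm
      grind
  by_cases c3 : π q = π r
  · rcases (h.eq_iff q r).1 c3 with e | ⟨rfl, rfl⟩ | ⟨rfl, rfl⟩
    · exact (h5 e).elim
    · have := key p t h1.symm h3 h2 h6.symm h4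
      grind
    · have := key t p h2 h6.symm h1.symm h3 h4.symm
      grind
  by_cases c4 : π q = π t
  · rcases (h.eq_iff q t).1 c4 with e | ⟨rfl, rfl⟩ | ⟨rfl, rfl⟩
    · exact (h6 e).elim
    · have := key p r h1.symm h4 h2.symm h5.symm h3
      grind
    · have := key r p h2.symm h5.symm h1.symm h4 h3.symm
      grind
  have := hd.eq _ _ _ _ (h.adj_of_adj h1 a1) (h.adj_of_adj h2 a2) c1 c2 c3 c4
  simp only [τ', s', a1, a2, c1, c2, c3, c4, Ne.symm c1, Ne.symm c2, Ne.symm c3, Ne.symm c4,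
    if_false]
  exact this

lemma IsContr.defect_sum_eq_zero (h : IsContr G F x y π) {τ : W → W → ZMod 2}
    {s : W → W → W → ZMod 2} (hd : ZDraw F τ s) {a a' b b' : V} (hxa : G.Adj x a)
    (hxa' : G.Adj x a') (hyb : G.Adj y b) (hyb' : G.Adj y b')
    (hl : Linked G {v | v ≠ x ∧ v ≠ y} a a' b b') :
    defect τ s (π x) (π a) (π b) + defect τ s (π x) (π a) (π b') + defect τ s (π x) (π a') (π b) +
      defect τ s (π x) (π a') (π b') = 0 := by
  obtain ⟨P, Q, hP, hQ, hPQ⟩ := (h.linked_map hl).exists_walks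
  have Pz : π x ∉ P.support := fun e => hP _ e rfl
  have Qz : π x ∉ Q.support := fun e => hQ _ e rfl
  have na : π a ≠ π x := hP _ P.start_mem_support
  have na' : π a' ≠ π x := hP _ P.end_mem_support
  have nb : π b ≠ π x := hQ _ Q.start_mem_support
  have nb' : π b' ≠ π x := hQ _ Q.end_mem_support
  have ea := h.adj_of_adj hxa na.symm
  have ea' := h.adj_of_adj hxa' na'.symm
  have eb := h.adj_of_adj hyb (h.map_eq ▸ nb.symm)
  have eb' := h.adj_of_adj hyb' (h.map_eq ▸ nb'.symm)
  rw [← h.map_eq] at eb eb'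
  have w := hd.walk_walk P Q hPQ
  have w1 := hd.walk_edge P eb Pz (hPQ _ Q.start_mem_support)
  have w2 := hd.walk_edge P eb' Pz (hPQ _ Q.end_mem_support)
  have w3 := hd.walk_edge Q ea Qz fun e => hPQ _ e P.start_mem_support
  have w4 := hd.walk_edge Q ea' Qz fun e => hPQ _ e P.end_mem_support
  have z1 := hd.anti (π a) (π b) fun e => hPQ _ Q.start_mem_support (e ▸ P.start_mem_support)
  have z2 := hd.anti (π a) (π b') fun e => hPQ _ Q.end_mem_support (e ▸ P.start_mem_support)
  have z3 := hd.anti (π a') (π b) fun e => hPQ _ Q.start_mem_support (e ▸ P.end_mem_support)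
  have z4 := hd.anti (π a') (π b') fun e => hPQ _ Q.end_mem_support (e ▸ P.end_mem_support)
  simp only [defect]
  clear h hl hP hQ hPQ
  grind

/-- A quadruple of distinct vertices, the first two adjacent to `x` and the last two to `y`. -/
structure IsQuad (G : SimpleGraph V) (x y a a' b b' : V) : Prop where
  xa : G.Adj x a
  xa' : G.Adj x a'
  yb : G.Adj y b
  yb' : G.Adj y b'
  aa' : a ≠ a'
  bb' : b ≠ b'
  ab : a ≠ b
  ab' : a ≠ b'
  a'b : a' ≠ b
  a'b' : a' ≠ b'
  ay : a ≠ y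
  a'y : a' ≠ y
  bx : b ≠ x
  b'x : b' ≠ x

/-- If contracting `xy` makes an undrawable graph drawable, some quadruple is obstructed. -/
theorem IsContr.exists_odd [Countable W] (h : IsContr G F x y π) (hF : ZPlanar F)
    (hG : ¬ ZPlanar G) (hP : ∀ u v, ∃ a, (G.Adj x a ∧ a ≠ y) ∧ a ≠ u ∧ a ≠ v)
    (hQ : ∀ u v, ∃ a, (G.Adj y a ∧ a ≠ x) ∧ a ≠ u ∧ a ≠ v)
    (hPQ : ∀ u v w, ∃ a, ((G.Adj x a ∧ a ≠ y) ∨ (G.Adj y a ∧ a ≠ x)) ∧ a ≠ u ∧ a ≠ v ∧ a ≠ w) :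
    ∃ δ : V → V → ZMod 2, (∀ a a' b b', IsQuad G x y a a' b b' →
        Linked G {v | v ≠ x ∧ v ≠ y} a a' b b' → δ a b + δ a b' + δ a' b + δ a' b' = 0) ∧
      ∃ a a' b b', IsQuad G x y a a' b b' ∧ δ a b + δ a b' + δ a' b + δ a' b' ≠ 0 := by
  obtain ⟨τ, s, hd, hs⟩ := hF.exists_symm
  refine ⟨fun a b => defect τ s (π x) (π a) (π b), fun a a' b b' q hl =>
    h.defect_sum_eq_zero hd q.xa q.xa' q.yb q.yb' hl, ?_⟩
  by_contra! hcon
  obtain ⟨α, β, hαβ⟩ := exists_rank_one (δ := fun a b => defect τ s (π x) (π a) (π b)) hP hQ hPQ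
    fun a a' b b' ha ha' hb hb' h1 h2 h3 h4 h5 h6 => hcon a a' b b'
      ⟨ha.1, ha'.1, hb.1, hb'.1, h1, h2, h3, h4, h5, h6, ha.2, ha'.2, hb.2, hb'.2⟩
  exact hG (h.zPlanar_of_defect hd hs fun a b ha ha' hb hb' hab =>
    hαβ a b ⟨ha, ha'⟩ ⟨hb, hb'⟩ hab)

end Lifting

section ContractEdge

set_option linter.unusedSectionVars false

open Finset

variable {V W : Type*} {G : SimpleGraph V} {F : SimpleGraph W} {x y : V} {π : V → W}

lemma IsContr.card_preimage [Fintype V] [DecidableEq V] [DecidableEq W] (h : IsContr G F x y π)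
    (A : Finset W) : #((univ.filter fun v => π v ∈ A).erase y) = #A := by
  rw [← card_image_of_injOn (f := π) (s := (univ.filter fun v => π v ∈ A).erase y)]
  · congr 1
    ext w
    simp only [mem_image, mem_erase, mem_filter, mem_univ, true_and]
    constructor
    · rintro ⟨v, ⟨-, hv⟩, rfl⟩
      exact hv
    · intro hw
      obtain ⟨v, rfl⟩ := h.surj w
      by_cases hv : v = y
      · subst hv
        exact ⟨x, ⟨h.adj.ne, h.map_eq ▸ hw⟩, h.map_eq⟩
      · exact ⟨v, ⟨hv, hw⟩, rfl⟩
  · intro u hu v hv e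
    simp only [coe_erase, Set.mem_sdiff, Set.mem_singleton_iff] at hu hv
    rcases (h.eq_iff u v).1 e with e | e | e
    exacts [e, (hv.2 e.2).elim, (hu.2 e.1).elim]

lemma IsContr.card [Fintype V] [Fintype W] (h : IsContr G F x y π) :
    Fintype.card W + 1 = Fintype.card V := by
  classical
  have := h.card_preimage univ
  simp only [mem_univ, filter_true, card_univ] at this
  rw [card_erase_of_mem (mem_univ _), card_univ] at this
  have : 0 < Fintype.card V := Fintype.card_pos_iff.2 ⟨y⟩
  omega

theorem IsContr.conn4 [Fintype V] [Fintype W] (h : IsContr G F x y π) (hc : Conn4 G)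
    (hn : 6 ≤ Fintype.card V) (hxy : Contr G x y) : Conn4 F := by
  classical
  have hcard := h.card
  refine ⟨by omega, fun A B hAB hA hB => ?_⟩
  let A' : Finset V := univ.filter fun v => π v ∈ A
  let B' : Finset V := univ.filter fun v => π v ∈ B
  have cA : #(A'.erase y) = #A := h.card_preimage A
  have cB : #(B'.erase y) = #B := h.card_preimage B
  have hsep : IsSep G A' B' := by
    refine ⟨disjoint_left.2 fun v hv hv' => disjoint_left.1 hAB.1 (mem_filter.1 hv).2
      (mem_filter.1 hv').2, fun a ha b hb e => ?_⟩
    have ha := (mem_filter.1 ha).2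
    have hb := (mem_filter.1 hb).2
    exact hAB.2 _ ha _ hb (h.adj_of_adj e fun e' => disjoint_left.1 hAB.1 ha (e' ▸ hb))
  have hne : ∀ {A : Finset W}, A.Nonempty → (univ.filter fun v => π v ∈ A).Nonempty := by
    rintro A ⟨w, hw⟩
    obtain ⟨v, rfl⟩ := h.surj w
    exact ⟨v, by simpa⟩
  have h4 := hc.2 A' B' hsep (hne hA) (hne hB)
  have leA := card_erase_le (s := A') (a := y)
  have leB := card_erase_le (s := B') (a := y)
  have mem : ∀ {A : Finset W}, (y ∈ univ.filter fun v => π v ∈ A) ↔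
      x ∈ univ.filter fun v => π v ∈ A := by simp [h.map_eq]
  by_cases yA : y ∈ A'
  · have := card_erase_add_one yA
    omega
  by_cases yB : y ∈ B'
  · have := card_erase_add_one yB
    omega
  rw [erase_eq_of_notMem yA] at cA
  rw [erase_eq_of_notMem yB] at cB
  by_contra hcon
  exact hxy A' B' ⟨hsep, hne hA, hne hB, by omega⟩ (fun e => yA (mem.2 e)) (fun e => yB (mem.2 e))
    yA yB

open Classical in
/-- The quotient map onto the contraction of the edge `uv`. -/
noncomputable def contractMap {V : Type} {u v : V} (huv : u ≠ v) (w : V) : {w : V // w ≠ v} :=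
  if h : w = v then ⟨u, huv⟩ else ⟨w, h⟩

lemma isContr_contractEdge {V : Type} {G : SimpleGraph V} {u v : V} (h : G.Adj u v) :
    IsContr G (contractEdge G u v) u v (contractMap h.ne) := by
  have hv : contractMap h.ne v = ⟨u, h.ne⟩ := dif_pos rfl
  have hw : ∀ w (e : w ≠ v), contractMap h.ne w = ⟨w, e⟩ := fun w e => dif_neg e
  have heq : ∀ a b, contractMap h.ne a = contractMap h.ne b ↔
      a = b ∨ (a = u ∧ b = v) ∨ (a = v ∧ b = u) := by
    intro a b
    have := h.ne
    by_cases ha : a = v <;> by_cases hb : b = v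
    · subst ha; subst hb; simp
    · subst ha; rw [hv, hw b hb]; simp only [Subtype.mk.injEq]; tauto
    · subst hb; rw [hv, hw a ha]; simp only [Subtype.mk.injEq]; tauto
    · rw [hw a ha, hw b hb]; simp only [Subtype.mk.injEq]; tauto
  have hs : ∀ w : {w : V // w ≠ v}, contractMap h.ne w.1 = w := fun w => hw _ w.2
  refine ⟨h, fun w => ⟨w.1, hs w⟩, heq, fun a b => ?_⟩
  generalize ea : contractMap h.ne a = a₁
  generalize eb : contractMap h.ne b = b₁
  simp only [contractEdge, fromRel_adj]
  refine and_congr_right fun hne => ?_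
  constructor
  · rintro ((e | ⟨e1, e2⟩) | (e | ⟨e1, e2⟩))
    · exact ⟨a₁, b₁, hs _, hs _, e⟩
    · exact ⟨v, b₁, by rw [hv, ← hs a₁, e1, hw u h.ne], hs _, e2⟩
    · exact ⟨a₁, b₁, hs _, hs _, e.symm⟩
    · exact ⟨a₁, v, hs _, by rw [hv, ← hs b₁, e1, hw u h.ne], e2.symm⟩
  · rintro ⟨a', b', rfl, rfl, e⟩
    by_cases ha : a' = v <;> by_cases hb : b' = v
    · subst ha; subst hb; exact (e.ne rfl).elim
    · subst ha; rw [hv, hw b' hb]; exact .inl (.inr ⟨rfl, e⟩)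
    · subst hb; rw [hv, hw a' ha]; exact .inr (.inr ⟨rfl, e.symm⟩)
    · rw [hw a' ha, hw b' hb]; exact .inl (.inl e)

end ContractEdge

section Unlinked

set_option linter.unusedSectionVars false

open Finset

lemma IsQuad.swap_left {V : Type*} {G : SimpleGraph V} {x y a a' b b' : V}
    (h : IsQuad G x y a a' b b') : IsQuad G x y a' a b b' :=
  ⟨h.xa', h.xa, h.yb, h.yb', h.aa'.symm, h.bb', h.a'b, h.a'b', h.ab, h.ab', h.a'y, h.ay,
    h.bx, h.b'x⟩

lemma IsQuad.swap {V : Type*} {G : SimpleGraph V} {x y a a' b b' : V}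
    (h : IsQuad G x y a a' b b') : IsQuad G y x b b' a a' :=
  ⟨h.yb, h.yb', h.xa, h.xa', h.bb', h.aa', h.ab.symm, h.a'b.symm, h.ab'.symm, h.a'b'.symm, h.bx,
    h.b'x, h.ay, h.a'y⟩

variable {V : Type} [Fintype V] [DecidableEq V] {G : SimpleGraph V} {x y a a' b b' p q c : V}

lemma Conn4.exists_adj_ne (hc : Conn4 G) (u p q r : V) :
    ∃ a, G.Adj u a ∧ a ≠ p ∧ a ≠ q ∧ a ≠ r := by
  by_contra! h
  have : nb G u ⊆ {p, q, r} := fun w hw => by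
    have := h w (mem_nb.1 hw)
    simp only [mem_insert, mem_singleton]
    tauto
  have := (card_le_card this).trans card_le_three
  have := hc.four_le_nb u
  omega

/-- Contracting a contractible edge always gives a drawable graph. -/
def ContrZPlanar {V : Type} [Fintype V] (G : SimpleGraph V) : Prop :=
  ∀ p q, G.Adj p q → Contr G p q → ZPlanar (contractEdge G p q)

/-- The edge `xy` is contractible and carries a quadruple that is not linked off `x` and `y`. -/
structure IsUnlinked (G : SimpleGraph V) (x y a a' b b' : V) : Prop extends
    IsQuad G x y a a' b b' where
  adj : G.Adj x y
  contr : Contr G x y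
  not_linked : ¬ Linked G {v | v ≠ x ∧ v ≠ y} a a' b b'

lemma IsUnlinked.swap_left (h : IsUnlinked G x y a a' b b') : IsUnlinked G x y a' a b b' :=
  ⟨h.toIsQuad.swap_left, h.adj, h.contr, fun hl => h.not_linked hl.symm_left⟩

lemma IsUnlinked.swap (h : IsUnlinked G x y a a' b b') : IsUnlinked G y x b b' a a' :=
  ⟨h.toIsQuad.swap, h.adj.symm, h.contr.symm,
    fun hl => h.not_linked (hl.swap.mono fun _ hv => ⟨hv.2, hv.1⟩)⟩

lemma IsContr.linked_of_isQuad {W : Type*} [Fintype W] {F : SimpleGraph W} {π : V → W}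
    (h : IsContr G F p q π) (hc : Conn4 F) (hF : ZPlanar F) (e : F.Adj (π x) (π y))
    (hq : IsQuad F (π x) (π y) (π a) (π a') (π b) (π b')) :
    Linked G {v | π v ≠ π x ∧ π v ≠ π y} a a' b b' := by
  classical
  exact h.linked (hF.linked (hc.noCut _ _) e hq.xa hq.xa' hq.yb hq.yb' hq.aa' hq.bb' hq.ab hq.ab'
    hq.a'b hq.a'b' hq.ay hq.a'y hq.bx hq.b'x)

lemma ContrZPlanar.linked_of_adj_right (hG : ContrZPlanar G) (hc : Conn4 G)
    (hn : 7 ≤ Fintype.card V) (hcx : G.Adj c x) (hcon : Contr G c x)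
    (hy : G.Adj x y) (hcy : c ≠ y) (hxa : G.Adj x a ∨ G.Adj c a) (hxa' : G.Adj x a' ∨ G.Adj c a')
    (hyb : G.Adj y b) (hyb' : G.Adj y b') (haa' : a ≠ a') (hbb' : b ≠ b') (hab : a ≠ b)
    (hab' : a ≠ b') (ha'b : a' ≠ b) (ha'b' : a' ≠ b') (hax : a ≠ x) (ha'x : a' ≠ x)
    (hac : a ≠ c) (ha'c : a' ≠ c) (hay : a ≠ y) (ha'y : a' ≠ y) (hbx : b ≠ x) (hb'x : b' ≠ x)
    (hbc : b ≠ c) (hb'c : b' ≠ c) :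
    Linked G {v | v ≠ x ∧ v ≠ y ∧ v ≠ c} a a' b b' := by
  have h := isContr_contractEdge hcx
  have hF := hG _ _ hcx hcon
  have hcF := h.conn4 hc (by omega) hcon
  generalize contractMap hcx.ne = π at h
  have hne : ∀ {u v}, u ≠ v → u ≠ c → u ≠ x → π u ≠ π v := by
    intro u v h1 h2 h3 e
    have := (h.eq_iff u v).1 e
    tauto
  have hadj : ∀ {u v}, G.Adj u v → u ≠ c → u ≠ x → (contractEdge G c x).Adj (π u) (π v) :=
    fun e h2 h3 => h.adj_of_adj e (hne e.ne h2 h3)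
  have hadj' : ∀ {u}, G.Adj x u ∨ G.Adj c u → u ≠ c → u ≠ x →
      (contractEdge G c x).Adj (π x) (π u) := by
    rintro u (e | e) h2 h3
    · exact (hadj e.symm h2 h3).symm
    · exact h.map_eq ▸ (hadj e.symm h2 h3).symm
  refine (h.linked_of_isQuad (x := x) (y := y) hcF hF (hadj' (.inl hy) hcy.symm hy.ne')
    ⟨hadj' hxa hac hax, hadj' hxa' ha'c ha'x,
      (hadj hyb.symm hbc hbx).symm, (hadj hyb'.symm hb'c hb'x).symm,
    hne haa' hac hax, hne hbb' hbc hbx, hne hab hac hax, hne hab' hac hax, hne ha'b ha'c ha'x,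
    hne ha'b' ha'c ha'x, hne hay hac hax, hne ha'y ha'c ha'x, hne hbx hbc hbx,
    hne hb'x hb'c hb'x⟩).mono ?_
  rintro v ⟨h1, h2⟩
  refine ⟨fun e => h1 (by rw [e]), fun e => h2 (by rw [e]), fun e => h1 (by rw [e, h.map_eq])⟩

/-- A contractible edge off `x` and `y` meets every unlinked quadruple in two places. -/
lemma IsUnlinked.mem_of_contr (h : IsUnlinked G x y a a' b b') (hG : ContrZPlanar G)
    (hc : Conn4 G) (hn : 7 ≤ Fintype.card V) (hpq : G.Adj p q) (hcon : Contr G p q)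
    (hpx : p ≠ x) (hpy : p ≠ y) (hqx : q ≠ x) (hqy : q ≠ y) :
    (p = a ∨ p = a' ∨ p = b ∨ p = b') ∧ (q = a ∨ q = a' ∨ q = b ∨ q = b') := by
  by_contra hh
  have hI := isContr_contractEdge hpq
  have hF := hG _ _ hpq hcon
  have hcF := hI.conn4 hc (by omega) hcon
  generalize contractMap hpq.ne = π at hI
  have h1 := h.toIsQuad
  have hx : ∀ {u}, u ≠ x → π u ≠ π x := by
    intro u hu e
    have := (hI.eq_iff u x).1 e
    tauto
  have hy : ∀ {u}, u ≠ y → π u ≠ π y := by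
    intro u hu e
    have := (hI.eq_iff u y).1 e
    tauto
  have hne : ∀ {u v}, u ≠ v → (u = a ∨ u = a' ∨ u = b ∨ u = b') →
      (v = a ∨ v = a' ∨ v = b ∨ v = b') → π u ≠ π v := by
    intro u v huv h2 h3 e
    rcases (hI.eq_iff u v).1 e with e | ⟨rfl, rfl⟩ | ⟨rfl, rfl⟩
    exacts [huv e, hh ⟨h2, h3⟩, hh ⟨h3, h2⟩]
  refine h.not_linked ((hI.linked_of_isQuad (x := x) (y := y) hcF hF
    (hI.adj_of_adj h.adj (hx h.adj.ne').symm)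
    ⟨hI.adj_of_adj h1.xa (hx h1.xa.ne').symm, hI.adj_of_adj h1.xa' (hx h1.xa'.ne').symm,
    hI.adj_of_adj h1.yb (hy h1.yb.ne').symm, hI.adj_of_adj h1.yb' (hy h1.yb'.ne').symm,
    hne h1.aa' (by simp) (by simp), hne h1.bb' (by simp) (by simp), hne h1.ab (by simp) (by simp),
    hne h1.ab' (by simp) (by simp), hne h1.a'b (by simp) (by simp),
    hne h1.a'b' (by simp) (by simp), hy h1.ay, hy h1.a'y, hx h1.bx, hx h1.b'x⟩).mono ?_)
  rintro v ⟨h1, h2⟩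
  exact ⟨fun e => h1 (by rw [e]), fun e => h2 (by rw [e])⟩

/-- The ends of a contractible edge and two further vertices do not separate the graph. -/
lemma Contr.joinIn (hcon : Contr G x y) (hxy : x ≠ y) (haa' : a ≠ a') (hax : a ≠ x) (hay : a ≠ y)
    (ha'x : a' ≠ x) (ha'y : a' ≠ y) (hb : b ≠ x ∧ b ≠ y ∧ b ≠ a ∧ b ≠ a')
    (hb' : b' ≠ x ∧ b' ≠ y ∧ b' ≠ a ∧ b' ≠ a') :
    JoinIn G {v | v ≠ x ∧ v ≠ y ∧ v ≠ a ∧ v ≠ a'} b b' := by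
  classical
  by_contra h
  obtain ⟨T, hT, hbT, hb'T, hcut⟩ :=
    exists_cut_of_not_joinIn (S := {v | v ≠ x ∧ v ≠ y ∧ v ≠ a ∧ v ≠ a'}) hb h
  have hS : (univ.filter (· ∈ T)) ∪ (univ.filter fun v => v ∉ T ∧ v ∉ ({x, y, a, a'} : Finset V)) =
      ({x, y, a, a'} : Finset V)ᶜ := by
    ext v
    have : v ∈ T → v ≠ x ∧ v ≠ y ∧ v ≠ a ∧ v ≠ a' := fun h => hT h
    simp only [mem_union, mem_filter, mem_univ, true_and, mem_compl, mem_insert, mem_singleton]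
    tauto
  have hd : Disjoint (univ.filter (· ∈ T))
      (univ.filter fun v => v ∉ T ∧ v ∉ ({x, y, a, a'} : Finset V)) :=
    disjoint_left.2 fun v hv hv' => (mem_filter.1 hv').2.1 (mem_filter.1 hv).2
  refine hcon _ _ ⟨⟨hd, fun u hu v hv => ?_⟩, ⟨b, by simpa⟩, ⟨b', by simpa [hb'T] using hb'⟩, ?_⟩
    ?_ ?_ ?_ ?_
  · simp only [mem_filter, mem_univ, true_and, mem_insert, mem_singleton, not_or] at hu hv
    exact hcut u hu v hv.2 hv.1
  · have := congrArg card hS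
    have h4 : #({x, y, a, a'} : Finset V) = 4 := by
      simp [card_insert_of_notMem, hxy, hax.symm, ha'x.symm, hay.symm, ha'y.symm, haa']
    have := card_le_univ ({x, y, a, a'} : Finset V)
    rw [card_union_of_disjoint hd, card_compl] at *
    omega
  all_goals simp
  all_goals first | exact fun h => (hT h).1 rfl | exact fun h => (hT h).2.1 rfl

lemma IsQuad.linked_of_adj (h : IsQuad G x y a a' b b') (hcon : Contr G x y) (hxy : x ≠ y)
    (haa' : G.Adj a a') : Linked G {v | v ≠ x ∧ v ≠ y} a a' b b' := by
  refine ⟨{v | v = a ∨ v = a'}, {v | v ≠ x ∧ v ≠ y ∧ v ≠ a ∧ v ≠ a'}, ?_, ?_,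
    fun v hv => ⟨hv.1, hv.2.1⟩, .of_adj (by simp) (by simp) haa',
    hcon.joinIn hxy h.aa' h.xa.ne' h.ay h.xa'.ne' h.a'y ⟨h.bx, h.yb.ne', h.ab.symm, h.a'b.symm⟩
      ⟨h.b'x, h.yb'.ne', h.ab'.symm, h.a'b'.symm⟩⟩
  · rw [Set.disjoint_left]
    rintro v (rfl | rfl) hv
    exacts [hv.2.2.1 rfl, hv.2.2.2 rfl]
  · rintro v (rfl | rfl)
    exacts [⟨h.xa.ne', h.ay⟩, ⟨h.xa'.ne', h.a'y⟩]

lemma IsUnlinked.not_adj (h : IsUnlinked G x y a a' b b') : ¬ G.Adj a a' :=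
  fun e => h.not_linked (h.linked_of_adj h.contr h.adj.ne e)

/-- The edges from `x` to an unlinked quadruple are not contractible. -/
lemma IsUnlinked.not_contr (h : IsUnlinked G x y a a' b b') (hG : ContrZPlanar G)
    (hc : Conn4 G) (hn : 7 ≤ Fintype.card V) : ¬ Contr G x a := by
  intro hcon
  obtain ⟨p, hp, hpx, hpy, hpb, hpb'⟩ : ∃ p, G.Adj a p ∧ p ≠ x ∧ p ≠ y ∧ p ≠ b ∧ p ≠ b' := by
    classical
    have hI := isContr_contractEdge h.adj
    have hcF := hI.conn4 hc (by omega) h.contr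
    generalize contractMap h.adj.ne = π at hI
    obtain ⟨w, hw, h1, h2, h3⟩ := hcF.exists_adj_ne (π a) (π x) (π b) (π b')
    obtain ⟨p, rfl⟩ := hI.surj w
    obtain ⟨h0, u, p', hu, hp', e⟩ := (hI.adj_iff _ _).1 hw
    rw [← hp'] at h1 h2 h3
    obtain rfl : u = a := by
      have := (hI.eq_iff _ _).1 hu
      have := h.ay
      have := h.xa.ne'
      tauto
    exact ⟨p', e, fun e => h1 (e ▸ rfl), fun e => h1 (e ▸ hI.map_eq.symm), fun e => h2 (e ▸ rfl),
      fun e => h3 (e ▸ rfl)⟩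
  have hpa' : p ≠ a' := fun e => h.not_adj (e ▸ hp)
  obtain ⟨S, T, hST, hS, hT, hj, hj'⟩ := hG.linked_of_adj_right hc hn h.xa.symm hcon.symm h.adj h.ay
    (.inr hp) (.inl h.xa') h.yb h.yb' hpa' h.bb' hpb hpb' h.a'b h.a'b' hpx h.xa'.ne' hp.ne'
    h.aa'.symm hpy h.a'y h.bx h.b'x h.ab.symm h.ab'.symm
  refine h.not_linked ⟨insert a S, T, ?_, ?_, fun v hv => ⟨(hT hv).1, (hT hv).2.1⟩, ?_, hj'⟩
  · rw [Set.disjoint_insert_left]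
    exact ⟨fun ha => (hT ha).2.2 rfl, hST⟩
  · rintro v (rfl | hv)
    exacts [⟨h.xa.ne', h.ay⟩, ⟨(hS hv).1, (hS hv).2.1⟩]
  · exact (JoinIn.of_adj (by simp) (Set.mem_insert_of_mem _ hj.left_mem) hp).trans
      (hj.mono (Set.subset_insert _ _))

/-- Other edges at `x` are not contractible unless they go to `y` or to the quadruple. -/
lemma IsUnlinked.not_contr_of_ne (h : IsUnlinked G x y a a' b b') (hG : ContrZPlanar G)
    (hc : Conn4 G) (hn : 7 ≤ Fintype.card V) (hxc : G.Adj x c) (hcy : c ≠ y) (hca : c ≠ a)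
    (hca' : c ≠ a') (hcb : c ≠ b) (hcb' : c ≠ b') : ¬ Contr G x c := by
  intro hcon
  exact h.not_linked ((hG.linked_of_adj_right hc hn hxc.symm hcon.symm h.adj hcy (.inl h.xa)
    (.inl h.xa') h.yb h.yb' h.aa' h.bb' h.ab h.ab' h.a'b h.a'b' h.xa.ne' h.xa'.ne' hca.symm
    hca'.symm h.ay h.a'y h.bx h.b'x hcb.symm hcb'.symm).mono fun v hv => ⟨hv.1, hv.2.1⟩)

end Unlinked

section Lifting

set_option linter.unusedSectionVars false

open Finset

variable {V : Type} [Fintype V] [DecidableEq V] {G : SimpleGraph V} {x y a a' b b' c : V}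
  {A B : Finset V}

/-- The case that the fourth neighbour of `x` is `b`: one of the two separations. -/
lemma IsUnlinked.adj_of_adj_iff (h : IsUnlinked G x y a a' b b') (hG : ContrZPlanar G)
    (hc : Conn4 G) (hn : 7 ≤ Fintype.card V)
    (hx : ∀ w, G.Adj x w ↔ w = y ∨ w = a ∨ w = a' ∨ w = b) : G.Adj b a' ∧ ¬ G.Adj b a := by
  obtain ⟨A, B, ht, hxA, hxB, haA, haB, hyB⟩ : ∃ A B, IsTight G A B ∧ x ∉ A ∧ x ∉ B ∧
      a ∉ A ∧ a ∉ B ∧ y ∈ B := by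
    obtain ⟨A, B, ht, h1, h2, h3, h4⟩ := _root_.not_contr (h.not_contr hG hc hn)
    by_cases hB : y ∈ B
    · exact ⟨A, B, ht, h1, h2, h3, h4, hB⟩
    · by_cases hA : y ∈ A
      · exact ⟨B, A, ht.symm, h2, h1, h4, h3, hA⟩
      · exact (h.contr A B ht h1 h2 hA hB).elim
  have hyA : y ∉ A := ht.symm.notMem_of_mem_left hyB
  have hbA : b ∉ A := ht.symm.notMem_of_adj hyB h.yb
  have hu : ∀ w ∈ A, G.Adj x w → w = a' := by
    intro w hw e
    rcases (hx w).1 e with rfl | rfl | rfl | rfl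
    exacts [(hyA hw).elim, (haA hw).elim, rfl, (hbA hw).elim]
  have ha'A : a' ∈ A := by
    obtain ⟨w, hw, e⟩ := ht.exists_adj_left hc hxA hxB
    exact hu w hw e ▸ hw
  have hA2 : 2 ≤ #A := by
    by_contra hlt
    have : #A = 1 := by
      have := card_pos.2 ⟨_, ha'A⟩
      omega
    obtain ⟨w, rfl⟩ := card_eq_one.1 this
    obtain rfl := mem_singleton.1 ha'A
    exact h.not_adj ((ht.adj_of_singleton hc a).2 ⟨h.aa', haB⟩).symm
  obtain ⟨f, β, γ, hfA, hfB, hβ, hγ, hβb, hf⟩ := exists_apex hc ht hA2 hxA hxB ha'A hu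
    (h.swap_left.not_contr hG hc hn)
  have hfx : G.Adj x f := ((hf x).2 (by simp)).symm
  have hfa' : G.Adj f a' := (hf a').2 (by simp)
  rcases (hx f).1 hfx with rfl | rfl | rfl | rfl
  · exact (hfB hyB).elim
  · exact (h.not_adj hfa').elim
  · exact (hfA ha'A).elim
  · refine ⟨hfa', fun e => ?_⟩
    rcases (hf a).1 e with rfl | rfl | rfl | rfl
    exacts [h.xa.ne rfl, h.aa' rfl, haA hβ, haB hγ]

lemma IsUnlinked.not_adj_iff (h : IsUnlinked G x y a a' b b') (hG : ContrZPlanar G)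
    (hc : Conn4 G) (hn : 7 ≤ Fintype.card V) :
    ¬ ∀ w, G.Adj x w ↔ w = y ∨ w = a ∨ w = a' ∨ w = b := fun hx =>
  (h.swap_left.adj_of_adj_iff hG hc hn fun w => by rw [hx w]; tauto).2
    (h.adj_of_adj_iff hG hc hn hx).1

/-- A set closed in one side of a tight separation minus `y` meets every vertex of the separator
other than a vertex `x` whose only neighbour on that side is `y`. -/
lemma IsTight.exists_adj_of_closed (hc : Conn4 G) (ht : IsTight G A B) (hyB : y ∈ B)
    (hx : ∀ w ∈ B, G.Adj x w → w = y) {D : Finset V} (hD : D ⊆ B) (hyD : y ∉ D)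
    (hne : D.Nonempty) (hcl : ∀ d ∈ D, ∀ w ∈ B, w ≠ y → G.Adj d w → w ∈ D) {s : V} (hsA : s ∉ A)
    (hsB : s ∉ B) (hxA : x ∉ A) (hxB : x ∉ B) (hsx : s ≠ x) : ∃ d ∈ D, G.Adj d s := by
  by_contra! hs
  have hS : #((A ∪ B)ᶜ) = 4 := by
    have := ht.2.2.2
    have := card_union_of_disjoint ht.1.1
    rw [card_compl]
    omega
  have hN : ∀ d ∈ D, ∀ w, G.Adj d w → w ∈ D ∪ insert y (((A ∪ B)ᶜ.erase x).erase s) := by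
    intro d hd w e
    by_cases hwy : w = y
    · simp [hwy]
    by_cases hwB : w ∈ B
    · exact mem_union_left _ (hcl d hd w hwB hwy e)
    · have hwA : w ∉ A := ht.symm.notMem_of_adj (hD hd) e
      have hwx : w ≠ x := by
        rintro rfl
        exact hyD (hx d (hD hd) e.symm ▸ hd)
      have hws : w ≠ s := by
        rintro rfl
        exact hs d hd e
      simp [*]
  have h3 : #(insert y (((A ∪ B)ᶜ.erase x).erase s)) ≤ 3 := by
    refine (card_insert_le _ _).trans ?_
    rw [card_erase_of_mem (by simp [*]), card_erase_of_mem (by simp [*]), hS]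
  have hu := hc.card_nbrs hne hN h3
  obtain ⟨α, hα⟩ := ht.2.1
  have hαB := ht.notMem_of_mem_left hα
  have : α ∈ D ∪ insert y (((A ∪ B)ᶜ.erase x).erase s) := hu ▸ mem_univ α
  have hαy : α ≠ y := fun e => hαB (e ▸ hyB)
  exact hαB (hD (by simpa [hα, hαy] using this))

/-- Linking a quadruple along the two sides of a tight separation. -/
lemma IsTight.linked (hc : Conn4 G) (ht : IsTight G A B) (hxA : x ∉ A) (hxB : x ∉ B) (hyB : y ∈ B)
    (hx : ∀ w ∈ B, G.Adj x w → w = y) (hB : 2 ≤ #B) (haA : a ∉ A) (haB : a ∉ B) (ha'B : a' ∉ B)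
    (hq : IsQuad G x y a a' b b') : Linked G {v | v ≠ x ∧ v ≠ y} a a' b b' := by
  have hyA : y ∉ A := ht.symm.notMem_of_mem_left hyB
  refine ⟨{v | v ∈ A ∨ v = a ∨ v = a'}, {v | v ∉ A ∧ v ≠ x ∧ v ≠ y ∧ v ≠ a ∧ v ≠ a'}, ?_, ?_,
    fun v hv => ⟨hv.2.1, hv.2.2.1⟩, ?_, ?_⟩
  · rw [Set.disjoint_left]
    rintro v (h | h | h) ⟨h1, h2, h3, h4, h5⟩
    exacts [h1 h, h4 h, h5 h]
  · rintro v (h | rfl | rfl)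
    · exact ⟨fun e => hxA (e ▸ h), fun e => hyA (e ▸ h)⟩
    · exact ⟨hq.xa.ne', hq.ay⟩
    · exact ⟨hq.xa'.ne', hq.a'y⟩
  · by_contra h
    obtain ⟨T, hT, haT, ha'T, hcut⟩ :=
      exists_cut_of_not_joinIn (S := {v | v ∈ A ∨ v = a ∨ v = a'}) (by simp) h
    classical
    by_cases hR : (A.filter fun v => v ∉ T).Nonempty
    · obtain ⟨r, hr⟩ := hR
      have hN : ∀ d ∈ A.filter fun v => v ∉ T, ∀ w, G.Adj d w →
          w ∈ (A.filter fun v => v ∉ T) ∪ ((A ∪ B)ᶜ.erase a) := by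
        intro d hd w e
        rw [mem_filter] at hd
        have hwB : w ∉ B := ht.notMem_of_adj hd.1 e
        have hwT : w ∉ T := fun hw => hcut w hw d (.inl hd.1) hd.2 e.symm
        have hwa : w ≠ a := fun h => hwT (h ▸ haT)
        by_cases hwA : w ∈ A <;> simp [*]
      have hS : #((A ∪ B)ᶜ.erase a) ≤ 3 := by
        rw [card_erase_of_mem (by simp [*]), card_compl, card_union_of_disjoint ht.1.1]
        have := ht.2.2.2
        omega
      have hu := hc.card_nbrs ⟨r, hr⟩ hN hS
      have : y ∈ (A.filter fun v => v ∉ T) ∪ ((A ∪ B)ᶜ.erase a) := hu ▸ mem_univ y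
      simp [hyA, hyB] at this
    · have hAT : ∀ v ∈ A, v ∈ T := fun v hv => by
        by_contra hvT
        exact hR ⟨v, mem_filter.2 ⟨hv, hvT⟩⟩
      obtain ⟨w, hw, e⟩ := ht.exists_adj_left hc (fun h => ha'T (hAT _ h)) ha'B
      exact hcut w (hAT w hw) a' (by simp) ha'T e.symm
  · have hbA : b ∉ A := ht.symm.notMem_of_adj hyB hq.yb
    have hb'A : b' ∉ A := ht.symm.notMem_of_adj hyB hq.yb'
    have hb : b ∉ A ∧ b ≠ x ∧ b ≠ y ∧ b ≠ a ∧ b ≠ a' :=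
      ⟨hbA, hq.bx, hq.yb.ne', hq.ab.symm, hq.a'b.symm⟩
    have hb' : b' ∉ A ∧ b' ≠ x ∧ b' ≠ y ∧ b' ≠ a ∧ b' ≠ a' :=
      ⟨hb'A, hq.b'x, hq.yb'.ne', hq.ab'.symm, hq.a'b'.symm⟩
    by_contra h
    obtain ⟨T, hT, hbT, hb'T, hcut⟩ := exists_cut_of_not_joinIn
      (S := {v | v ∉ A ∧ v ≠ x ∧ v ≠ y ∧ v ≠ a ∧ v ≠ a'}) hb h
    classical
    have hmem : ∀ v ∈ B, v ≠ y → v ∉ A ∧ v ≠ x ∧ v ≠ y ∧ v ≠ a ∧ v ≠ a' := fun v hv hvy =>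
      ⟨ht.symm.notMem_of_mem_left hv, fun e => hxB (e ▸ hv), hvy, fun e => haB (e ▸ hv),
        fun e => ha'B (e ▸ hv)⟩
    have hD : ∀ s, s ∉ A → s ∉ B → s ≠ x → ∀ v ∈ B, v ≠ y → v ∈ T →
        ∃ d ∈ B.filter fun v => v ≠ y ∧ v ∈ T, G.Adj d s := by
      intro s hsA hsB hsx v hv hvy hvT
      refine ht.exists_adj_of_closed hc hyB hx (filter_subset _ _) (by simp) ⟨v, by simp [*]⟩ ?_ hsA
        hsB hxA hxB hsx
      intro d hd w hw hwy e
      rw [mem_filter] at hd ⊢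
      refine ⟨hw, hwy, ?_⟩
      by_contra hwT
      exact hcut d hd.2.2 w (hmem w hw hwy) hwT e
    have hD' : ∀ s, s ∉ A → s ∉ B → s ≠ x → ∀ v ∈ B, v ≠ y → v ∉ T →
        ∃ d ∈ B.filter fun v => v ≠ y ∧ v ∉ T, G.Adj d s := by
      intro s hsA hsB hsx v hv hvy hvT
      refine ht.exists_adj_of_closed hc hyB hx (filter_subset _ _) (by simp) ⟨v, by simp [*]⟩ ?_ hsA
        hsB hxA hxB hsx
      intro d hd w hw hwy e
      rw [mem_filter] at hd ⊢
      refine ⟨hw, hwy, fun hwT => ?_⟩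
      exact hcut w hwT d (hmem d hd.1 hd.2.1) hd.2.2 e.symm
    obtain ⟨s, hs, hsxaa⟩ : ∃ s ∈ (A ∪ B)ᶜ, s ∉ ({x, a, a'} : Finset V) := by
      by_contra! hall
      have := (card_le_card hall).trans card_le_three
      rw [card_compl, card_union_of_disjoint ht.1.1] at this
      have := ht.2.2.2
      omega
    simp only [mem_compl, mem_union, not_or, mem_insert, mem_singleton] at hs hsxaa
    have hsY : s ∉ A ∧ s ≠ x ∧ s ≠ y ∧ s ≠ a ∧ s ≠ a' :=
      ⟨hs.1, hsxaa.1, fun e => hs.2 (e ▸ hyB), hsxaa.2⟩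
    obtain ⟨v, hv, hvy⟩ := exists_mem_ne (by omega : 1 < #B) y
    have hT1 : ∃ v ∈ B, v ≠ y ∧ v ∈ T := by
      by_contra! hno
      by_cases hbB : b ∈ B
      · exact hno b hbB hb.2.2.1 hbT
      · obtain ⟨d, hd, e⟩ := hD' b hbA hbB hb.2.1 v hv hvy (hno v hv hvy)
        rw [mem_filter] at hd
        exact hcut b hbT d (hmem d hd.1 hd.2.1) hd.2.2 e.symm
    have hT2 : ∃ v ∈ B, v ≠ y ∧ v ∉ T := by
      by_contra! hno
      by_cases hbB : b' ∈ B
      · exact hb'T (hno b' hbB hb'.2.2.1)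
      · obtain ⟨d, hd, e⟩ := hD b' hb'A hbB hb'.2.1 v hv hvy (hno v hv hvy)
        rw [mem_filter] at hd
        exact hcut d hd.2.2 b' hb' hb'T e
    by_cases hsT : s ∈ T
    · obtain ⟨v, hv, hvy, hvT⟩ := hT2
      obtain ⟨d, hd, e⟩ := hD' s hs.1 hs.2 hsxaa.1 v hv hvy hvT
      rw [mem_filter] at hd
      exact hcut s hsT d (hmem d hd.1 hd.2.1) hd.2.2 e.symm
    · obtain ⟨v, hv, hvy, hvT⟩ := hT1
      obtain ⟨d, hd, e⟩ := hD s hs.1 hs.2 hsxaa.1 v hv hvy hvT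
      rw [mem_filter] at hd
      exact hcut d hd.2.2 s hsY hsT e

lemma IsUnlinked.eq_singleton (h : IsUnlinked G x y a a' b b') (hc : Conn4 G) (ht : IsTight G A B)
    (hxA : x ∉ A) (hxB : x ∉ B) (hyB : y ∈ B) (hx : ∀ w ∈ B, G.Adj x w → w = y)
    (haA : a ∉ A) (haB : a ∉ B) (ha'B : a' ∉ B) : #(nb G y) = 4 ∧ G.Adj y a := by
  have hB : #B = 1 := by
    by_contra hB
    have := card_pos.2 ⟨y, hyB⟩
    exact h.not_linked (ht.linked hc hxA hxB hyB hx (by omega) haA haB ha'B h.toIsQuad)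
  obtain ⟨w, rfl⟩ := card_eq_one.1 hB
  obtain rfl := mem_singleton.1 hyB
  exact ⟨ht.symm.nb_of_singleton hc, (ht.symm.adj_of_singleton hc a).2 ⟨h.ay, haA⟩⟩

/-- The case that the fourth neighbour of `x` is off the quadruple: one of the two separations. -/
lemma IsUnlinked.adj_or (h : IsUnlinked G x y a a' b b') (hG : ContrZPlanar G)
    (hc : Conn4 G) (hn : 7 ≤ Fintype.card V)
    (hx : ∀ w, G.Adj x w ↔ w = y ∨ w = a ∨ w = a' ∨ w = c) (hcy : c ≠ y) (hca : c ≠ a)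
    (hca' : c ≠ a') (hcb : c ≠ b) (hcb' : c ≠ b') :
    G.Adj c a ∨ (#(nb G y) = 4 ∧ G.Adj y a) := by
  obtain ⟨A, B, ht, hxA, hxB, haA, haB, hyB⟩ : ∃ A B, IsTight G A B ∧ x ∉ A ∧ x ∉ B ∧
      a ∉ A ∧ a ∉ B ∧ y ∈ B := by
    obtain ⟨A, B, ht, h1, h2, h3, h4⟩ := _root_.not_contr (h.not_contr hG hc hn)
    by_cases hB : y ∈ B
    · exact ⟨A, B, ht, h1, h2, h3, h4, hB⟩
    · by_cases hA : y ∈ A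
      · exact ⟨B, A, ht.symm, h2, h1, h4, h3, hA⟩
      · exact (h.contr A B ht h1 h2 hA hB).elim
  have hyA : y ∉ A := ht.symm.notMem_of_mem_left hyB
  have hxc : G.Adj x c := (hx c).2 (by simp)
  have key : ∀ p q, (∀ w, G.Adj x w ↔ w = y ∨ w = a ∨ w = p ∨ w = q) → p ∈ A → q ∉ A →
      ¬ Contr G x p → p ≠ a → a' = p ∨ a' = q →
      G.Adj p a ∨ q ∉ B ∧ a' ∉ B := by
    intro p q hx hp hq hcon hpa ha'
    have hu : ∀ w ∈ A, G.Adj x w → w = p := by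
      intro w hw e
      rcases (hx w).1 e with rfl | rfl | rfl | rfl
      exacts [(hyA hw).elim, (haA hw).elim, rfl, (hq hw).elim]
    by_cases hA2 : 2 ≤ #A
    · obtain ⟨f, β, γ, hfA, hfB, hβ, hγ, hβb, hf⟩ := exists_apex hc ht hA2 hxA hxB hp hu hcon
      have hfx : G.Adj x f := ((hf x).2 (by simp)).symm
      have hfp : G.Adj f p := (hf p).2 (by simp)
      rcases (hx f).1 hfx with rfl | rfl | rfl | rfl
      · exact (hfB hyB).elim
      · exact .inl hfp.symm
      · exact (hfA hp).elim
      · refine .inr ⟨hfB, ?_⟩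
        rcases ha' with rfl | rfl
        exacts [ht.notMem_of_mem_left hp, hfB]
    · have : #A = 1 := by
        have := card_pos.2 ⟨_, hp⟩
        omega
      obtain ⟨w, rfl⟩ := card_eq_one.1 this
      obtain rfl := mem_singleton.1 hp
      exact .inl ((ht.adj_of_singleton hc a).2 ⟨hpa.symm, haB⟩)
  have fin : a' ∉ B → c ∉ B → #(nb G y) = 4 ∧ G.Adj y a := by
    intro h1 h2
    refine h.eq_singleton hc ht hxA hxB hyB ?_ haA haB h1
    intro w hw e
    rcases (hx w).1 e with rfl | rfl | rfl | rfl
    exacts [rfl, (haB hw).elim, (h1 hw).elim, (h2 hw).elim]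
  by_cases ha'A : a' ∈ A
  · by_cases hcA : c ∈ A
    · exact .inr (fin (ht.notMem_of_mem_left ha'A) (ht.notMem_of_mem_left hcA))
    · rcases key a' c hx ha'A hcA (h.swap_left.not_contr hG hc hn) h.aa'.symm (.inl rfl) with e | e
      · exact (h.not_adj e.symm).elim
      · exact .inr (fin e.2 e.1)
  · have hcA : c ∈ A := by
      obtain ⟨w, hw, e⟩ := ht.exists_adj_left hc hxA hxB
      rcases (hx w).1 e with rfl | rfl | rfl | rfl
      exacts [(hyA hw).elim, (haA hw).elim, (ha'A hw).elim, hw]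
    rcases key c a' (fun w => by rw [hx w]; tauto) hcA ha'A
      (h.not_contr_of_ne hG hc hn hxc hcy hca hca' hcb hcb') hca (.inr rfl) with e | e
    · exact .inl e
    · exact .inr (fin e.1 (ht.notMem_of_mem_left hcA))

/-- The fourth neighbour of `x` is adjacent to both `a` and `a'`. -/
lemma IsUnlinked.adj_fourth (h : IsUnlinked G x y a a' b b') (hG : ContrZPlanar G)
    (hc : Conn4 G) (hn : 7 ≤ Fintype.card V)
    (hx : ∀ w, G.Adj x w ↔ w = y ∨ w = a ∨ w = a' ∨ w = c) (hcy : c ≠ y) (hca : c ≠ a)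
    (hca' : c ≠ a') : G.Adj c a ∧ c ≠ b ∧ c ≠ b' := by
  have hcb : c ≠ b := by
    rintro rfl
    exact h.not_adj_iff hG hc hn hx
  have hcb' : c ≠ b' := by
    rintro rfl
    exact h.swap.swap_left.swap.not_adj_iff hG hc hn hx
  refine ⟨?_, hcb, hcb'⟩
  rcases h.adj_or hG hc hn hx hcy hca hca' hcb hcb' with e | ⟨hy, e⟩
  · exact e
  · refine (h.swap.not_adj_iff hG hc hn fun w => ?_).elim
    exact adj_iff_of_card_nb hy h.adj.symm h.yb h.yb' e h.bx.symm h.b'x.symm h.xa.ne h.bb'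
      h.ab.symm h.ab'.symm w

end Lifting

section Lifting

set_option linter.unusedSectionVars false

open Finset

variable {V : Type} [Fintype V] [DecidableEq V] {G : SimpleGraph V} {x y p q : V}

lemma exists_isUnlinked (hG : ContrZPlanar G) (hc : Conn4 G) (hn : 7 ≤ Fintype.card V)
    (hZ : ¬ ZPlanar G) (hxy : G.Adj x y) (hcon : Contr G x y) :
    ∃ δ : V → V → ZMod 2, (∀ a a' b b', IsQuad G x y a a' b b' →
        Linked G {v | v ≠ x ∧ v ≠ y} a a' b b' → δ a b + δ a b' + δ a' b + δ a' b' = 0) ∧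
      ∃ a a' b b', IsUnlinked G x y a a' b b' ∧ δ a b + δ a b' + δ a' b + δ a' b' ≠ 0 := by
  have hI := isContr_contractEdge hxy
  have hP : ∀ x y u v, ∃ a, (G.Adj x a ∧ a ≠ y) ∧ a ≠ u ∧ a ≠ v := by
    intro x y u v
    obtain ⟨a, e, h1, h2, h3⟩ := hc.exists_adj_ne x y u v
    exact ⟨a, ⟨e, h1⟩, h2, h3⟩
  have hPQ : ∀ u v w, ∃ a, ((G.Adj x a ∧ a ≠ y) ∨ (G.Adj y a ∧ a ≠ x)) ∧
      a ≠ u ∧ a ≠ v ∧ a ≠ w := by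
    intro u v w
    by_contra! hno
    have hu := hc.card_nbrs (A := {x, y}) (N := {u, v, w}) (by simp) ?_ card_le_three
    · have := congrArg card hu
      have h1 := card_union_le ({x, y} : Finset V) {u, v, w}
      have h2 : #({x, y} : Finset V) ≤ 2 := card_le_two
      have h3 : #({u, v, w} : Finset V) ≤ 3 := card_le_three
      rw [card_univ] at this
      omega
    · intro a ha t e
      have := hno t
      simp only [mem_union, mem_insert, mem_singleton] at ha ⊢
      rcases ha with rfl | rfl <;> grind
  obtain ⟨δ, h0, a, a', b, b', hq, h1⟩ :=
    hI.exists_odd (hG _ _ hxy hcon) hZ (hP x y) (hP y x) hPQ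
  exact ⟨δ, h0, a, a', b, b', ⟨hq, hxy, hcon, fun hl => h1 (h0 _ _ _ _ hq hl)⟩, h1⟩

lemma ContrZPlanar.exists_card_nb_eq_four (hG : ContrZPlanar G) (hc : Conn4 G)
    (hn : 7 ≤ Fintype.card V) (hZ : ¬ ZPlanar G) (hpq : G.Adj p q) (hcon : Contr G p q) :
    ∃ u, #(nb G u) = 4 := by
  by_contra! h4
  obtain ⟨-, -, a, a', b, b', hu, -⟩ := exists_isUnlinked hG hc hn hZ hpq hcon
  obtain ⟨A, B, ht, ⟨x, x', exx', hxA, hxB, -, -⟩, hmin, hle⟩ :=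
    exists_atom hu.xa (hu.not_contr hG hc hn)
  have hA2 : 2 ≤ #A := by
    by_contra hlt
    have : #A = 1 := by
      have := card_pos.2 ht.2.1
      omega
    obtain ⟨w, rfl⟩ := card_eq_one.1 this
    exact h4 w (ht.nb_of_singleton hc)
  have hAS : ∀ u ∈ A, ∀ v ∉ A, G.Adj u v → Contr G u v := by
    intro u hu v hv e
    by_contra hn
    have := (atom_bound hc ht hmin hle e hu hn).2 hv
    omega
  have hAS' : ∀ u ∈ A, ∀ v ∈ A, G.Adj u v → ¬ Contr G u v → #A ≤ 2 := fun u hu v hv e hn =>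
    (atom_bound hc ht hmin hle e hu hn).1
  obtain ⟨y, hyA, exy⟩ := ht.exists_adj_left hc hxA hxB
  have hyB : y ∉ B := ht.notMem_of_mem_left hyA
  obtain ⟨s, hs, hsy, t, htA, htx, est⟩ : ∃ s ∈ A, s ≠ y ∧ ∃ t, t ∉ A ∧ t ≠ x ∧ G.Adj s t := by
    by_contra! hno
    obtain ⟨v, hv, hvy⟩ := exists_mem_ne (by omega : 1 < #A) y
    have hu := hc.card_nbrs (A := A.erase y) (N := {y, x}) ⟨v, by simp [*]⟩ ?_
      (card_le_two.trans (by norm_num))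
    · obtain ⟨b, hb⟩ := ht.2.2.1
      have : b ∈ A.erase y ∪ {y, x} := hu ▸ mem_univ b
      have hbA := ht.symm.notMem_of_mem_left hb
      simp only [mem_union, mem_erase, hbA, and_false, mem_insert, mem_singleton, false_or] at this
      rcases this with rfl | rfl
      exacts [hbA hyA, hxB hb]
    · intro a ha w e
      have h1 := hno a (mem_of_mem_erase ha) (ne_of_mem_erase ha) w
      simp only [mem_union, mem_erase, mem_insert, mem_singleton]
      by_cases hwA : w ∈ A
      · tauto
      · exact .inr (.inr (by_contra fun hwx => h1 hwA hwx e))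
  have hyx : y ≠ x := fun e => hxA (e ▸ hyA)
  have hcxy := (hAS y hyA x hxA exy.symm).symm
  obtain ⟨-, -, a, a', b, b', hu, -⟩ := exists_isUnlinked hG hc hn hZ exy hcxy
  have hmem : ∀ t, t ∉ A → t ≠ x → G.Adj s t →
      (s = a ∨ s = a' ∨ s = b ∨ s = b') ∧ (t = a ∨ t = a' ∨ t = b ∨ t = b') :=
    fun t htA htx est => hu.mem_of_contr hG hc hn est (hAS s hs t htA est)
      (fun e => hxA (e ▸ hs)) hsy htx fun e => htA (e ▸ hyA)
  have hsa : s ≠ a := by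
    rintro rfl
    exact hu.not_contr hG hc hn (hAS s hs x hxA hu.xa.symm).symm
  have hsa' : s ≠ a' := by
    rintro rfl
    exact hu.swap_left.not_contr hG hc hn (hAS s hs x hxA hu.xa'.symm).symm
  have hsb : s = b ∨ s = b' := by
    rcases (hmem t htA htx est).1 with h | h | h | h
    exacts [(hsa h).elim, (hsa' h).elim, .inl h, .inr h]
  have hA : #A ≤ 2 := by
    rcases hsb with rfl | rfl
    · exact hAS' y hyA s hs hu.yb (hu.swap.not_contr hG hc hn)
    · exact hAS' y hyA s hs hu.yb' (hu.swap.swap_left.not_contr hG hc hn)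
  have hAe : A = {y, s} := by
    symm
    refine eq_of_subset_of_card_le (insert_subset hyA (singleton_subset_iff.2 hs)) ?_
    rw [card_pair hsy.symm]
    exact hA
  have hS : #((A ∪ B)ᶜ) = 4 := by
    rw [card_compl, card_union_of_disjoint ht.1.1]
    have := ht.2.2.2
    omega
  have hnb : nb G s = insert y (A ∪ B)ᶜ := by
    refine eq_of_subset_of_card_le (fun w hw => ?_) ?_
    · rw [mem_nb] at hw
      have hwB := ht.notMem_of_adj hs hw
      by_cases hwA : w ∈ A
      · have : w = y := by
          rw [hAe] at hwA
          simp only [mem_insert, mem_singleton] at hwA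
          exact hwA.resolve_right hw.ne'
        simp [this]
      · simp [hwA, hwB]
    · have h1 := card_insert_le y (A ∪ B)ᶜ
      have h2 := hc.four_le_nb s
      have h3 := h4 s
      omega
  have hsub : (A ∪ B)ᶜ.erase x ⊆ {a, a'} := by
    intro t ht'
    simp only [mem_erase, mem_compl, mem_union, not_or] at ht'
    have est : G.Adj s t := mem_nb.1 (hnb ▸ by simp [ht'])
    have h1 := hmem t ht'.2.1 ht'.1 est
    have h2 : t ≠ b := by
      rintro rfl
      rcases hsb with rfl | rfl
      exacts [est.ne rfl, hu.swap.not_adj est.symm]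
    have h3 : t ≠ b' := by
      rintro rfl
      rcases hsb with rfl | rfl
      exacts [hu.swap.not_adj est, est.ne rfl]
    simp only [mem_insert, mem_singleton]
    tauto
  have := (card_le_card hsub).trans card_le_two
  rw [card_erase_of_mem (by simp [hxA, hxB]), hS] at this
  omega

/-- If all contractions of contractible edges are drawable, then so is the graph. -/
theorem ContrZPlanar.zPlanar (hG : ContrZPlanar G) (hc : Conn4 G) (hn : 7 ≤ Fintype.card V)
    (hpq : G.Adj p q) (hcon : Contr G p q) : ZPlanar G := by
  by_contra hZ
  obtain ⟨x, y, hxy, hx4, hcxy⟩ : ∃ x y, G.Adj x y ∧ #(nb G x) = 4 ∧ Contr G x y := by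
    by_contra! hno
    exact hno p q hpq (regular_of_not_contr hc (by omega) hno
      (hG.exists_card_nb_eq_four hc hn hZ hpq hcon) p) hcon
  obtain ⟨δ, h0, a, a', b, b', hu, h1⟩ := exists_isUnlinked hG hc hn hZ hxy hcxy
  obtain ⟨c, hyc, hac, ha'c, hx⟩ :=
    exists_adj_iff_three hx4 hxy hu.xa hu.xa' hu.ay.symm hu.a'y.symm hu.aa'
  obtain ⟨e, hcb, hcb'⟩ := hu.adj_fourth hG hc hn hx hyc.symm hac.symm ha'c.symm
  obtain ⟨e', -, -⟩ := hu.swap_left.adj_fourth hG hc hn (fun w => by rw [hx w]; tauto) hyc.symm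
    ha'c.symm hac.symm
  have hxc : G.Adj x c := (hx c).2 (by simp)
  have hq : IsQuad G x y a c b b' := { hu.toIsQuad with
    xa' := hxc, aa' := hac, a'b := hcb, a'b' := hcb', a'y := hyc.symm }
  have hq' : IsQuad G x y a' c b b' := { hu.toIsQuad.swap_left with
    xa' := hxc, aa' := ha'c, a'b := hcb, a'b' := hcb', a'y := hyc.symm }
  have h2 := h0 _ _ _ _ hq (hq.linked_of_adj hcxy hxy.ne e.symm)
  have h3 := h0 _ _ _ _ hq' (hq'.linked_of_adj hcxy hxy.ne e'.symm)
  grind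

end Lifting

section Rotation

set_option linter.unusedSectionVars false

open Finset

variable {V W W' : Type*} {G : SimpleGraph V} {F : SimpleGraph W} {F' : SimpleGraph W'} {x y q : V}
  {π : V → W} {π' : V → W'}

/-- Contracting `qx` rather than `xy` gives a larger graph if all neighbours of `x` except `q` are
neighbours of `y`. -/
lemma IsContr.exists_bijective (h : IsContr G F x y π) (h' : IsContr G F' q x π') (hqy : q ≠ y)
    (hq : ∀ w, G.Adj x w → w ≠ y → w ≠ q → G.Adj y w) :
    ∃ f : W → W', Function.Bijective f ∧ (∀ u v, F.Adj u v → F'.Adj (f u) (f v)) ∧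
      ∀ v, v ≠ x → f (π v) = π' v := by
  have hex : ∀ w, ∃ v, π v = w ∧ v ≠ x := by
    intro w
    obtain ⟨v, rfl⟩ := h.surj w
    by_cases hv : v = x
    · exact ⟨y, by rw [hv, h.map_eq], h.adj.ne'⟩
    · exact ⟨v, rfl, hv⟩
  choose σ hσ hσx using hex
  have hσπ : ∀ v, v ≠ x → σ (π v) = v := by
    intro v hv
    have := (h.eq_iff _ _).1 (hσ (π v))
    have := hσx (π v)
    tauto
  have hinj : ∀ u v, u ≠ x → v ≠ x → π' u = π' v → u = v := by
    intro u v hu hv e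
    have := (h'.eq_iff _ _).1 e
    tauto
  refine ⟨fun w => π' (σ w), ⟨fun u v e => ?_, fun w => ?_⟩, fun u v e => ?_, fun v hv => ?_⟩
  · rw [← hσ u, ← hσ v, hinj _ _ (hσx u) (hσx v) e]
  · obtain ⟨v, rfl⟩ := h'.surj w
    by_cases hv : v = x
    · exact ⟨π q, by rw [hv, ← h'.map_eq]; exact congrArg π' (hσπ q h'.adj.ne)⟩
    · exact ⟨π v, congrArg π' (hσπ v hv)⟩
  · change F'.Adj (π' (σ u)) (π' (σ v))
    have key : ∀ w, G.Adj x w → w ≠ y → F'.Adj (π' y) (π' w) := by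
      intro w hw hwy
      have hne : π' y ≠ π' w := fun e => hwy (hinj _ _ h.adj.ne' hw.ne' e).symm
      by_cases hwq : w = q
      · subst hwq
        rw [h'.map_eq] at hne ⊢
        exact h'.adj_of_adj h.adj.symm hne
      · exact h'.adj_of_adj (hq w hw hwy hwq) hne
    have hne : σ u ≠ σ v := fun e' => e.ne (by rw [← hσ u, ← hσ v, e'])
    rw [← hσ u, ← hσ v] at e
    obtain ⟨-, a, b, ha, hb, e⟩ := (h.adj_iff _ _).1 e
    have h1 := (h.eq_iff _ _).1 ha
    have h2 := (h.eq_iff _ _).1 hb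
    have h3 := hσx u
    have h4 := hσx v
    rcases h1 with rfl | ⟨rfl, h1⟩ | ⟨-, h1⟩
    · rcases h2 with rfl | ⟨rfl, h2⟩ | ⟨-, h2⟩
      · exact h'.adj_of_adj e fun e' => hne (hinj _ _ h3 h4 e')
      · rw [h2] at hne ⊢
        exact (key _ e.symm hne).symm
      · exact (h4 h2).elim
    · rcases h2 with rfl | ⟨rfl, h2⟩ | ⟨-, h2⟩
      · rw [h1] at hne ⊢
        exact key _ e hne.symm
      · exact (e.ne rfl).elim
      · exact (h4 h2).elim
    · exact (h3 h1).elim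
  · exact congrArg π' (hσπ v hv)

variable [Fintype V] [Fintype W] [Fintype W'] [DecidableEq V] [DecidableEq W] [DecidableEq W']

lemma Conn4.of_bijective (hc : Conn4 F) {f : W → W'} (hf : Function.Bijective f)
    (hadj : ∀ u v, F.Adj u v → F'.Adj (f u) (f v)) : Conn4 F' := by
  have hcard := Fintype.card_of_bijective hf
  refine ⟨hcard ▸ hc.1, fun A B hs hA hB => ?_⟩
  have hpre : ∀ A : Finset W', #(A.preimage f hf.1.injOn) = #A := by
    intro A
    rw [← card_image_of_injective _ hf.1, image_preimage]
    congr 1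
    exact filter_true_of_mem fun w _ => hf.2 w
  have hne : ∀ A : Finset W', A.Nonempty → (A.preimage f hf.1.injOn).Nonempty := fun A hA =>
    card_pos.1 (by rw [hpre]; exact card_pos.2 hA)
  have := hc.2 (A.preimage f hf.1.injOn) (B.preimage f hf.1.injOn)
    ⟨disjoint_left.2 fun w h1 h2 => disjoint_left.1 hs.1 (mem_preimage.1 h1) (mem_preimage.1 h2),
      fun a ha b hb e => hs.2 _ (mem_preimage.1 ha) _ (mem_preimage.1 hb) (hadj _ _ e)⟩
    (hne A hA) (hne B hB)
  rw [hpre, hpre] at this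
  omega

lemma Good.not_good_of_bijective (hg : Good F) {f : W → W'} (hf : Function.Bijective f)
    (hadj : ∀ u v, F.Adj u v → F'.Adj (f u) (f v)) {u v : W} (huv : ¬ F.Adj u v)
    (e : F'.Adj (f u) (f v)) : ¬ Good F' := by
  intro hg'
  have hsub : insert (f v) ((nb F u).image f) ⊆ nb F' (f u) := by
    intro w hw
    simp only [mem_insert, mem_image, mem_nb] at hw ⊢
    rcases hw with rfl | ⟨w, hw, rfl⟩
    exacts [e, hadj _ _ hw]
  have := card_le_card hsub
  rw [card_insert_of_notMem, card_image_of_injective _ hf.1, hg.1 u, hg'.1] at this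
  · omega
  · simp only [mem_image, mem_nb, not_exists, not_and]
    exact fun w hw h => huv (hf.1 h ▸ hw)

/-- An end `x` of `xy` that can be contracted into another neighbour, gaining an edge. -/
def Rotates {V : Type*} (G : SimpleGraph V) (x y : V) : Prop :=
  ∃ q r, G.Adj x q ∧ q ≠ y ∧ (∀ w, G.Adj x w → w ≠ y → w ≠ q → G.Adj y w) ∧
    G.Adj x r ∧ r ≠ y ∧ r ≠ q ∧ ¬ G.Adj r q

lemma exists_forall_mem_of_card_sdiff_le_one {A B : Finset V} (hA : A.Nonempty)
    (h : #(A \ B) ≤ 1) : ∃ q ∈ A, ∀ w ∈ A, w ≠ q → w ∈ B := by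
  by_cases hne : (A \ B).Nonempty
  · obtain ⟨q, hq⟩ := hne
    refine ⟨q, (mem_sdiff.1 hq).1, fun w hw hwq => ?_⟩
    by_contra hwB
    exact hwq (card_le_one.1 h _ (mem_sdiff.2 ⟨hw, hwB⟩) _ hq)
  · obtain ⟨q, hq⟩ := hA
    refine ⟨q, hq, fun w hw _ => ?_⟩
    by_contra hwB
    exact hne ⟨w, mem_sdiff.2 ⟨hw, hwB⟩⟩

theorem IsContr.rotates_or (h : IsContr G F x y π) (hc : Conn4 G) (hcF : Conn4 F)
    (hn : 7 ≤ Fintype.card W) (hg : Good F) : Rotates G x y ∨ Rotates G y x := by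
  by_contra hno
  rw [not_or] at hno
  let A := (nb G x).erase y
  let B := (nb G y).erase x
  have mA : ∀ w, w ∈ A ↔ G.Adj x w ∧ w ≠ y := fun w => by simp [A, and_comm]
  have mB : ∀ w, w ∈ B ↔ G.Adj y w ∧ w ≠ x := fun w => by simp [B, and_comm]
  have hA3 : 3 ≤ #A := by
    have : #(nb G x) - 1 ≤ #A := pred_card_le_card_erase
    have := hc.four_le_nb x
    omega
  have hB3 : 3 ≤ #B := by
    have : #(nb G y) - 1 ≤ #B := pred_card_le_card_erase
    have := hc.four_le_nb y
    omega
  have hx : ∀ q ∈ A, (∀ w ∈ A, w ≠ q → w ∈ B) → ∀ r ∈ A, r ≠ q → G.Adj r q := by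
    intro q hq h1 r hr hrq
    by_contra e
    exact hno.1 ⟨q, r, ((mA q).1 hq).1, ((mA q).1 hq).2, fun w hw hwy hwq =>
      ((mB w).1 (h1 w ((mA w).2 ⟨hw, hwy⟩) hwq)).1, ((mA r).1 hr).1, ((mA r).1 hr).2, hrq, e⟩
  have hy : ∀ q ∈ B, (∀ w ∈ B, w ≠ q → w ∈ A) → ∀ r ∈ B, r ≠ q → G.Adj r q := by
    intro q hq h1 r hr hrq
    by_contra e
    exact hno.2 ⟨q, r, ((mB q).1 hq).1, ((mB q).1 hq).2, fun w hw hwy hwq =>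
      ((mA w).1 (h1 w ((mB w).2 ⟨hw, hwy⟩) hwq)).1, ((mB r).1 hr).1, ((mB r).1 hr).2, hrq, e⟩
  have hxy : ∀ w ∈ A ∪ B, w ≠ x ∧ w ≠ y := by
    intro w hw
    rw [mem_union, mA, mB] at hw
    rcases hw with hw | hw
    exacts [⟨hw.1.ne', hw.2⟩, ⟨hw.2, hw.1.ne'⟩]
  have hπ : ∀ u ∈ A ∪ B, ∀ v, π u = π v → u = v := by
    intro u hu v e
    have := hxy u hu
    have := (h.eq_iff u v).1 e
    tauto
  have hadj : ∀ u ∈ A ∪ B, ∀ v, G.Adj u v → F.Adj (π u) (π v) := fun u hu v e =>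
    h.adj_of_adj e fun e' => e.ne (hπ u hu v e')
  have hz : ∀ u ∈ A ∪ B, F.Adj (π x) (π u) := by
    intro u hu
    have h1 := hu
    rw [mem_union, mA, mB] at h1
    rcases h1 with h1 | h1
    · exact (hadj u hu x h1.1.symm).symm
    · exact h.map_eq ▸ (hadj u hu y h1.1.symm).symm
  have hcard : #(A ∪ B) = 4 := by
    rw [← hg.1 (π x), ← card_image_of_injOn (f := π) fun u hu v _ e => hπ u hu v e]
    congr 1
    ext w
    simp only [mem_image, mem_nb]
    constructor
    · rintro ⟨u, hu, rfl⟩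
      exact hz u hu
    · intro e
      obtain ⟨v, rfl⟩ := h.surj w
      obtain ⟨hne, a, b, ha, hb, hab⟩ := (h.adj_iff _ _).1 e
      refine ⟨b, ?_, hb⟩
      have hbx : b ≠ x := fun e => hne (by rw [← hb, e])
      have hby : b ≠ y := fun e => hne (by rw [← hb, e, h.map_eq])
      rw [mem_union, mA, mB]
      rcases (h.eq_iff _ _).1 ha with rfl | ⟨rfl, -⟩ | ⟨rfl, -⟩
      exacts [.inl ⟨hab, hby⟩, .inl ⟨hab, hby⟩, .inr ⟨hab, hbx⟩]
  have claw : ∀ D : Finset V, D ⊆ A ∪ B → #D = 4 → ∀ q ∈ D, (∀ r ∈ D, r ≠ q → G.Adj r q) →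
      False := by
    intro D hD h4 q hq hr
    have h3 : #(D.erase q) = 3 := by rw [card_erase_of_mem hq, h4]
    obtain ⟨a, b, c, hab, hac, hbc, he⟩ := card_eq_three.1 h3
    have ha : a ∈ D.erase q := by simp [he]
    have hb : b ∈ D.erase q := by simp [he]
    have hc : c ∈ D.erase q := by simp [he]
    rw [mem_erase] at ha hb hc
    exact hg.no_claw hcF hn (hz q (hD hq)) (hz a (hD ha.2)) (hz b (hD hb.2)) (hz c (hD hc.2))
      (hadj q (hD hq) a (hr a ha.2 ha.1).symm) (hadj q (hD hq) b (hr b hb.2 hb.1).symm)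
      (hadj q (hD hq) c (hr c hc.2 hc.1).symm) (fun e => hab (hπ a (hD ha.2) b e))
      (fun e => hac (hπ a (hD ha.2) c e)) fun e => hbc (hπ b (hD hb.2) c e)
  have hA4 := card_le_card (subset_union_left : A ⊆ A ∪ B)
  have hB4 := card_le_card (subset_union_right : B ⊆ A ∪ B)
  have cA : #(A \ B) + #B = 4 := by rw [card_sdiff_add_card, hcard]
  have cB : #(B \ A) + #A = 4 := by rw [card_sdiff_add_card, union_comm, hcard]
  obtain ⟨q, hq, hqB⟩ := exists_forall_mem_of_card_sdiff_le_one
    (card_pos.1 (by omega : 0 < #A)) (by omega : #(A \ B) ≤ 1)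
  obtain ⟨p, hp, hpA⟩ := exists_forall_mem_of_card_sdiff_le_one
    (card_pos.1 (by omega : 0 < #B)) (by omega : #(B \ A) ≤ 1)
  have hqr := hx q hq hqB
  have hpr := hy p hp hpA
  by_cases h1 : #A = 4
  · exact claw A subset_union_left h1 q hq hqr
  by_cases h2 : #B = 4
  · exact claw B subset_union_right h2 p hp hpr
  have hqB' : q ∉ B := by
    intro hqB'
    have : A \ B = ∅ := by
      refine sdiff_eq_empty_iff_subset.2 fun w hw => ?_
      by_cases e : w = q
      exacts [e ▸ hqB', hqB w hw e]
    rw [this, card_empty] at cA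
    omega
  have hpA' : p ∉ A := by
    intro hpA'
    have : B \ A = ∅ := by
      refine sdiff_eq_empty_iff_subset.2 fun w hw => ?_
      by_cases e : w = p
      exacts [e ▸ hpA', hpA w hw e]
    rw [this, card_empty] at cB
    omega
  have h3 : #(A.erase q) = 2 := by
    rw [card_erase_of_mem hq]
    omega
  obtain ⟨s, t, hst, he⟩ := card_eq_two.1 h3
  have hs : s ∈ A.erase q := by simp [he]
  have ht : t ∈ A.erase q := by simp [he]
  rw [mem_erase] at hs ht
  have hps : s ≠ p := fun e => hpA' (e ▸ hs.2)
  have hpt : t ≠ p := fun e => hpA' (e ▸ ht.2)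
  have eA : ∀ {w}, w ∈ A → w ∈ A ∪ B := fun h => mem_union_left _ h
  have eB : ∀ {w}, w ∈ B → w ∈ A ∪ B := fun h => mem_union_right _ h
  exact hg.no_wheel hcF hn (hz q (eA hq)) (hz s (eA hs.2)) (hz p (eB hp)) (hz t (eA ht.2))
    (hadj q (eA hq) s (hqr s hs.2 hs.1).symm) (hadj s (eA hs.2) p (hpr s (hqB s hs.2 hs.1) hps))
    (hadj p (eB hp) t (hpr t (hqB t ht.2 ht.1) hpt).symm) (hadj t (eA ht.2) q (hqr t ht.2 ht.1))
    (fun e => hpA' (hπ q (eA hq) p e ▸ hq)) fun e => hst (hπ s (eA hs.2) t e)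

end Rotation

section SmallGraphs

open Finset

variable {V : Type*} [Fintype V] {G : SimpleGraph V}

/-- If the contraction of `xy` is good, rotating `xy` gives an edge whose contraction is not. -/
lemma Conn4.exists_not_good {V : Type} [Fintype V] [DecidableEq V] {G : SimpleGraph V} {x y : V}
    (hc : Conn4 G) (hxy : G.Adj x y) (hn : 8 ≤ Fintype.card V) (hcF : Conn4 (contractEdge G x y))
    (hg : Good (contractEdge G x y)) :
    ∃ u v, G.Adj u v ∧ Conn4 (contractEdge G u v) ∧ ¬ Good (contractEdge G u v) ∧
      (¬ ZPlanar (contractEdge G x y) → ¬ ZPlanar (contractEdge G u v)) := by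
  have key : ∀ a b π, IsContr G (contractEdge G x y) a b π → Rotates G a b →
      ∃ u v, G.Adj u v ∧ Conn4 (contractEdge G u v) ∧ ¬ Good (contractEdge G u v) ∧
      (¬ ZPlanar (contractEdge G x y) → ¬ ZPlanar (contractEdge G u v)) := by
    rintro a b π h ⟨q, r, haq, hqb, hN, har, hrb, hrq, hqr⟩
    have h' := isContr_contractEdge haq.symm
    obtain ⟨f, hf, hadj, hfπ⟩ := h.exists_bijective h' hqb hN
    refine ⟨q, a, haq.symm, hcF.of_bijective hf hadj,
      hg.not_good_of_bijective hf hadj (u := π q) (v := π r) ?_ ?_, fun hZ hZ' =>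
        hZ (hZ'.of_injective f hf.1 hadj)⟩
    · intro e
      obtain ⟨-, q', r', hq', hr', e⟩ := (h.adj_iff q r).1 e
      have e1 := (h.eq_iff q' q).1 hq'
      have e2 := (h.eq_iff r' r).1 hr'
      have e3 : q' = q := by
        rcases e1 with e1 | e1 | e1
        exacts [e1, (hqb e1.2).elim, (haq.ne' e1.2).elim]
      have e4 : r' = r := by
        rcases e2 with e2 | e2 | e2
        exacts [e2, (hrb e2.2).elim, (har.ne' e2.2).elim]
      exact hqr (e3 ▸ e4 ▸ e.symm)
    · rw [hfπ q haq.ne', hfπ r har.ne', h'.map_eq]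
      refine h'.adj_of_adj har fun e => ?_
      rcases (h'.eq_iff a r).1 e with e | e | e
      exacts [har.ne e, har.ne' e.2, hrq e.2]
  have h := isContr_contractEdge hxy
  have hW := h.card
  rcases h.rotates_or hc hcF (by omega) hg with h1 | h1
  exacts [key _ _ _ h h1, key _ _ _ h.symm h1]

lemma Conn4.nonempty_iso_cycleSq_five (hc : Conn4 G) (hn : Fintype.card V = 5) :
    Nonempty (G ≃g cycleSq 5) := by
  have e : Fintype.card V = Fintype.card (ZMod 5) := by rw [hn, ZMod.card]
  refine ⟨⟨Fintype.equivOfCardEq e, fun {a b} => ?_⟩⟩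
  have h5 : ∀ i j : ZMod 5, (cycleSq 5).Adj i j ↔ i ≠ j := by
    simp only [cycleSq, fromRel_adj]
    decide
  rw [h5, (Fintype.equivOfCardEq e).injective.ne_iff]
  refine ⟨fun hab => ?_, fun h => h.ne⟩
  by_contra hadj
  have := hc.2 {a} {b} ⟨by simpa, by simpa⟩ (by simp) (by simp)
  simp only [card_singleton] at this
  omega

lemma nonempty_iso_cycleSq_six (hn : Fintype.card V = 6) (h4 : ∀ v, #(nb G v) = 4) :
    Nonempty (G ≃g cycleSq 6) := by
  classical
  have hex : ∀ v, ∃ w, ∀ u, (u ≠ v ∧ ¬ G.Adj v u) ↔ u = w := by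
    intro v
    have : #(insert v (nb G v))ᶜ = 1 := by
      rw [card_compl, card_insert_of_notMem (by simp), h4, hn]
    obtain ⟨w, hw⟩ := card_eq_one.1 this
    refine ⟨w, fun u => ?_⟩
    rw [← mem_singleton, ← hw]
    simp
  choose f hf using hex
  have hfv : ∀ v, f v ≠ v ∧ ¬ G.Adj v (f v) := fun v => (hf v _).2 rfl
  have hff : ∀ v, f (f v) = v := fun v =>
    ((hf (f v) v).1 ⟨(hfv v).1.symm, fun e => (hfv v).2 e.symm⟩).symm
  have hout : ∀ T : Finset V, #T ≤ 5 → ∃ v, v ∉ T := by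
    intro T hT
    by_contra! hall
    rw [eq_univ_iff_forall.2 hall, card_univ] at hT
    omega
  obtain ⟨a, -⟩ := hout ∅ (by simp)
  obtain ⟨b, hb⟩ := hout {a, f a} (card_le_two.trans (by omega))
  obtain ⟨c, hc⟩ := hout {a, f a, b, f b} (card_le_four.trans (by omega))
  simp only [mem_insert, mem_singleton, not_or] at hb hc
  have ha' := hfv a
  have hb' := hfv b
  have hc' := hfv c
  have ia := hff a
  have ib := hff b
  have ic := hff c
  let g : ZMod 6 → V := (![a, b, c, f a, f b, f c] : Fin 6 → V)
  have hg3 : ∀ i, f (g i) = g (i + 3) := by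
    intro i
    fin_cases i
    exacts [rfl, rfl, rfl, ia, ib, ic]
  have hne : ∀ u v, u ≠ v → f u ≠ f v := fun u v h e => h (by rw [← hff u, e, hff])
  have hinj : Function.Injective g := by
    intro i j hij
    have h1 := hne b a hb.1
    have h2 := hne c a hc.1
    have h3 := hne c b hc.2.2.1
    have h4 : f b ≠ a := fun e => hb.2 (by rw [← e, hff])
    have h5 : f c ≠ a := fun e => hc.2.1 (by rw [← e, hff])
    have h6 : f c ≠ b := fun e => hc.2.2.2 (by rw [← e, hff])
    fin_cases i <;> fin_cases j <;> first | rfl | (exfalso; simp [g] at hij; grind)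
  have hbij : Function.Bijective g :=
    (Fintype.bijective_iff_injective_and_card g).2 ⟨hinj, by rw [hn, ZMod.card]⟩
  refine ⟨(⟨Equiv.ofBijective g hbij, fun {i j} => ?_⟩ : cycleSq 6 ≃g G).symm⟩
  rw [cycleSq_six_adj, Equiv.ofBijective_apply, Equiv.ofBijective_apply, ← hinj.ne_iff,
    ← hinj.ne_iff (y := j + 3), ← hg3, Ne, Ne, ← hf, adj_comm]
  constructor
  · exact fun e => ⟨e.ne', fun h => h.2 e⟩
  · intro h
    by_contra e
    exact h.2 ⟨h.1, e⟩

lemma Conn4.fourConnected (hc : Conn4 G) : FourConnected G := by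
  classical
  refine ⟨Nat.card_eq_fintype_card (α := V) ▸ hc.1, fun S hS => induce_connected_iff.2 ⟨?_, ?_⟩⟩
  · rw [Set.nonempty_compl]
    rintro rfl
    rw [Set.ncard_univ, Nat.card_eq_fintype_card] at hS
    have := hc.1
    omega
  · intro a ha b hb
    by_contra hcon
    obtain ⟨T, hT, haT, hbT, hcut⟩ := exists_cut_of_not_joinIn ha hcon
    have h := hc.2 T.toFinset (Sᶜ \ T).toFinset
      ⟨by rw [Set.disjoint_toFinset]; exact Set.disjoint_sdiff_right,
        fun u hu v hv => by
          rw [Set.mem_toFinset] at hu hv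
          exact hcut u hu v hv.1 hv.2⟩ ⟨a, by simpa⟩
      ⟨b, by rw [Set.mem_toFinset]; exact ⟨hb, hbT⟩⟩
    rw [← Set.ncard_eq_toFinset_card', ← Set.ncard_eq_toFinset_card'] at h
    have h1 := Set.ncard_sdiff_add_ncard_of_subset hT
    have h2 := Set.ncard_add_ncard_compl S
    rw [Nat.card_eq_fintype_card] at h2
    omega

lemma FourConnected.conn4 (h : FourConnected G) : Conn4 G := by
  classical
  refine ⟨Nat.card_eq_fintype_card (α := V) ▸ h.1, fun A B hs ⟨a, ha⟩ ⟨b, hb⟩ => ?_⟩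
  by_contra hlt
  have h1 : #(A ∪ B)ᶜ ≤ 3 := by
    rw [card_compl, card_union_of_disjoint hs.1]
    omega
  obtain ⟨P, hP⟩ := (induce_connected_iff.1 (h.2 ((A ∪ B)ᶜ : Finset V)
    (by rwa [Set.ncard_coe_finset]))).2 a (by simp [ha]) b (by simp [hb])
  obtain ⟨d, hd, h2, h3⟩ := P.exists_boundary_dart A (by simpa)
    (fun e => disjoint_left.1 hs.1 (by simpa using e) hb)
  have := hP _ (P.dart_snd_mem_support_of_mem_darts hd)
  simp only [coe_compl, compl_compl, coe_union, Set.mem_union, mem_coe] at this h2 h3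
  exact hs.2 _ h2 _ (this.resolve_left h3) d.adj

end SmallGraphs

section Chains

variable {V W X : Type*} {G : SimpleGraph V} {F : SimpleGraph W} {H : SimpleGraph X}

/-- There is a `(G, H)`-chain. -/
def HasChain (G : SimpleGraph V) (H : SimpleGraph X) : Prop :=
  ∃ (n : ℕ) (seq : Fin (n + 1) → PGraph), IsContractionChain G H n seq

lemma HasChain.of_iso {V : Type} {G : SimpleGraph V} (e : G ≃g H) (h : FourConnected G) :
    HasChain G H :=
  ⟨0, fun _ => ⟨V, G⟩, ⟨.refl⟩, ⟨e⟩, fun _ => h, fun i => i.elim0⟩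

lemma HasChain.cons {V : Type} {G : SimpleGraph V} {u v : V} (h : FourConnected G)
    (huv : G.Adj u v) (hch : HasChain (contractEdge G u v) H) : HasChain G H := by
  obtain ⟨n, seq, ⟨e⟩, hlast, h4, hstep⟩ := hch
  refine ⟨n + 1, Fin.cons ⟨V, G⟩ seq, ⟨.refl⟩, hlast, ?_, ?_⟩
  · intro i
    cases i using Fin.cases with
    | zero => exact h
    | succ i => exact h4 i
  · intro i
    cases i using Fin.cases with
    | zero => exact ⟨u, v, huv, ⟨e⟩⟩
    | succ i => exact hstep i

lemma HasChain.congr_left (h : HasChain F H) (e : F ≃g G) : HasChain G H := by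
  obtain ⟨n, seq, ⟨e'⟩, h⟩ := h
  exact ⟨n, seq, ⟨e'.trans e⟩, h⟩

lemma FourConnected.congr (h : FourConnected F) (e : F ≃g G) : FourConnected G := by
  refine ⟨Nat.card_congr e.toEquiv ▸ h.1, fun S hS => ?_⟩
  have := h.2 (e ⁻¹' S) (by
    rwa [← Set.ncard_image_of_injective _ e.injective, Set.image_preimage_eq _ e.surjective])
  rw [induce_connected_iff] at this ⊢
  obtain ⟨⟨a, ha⟩, hj⟩ := this
  refine ⟨⟨e a, ha⟩, fun a ha b hb => ?_⟩
  obtain ⟨P, hP⟩ := hj (e.symm a) (by simpa) (e.symm b) (by simpa)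
  refine ⟨(P.map e.toHom).copy (by simp) (by simp), fun v hv => ?_⟩
  simp only [Walk.support_copy, Walk.support_map, List.mem_map] at hv
  obtain ⟨w, hw, rfl⟩ := hv
  exact hP w hw

lemma SimpleGraph.IsMinorOf.comap {π : V → W} (hm : H.IsMinorOf F) (hπ : Function.Surjective π)
    (hj : ∀ S a b, JoinIn F S (π a) (π b) → JoinIn G (π ⁻¹' S) a b)
    (hadj : ∀ a b, F.Adj (π a) (π b) → ∃ a' b', π a' = π a ∧ π b' = π b ∧ G.Adj a' b') :
    H.IsMinorOf G := by
  obtain ⟨φ, h1, h2, h3, h4⟩ := hm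
  refine ⟨fun w => π ⁻¹' φ w, fun w => (h1 w).preimage hπ, fun w => induce_connected_iff.2
    ⟨(h1 w).preimage hπ, fun a ha b hb => hj _ a b ((induce_connected_iff.1 (h2 w)).2 _ ha _ hb)⟩,
    fun i j hij => (h3 hij).preimage π, fun i j hij => ?_⟩
  obtain ⟨a, ha, b, hb, e⟩ := h4 hij
  obtain ⟨a, rfl⟩ := hπ a
  obtain ⟨b, rfl⟩ := hπ b
  obtain ⟨a', b', ha', hb', e⟩ := hadj a b e
  exact ⟨a', by rwa [Set.mem_preimage, ha'], b', by rwa [Set.mem_preimage, hb'], e⟩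

lemma SimpleGraph.IsMinorOf.congr (hm : H.IsMinorOf F) (e : G ≃g F) : H.IsMinorOf G := by
  refine hm.comap e.surjective (fun S a b => ?_) fun a b h => ⟨a, b, rfl, rfl, e.map_adj_iff.1 h⟩
  rintro ⟨P, hP⟩
  refine ⟨(P.map e.symm.toHom).copy (by simp) (by simp), fun v hv => ?_⟩
  simp only [Walk.support_copy, Walk.support_map, List.mem_map] at hv
  obtain ⟨w, hw, rfl⟩ := hv
  simpa using hP w hw

lemma SimpleGraph.IsMinorOf.of_contractEdge {V : Type} {G : SimpleGraph V} {u v : V}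
    (huv : G.Adj u v) (hm : H.IsMinorOf (contractEdge G u v)) : H.IsMinorOf G :=
  have h := isContr_contractEdge huv
  hm.comap h.surj (fun _ _ _ => h.joinIn) fun a b e => ((h.adj_iff a b).1 e).2

/-- Minors of the last graph of a chain are minors of the first. -/
lemma HasChain.isMinorOf (h : HasChain G F) (hm : H.IsMinorOf F) : H.IsMinorOf G := by
  obtain ⟨n, seq, ⟨e⟩, ⟨e'⟩, -, hstep⟩ := h
  refine SimpleGraph.IsMinorOf.congr (F := (seq 0).G) ?_ e.symm
  refine Fin.reverseInduction (motive := fun i => H.IsMinorOf (seq i).G) (hm.congr e')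
    (fun i hi => ?_) 0
  obtain ⟨u, v, huv, ⟨f⟩⟩ := hstep i
  exact (hi.congr f.symm).of_contractEdge huv

lemma not_isPlanar_of_hasChain (h : HasChain G (cycleSq 5)) : ¬ IsPlanar G := by
  refine fun hp => hp.1 (h.isMinorOf ⟨fun i => {(i : ZMod 5)}, fun i => ⟨i, rfl⟩, fun i => ?_,
    fun i j hij => ?_, fun i j hij => ⟨i, rfl, j, rfl, ?_⟩⟩)
  · exact induce_connected_iff.2 ⟨⟨i, rfl⟩, by rintro _ rfl _ rfl; exact .refl rfl⟩
  · exact Set.disjoint_singleton.2 hij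
  · have : ∀ i j : ZMod 5, i ≠ j → (cycleSq 5).Adj i j := by
      simp only [cycleSq, fromRel_adj]
      decide
    exact this i j hij

end Chains

section Main

open Finset

lemma Conn4.exists_contr {V : Type*} [Fintype V] {G : SimpleGraph V} (hc : Conn4 G)
    (hn : 6 ≤ Fintype.card V) (hg : ¬ Good G) : ∃ u v, G.Adj u v ∧ Contr G u v := by
  classical
  by_contra! hno
  exact hg (regular_of_no_contr hc hn hno)

theorem Conn4.hasChain (n : ℕ) : ∀ (V : Type) [Fintype V] [DecidableEq V] (G : SimpleGraph V),
    Fintype.card V = n + 6 → Conn4 G → ¬ Good G →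
      (HasChain G (cycleSq 5) ∨ HasChain G (cycleSq 6)) ∧
      (¬ ZPlanar G → HasChain G (cycleSq 5)) := by
  induction n with
  | zero =>
    intro V _ _ G hn hc hg
    obtain ⟨u, v, huv, hcon⟩ := hc.exists_contr hn.ge hg
    have h := isContr_contractEdge huv
    have hF := h.conn4 hc hn.ge hcon
    obtain ⟨e⟩ := hF.nonempty_iso_cycleSq_five (by have := h.card; omega)
    have := HasChain.cons hc.fourConnected huv (.of_iso e hF.fourConnected)
    exact ⟨.inl this, fun _ => this⟩
  | succ n ih =>
    intro V _ _ G hn hc hg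
    have key : ∀ u v, G.Adj u v → Contr G u v →
        (HasChain G (cycleSq 5) ∨ HasChain G (cycleSq 6)) ∧
        (¬ ZPlanar (contractEdge G u v) → HasChain G (cycleSq 5)) := by
      intro u v huv hcon
      have h := isContr_contractEdge huv
      have hF := h.conn4 hc (by omega) hcon
      have lift : ∀ p q, G.Adj p q → Conn4 (contractEdge G p q) → ¬ Good (contractEdge G p q) →
          (HasChain G (cycleSq 5) ∨ HasChain G (cycleSq 6)) ∧
          (¬ ZPlanar (contractEdge G p q) → HasChain G (cycleSq 5)) := by
        intro p q hpq hF hgF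
        have hcard := (isContr_contractEdge hpq).card
        have := ih _ (contractEdge G p q) (by omega) hF hgF
        exact ⟨this.1.imp (.cons hc.fourConnected hpq) (.cons hc.fourConnected hpq),
          fun hZ => .cons hc.fourConnected hpq (this.2 hZ)⟩
      by_cases hgF : Good (contractEdge G u v)
      · rcases n with - | n
        · obtain ⟨e⟩ := nonempty_iso_cycleSq_six (by have := h.card; omega) hgF.1
          exact ⟨.inr (.cons hc.fourConnected huv (.of_iso e hF.fourConnected)), fun hZ =>
            (hZ (zPlanar_cycleSq_six.of_injective e e.injective fun a b => e.map_adj_iff.2)).elim⟩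
        · obtain ⟨p, q, hpq, h1, h2, h3⟩ := hc.exists_not_good huv (by omega) hF hgF
          exact ⟨(lift p q hpq h1 h2).1, fun hZ => (lift p q hpq h1 h2).2 (h3 hZ)⟩
      · exact lift u v huv hF hgF
    obtain ⟨u, v, huv, hcon⟩ := hc.exists_contr (by omega) hg
    refine ⟨(key u v huv hcon).1, fun hZ => ?_⟩
    obtain ⟨p, q, hpq, hcpq, hZ'⟩ : ∃ p q, G.Adj p q ∧ Contr G p q ∧
        ¬ ZPlanar (contractEdge G p q) := by
      by_contra! hno
      exact hZ (ContrZPlanar.zPlanar hno hc (by omega) huv hcon)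
    exact (key p q hpq hcpq).2 hZ'

lemma FourConnected.exists_hasChain {V : Type} [Fintype V] {G : SimpleGraph V}
    (hG : FourConnected G) (hC : ¬ ∃ n : ℕ, 5 ≤ n ∧ Nonempty (G ≃g cycleSq n))
    (hL : ¬ ∃ (W : Type) (H : SimpleGraph W), IsCubic H ∧ CyclicallyFourConnected H ∧
      Nonempty (G ≃g H.lineGraph)) :
    (HasChain G (cycleSq 5) ∨ HasChain G (cycleSq 6)) ∧
      (¬ IsPlanar G → HasChain G (cycleSq 5)) := by
  classical
  have hc := hG.conn4
  have h5 : 5 ≤ Fintype.card V := hc.1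
  rcases h5.eq_or_lt with h5 | h5
  · exact (hC ⟨5, le_rfl, hc.nonempty_iso_cycleSq_five h5.symm⟩).elim
  have hg : ¬ Good G := by
    intro hg
    rcases (Nat.succ_le_of_lt h5).eq_or_lt with h6 | h6
    · exact hC ⟨6, by norm_num, nonempty_iso_cycleSq_six h6.symm hg.1⟩
    · exact (Good.cycleSq_or_lineGraph hc h6 hg).elim hC hL
  have := Conn4.hasChain (Fintype.card V - 6) V G (by omega) hc hg
  exact ⟨this.1, fun hp => this.2 fun hZ => hp hZ.isPlanar⟩

end Main

theorem stmt2 {V : Type*} (G : SimpleGraph V) (hG : FourConnected G)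
    (hC : ¬ ∃ n : ℕ, 5 ≤ n ∧ Nonempty (G ≃g cycleSq n))
    (hL : ¬ ∃ (W : Type) (H : SimpleGraph W), IsCubic H ∧ CyclicallyFourConnected H ∧
      Nonempty (G ≃g H.lineGraph)) :
    (IsPlanar G → ∃ (n : ℕ) (seq : Fin (n + 1) → PGraph),
        IsContractionChain G (cycleSq 6) n seq) ∧
    (¬ IsPlanar G → ∃ (n : ℕ) (seq : Fin (n + 1) → PGraph),
        IsContractionChain G (cycleSq 5) n seq) := by
  have hfin : Finite V := Nat.finite_of_card_ne_zero (by have := hG.1; omega)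
  obtain ⟨n, ⟨e⟩⟩ := Finite.exists_equiv_fin V
  let i : G ≃g G.map e.toEmbedding := Iso.map e G
  have h := (hG.congr i).exists_hasChain
    (fun ⟨n, hn, ⟨f⟩⟩ => hC ⟨n, hn, ⟨i.trans f⟩⟩)
    (fun ⟨W, H, h1, h2, ⟨f⟩⟩ => hL ⟨W, H, h1, h2, ⟨i.trans f⟩⟩)
  refine ⟨fun hp => ?_, fun hp => ?_⟩
  · refine h.1.elim (fun h => ?_) fun h => h.congr_left i.symm
    exact (not_isPlanar_of_hasChain (h.congr_left i.symm) hp).elim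
  · exact (h.2 fun hp' => hp ⟨fun hm => hp'.1 (hm.congr i.symm),
      fun hm => hp'.2 (hm.congr i.symm)⟩).congr_left i.symm
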